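/- There exist t₀ ∈ [0, T) and C > 0 such that for all t ∈ [t₀, T): sup_{x ∈ ℝⁿ} |u(x,t)| ≤ C (T - t)^{-1/(p-1)}; equivalently, the rescaled functions w_{b,T} satisfy ‖w_{b,T}(·,s)‖_{L^∞(ℝⁿ)} ≤ C for every b ∈ ℝⁿ and all s ≥ -log(T - t₀). -/

import Mathlib

open MeasureTheory Real Filter Topology

noncomputable def hfun (p a μ : ℝ) (z : ℝ) : ℝ :=
  μ * |z| ^ (p - 1) * z / (Real.log (2 + z ^ 2)) ^ a

noncomputable def rho (n : ℕ) (y : EuclideanSpace ℝ (Fin n)) : ℝ :=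
  (4 * Real.pi) ^ (-(n : ℝ) / 2) * Real.exp (-‖y‖ ^ 2 / 4)

noncomputable def lap (n : ℕ) (f : EuclideanSpace ℝ (Fin n) → ℝ)
    (y : EuclideanSpace ℝ (Fin n)) : ℝ :=
  ∑ i : Fin n, fderiv ℝ (fun z => fderiv ℝ f z (EuclideanSpace.single i 1)) y
      (EuclideanSpace.single i 1)

/-- `u` is a classical solution of `u_t = Δu + |u|^{p-1}u + h(u)` on `ℝⁿ × [0,T)`,
bounded on `ℝⁿ × [0,t]` for every `t < T`, blowing up at time `T`. -/
def SolvesU (n : ℕ) (p a μ T : ℝ) (u : EuclideanSpace ℝ (Fin n) → ℝ → ℝ) : Prop :=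
  (∀ t ∈ Set.Ico (0:ℝ) T, ContDiff ℝ 2 (fun x => u x t)) ∧
  (∀ x, ∀ t ∈ Set.Ico (0:ℝ) T, DifferentiableAt ℝ (fun t' => u x t') t) ∧
  (∀ x, ∀ t ∈ Set.Ico (0:ℝ) T,
    deriv (fun t' => u x t') t =
      lap n (fun z => u z t) x + |u x t| ^ (p - 1) * u x t + hfun p a μ (u x t)) ∧
  (∀ t ∈ Set.Ico (0:ℝ) T, ∃ M : ℝ, ∀ x, ∀ t' ∈ Set.Icc (0:ℝ) t, |u x t'| ≤ M) ∧
  (∀ M : ℝ, ∃ t₁ ∈ Set.Ico (0:ℝ) T, ∀ t ∈ Set.Ico t₁ T, ∃ x, M ≤ |u x t|)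

/-- The similarity-variables rescaled solution
`w_{b,T}(y,s) = (T-t)^{1/(p-1)} u(b + y√(T-t), t)` with `t = T - e^{-s}`. -/
noncomputable def wSelf (n : ℕ) (p T : ℝ) (u : EuclideanSpace ℝ (Fin n) → ℝ → ℝ)
    (b y : EuclideanSpace ℝ (Fin n)) (s : ℝ) : ℝ :=
  Real.exp (-s / (p - 1)) * u (b + Real.exp (-s / 2) • y) (T - Real.exp (-s))

/-- `b` is a blow-up point of `u`: there exist `(xₖ, tₖ) → (b, T)` with `|u(xₖ,tₖ)| → ∞`. -/
def BlowupPt (n : ℕ) (T : ℝ) (u : EuclideanSpace ℝ (Fin n) → ℝ → ℝ)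
    (b : EuclideanSpace ℝ (Fin n)) : Prop :=
  ∃ x : ℕ → EuclideanSpace ℝ (Fin n), ∃ t : ℕ → ℝ,
    (∀ k, t k ∈ Set.Ico (0:ℝ) T) ∧ Tendsto x atTop (nhds b) ∧ Tendsto t atTop (nhds T) ∧
    Tendsto (fun k => |u (x k) (t k)|) atTop atTop

section Gaussian

variable {n : ℕ}

abbrev Eu (n : ℕ) := EuclideanSpace ℝ (Fin n)

/-- The `i`-th standard basis vector. -/
noncomputable abbrev bv (i : Fin n) : Eu n := EuclideanSpace.single i (1 : ℝ)

/-- `G` has polynomial growth in the space variable, uniformly for parameters in `S`. -/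
def PolyGrowth {ι : Type*} (S : Set ι) (G : Eu n → ι → ℝ) : Prop :=
  ∃ A : ℝ, ∃ k : ℕ, 0 ≤ A ∧ ∀ s ∈ S, ∀ y, |G y s| ≤ A * (1 + ‖y‖) ^ k

lemma one_add_norm_pow_le {k m : ℕ} (h : k ≤ m) (y : Eu n) :
    (1 + ‖y‖) ^ k ≤ (1 + ‖y‖) ^ m :=
  pow_le_pow_right₀ (by linarith [norm_nonneg y]) h

namespace PolyGrowth

variable {ι : Type*} {S : Set ι} {G H : Eu n → ι → ℝ}

lemma of_bdd {M : ℝ} (h : ∀ s ∈ S, ∀ y, |G y s| ≤ M) : PolyGrowth S G :=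
  ⟨|M|, 0, abs_nonneg M, fun s hs y => by simpa using (h s hs y).trans (le_abs_self M)⟩

lemma const (c : ℝ) : PolyGrowth S (fun (_ : Eu n) _ => c) := of_bdd (fun _ _ _ => le_rfl)

lemma of_le (h : PolyGrowth S G) (hH : ∀ s ∈ S, ∀ y, |H y s| ≤ |G y s|) : PolyGrowth S H := by
  obtain ⟨A, k, hA, h⟩ := h
  exact ⟨A, k, hA, fun s hs y => (hH s hs y).trans (h s hs y)⟩

lemma add (hG : PolyGrowth S G) (hH : PolyGrowth S H) :
    PolyGrowth S (fun y s => G y s + H y s) := by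
  obtain ⟨A, k, hA, h⟩ := hG
  obtain ⟨B, m, hB, h'⟩ := hH
  refine ⟨A + B, max k m, by positivity, fun s hs y => (abs_add_le _ _).trans ?_⟩
  rw [add_mul]
  exact add_le_add
    ((h s hs y).trans (mul_le_mul_of_nonneg_left (one_add_norm_pow_le (le_max_left _ _) y) hA))
    ((h' s hs y).trans (mul_le_mul_of_nonneg_left (one_add_norm_pow_le (le_max_right _ _) y) hB))

lemma mul (hG : PolyGrowth S G) (hH : PolyGrowth S H) :
    PolyGrowth S (fun y s => G y s * H y s) := by
  obtain ⟨A, k, hA, h⟩ := hG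
  obtain ⟨B, m, hB, h'⟩ := hH
  refine ⟨A * B, k + m, by positivity, fun s hs y => ?_⟩
  rw [abs_mul, pow_add]
  calc |G y s| * |H y s| ≤ (A * (1 + ‖y‖) ^ k) * (B * (1 + ‖y‖) ^ m) :=
        mul_le_mul (h s hs y) (h' s hs y) (abs_nonneg _) (by positivity)
    _ = _ := by ring

lemma neg (hG : PolyGrowth S G) : PolyGrowth S (fun y s => -G y s) :=
  hG.of_le (fun s _ y => by simp)

lemma sub (hG : PolyGrowth S G) (hH : PolyGrowth S H) :
    PolyGrowth S (fun y s => G y s - H y s) := by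
  simpa [sub_eq_add_neg] using hG.add hH.neg

lemma const_mul (c : ℝ) (hG : PolyGrowth S G) : PolyGrowth S (fun y s => c * G y s) :=
  (const c).mul hG

lemma pow (hG : PolyGrowth S G) (m : ℕ) : PolyGrowth S (fun y s => G y s ^ m) := by
  induction m with
  | zero => simpa using const (1 : ℝ)
  | succ m ih => simpa [pow_succ] using ih.mul hG

lemma sum {κ : Type*} (t : Finset κ) {G : κ → Eu n → ι → ℝ} (h : ∀ j ∈ t, PolyGrowth S (G j)) :
    PolyGrowth S (fun y s => ∑ j ∈ t, G j y s) := by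
  classical
  induction t using Finset.induction_on with
  | empty => simpa using const (0 : ℝ)
  | insert j t hj ih =>
    simp only [Finset.sum_insert hj]
    exact (h j (by simp)).add (ih fun i hi => h i (by simp [hi]))

lemma norm : PolyGrowth S (fun (y : Eu n) _ => ‖y‖) :=
  ⟨1, 1, zero_le_one, fun s _ y => by simp⟩

lemma coord (i : Fin n) : PolyGrowth S (fun (y : Eu n) _ => y i) :=
  norm.of_le (fun s _ y => by
    rw [abs_norm]; simpa using PiLp.norm_apply_le y i)

end PolyGrowth

lemma rho_pos (y : Eu n) : 0 < rho n y := by unfold rho; positivity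

lemma continuous_rho : Continuous (rho n) := by unfold rho; fun_prop

lemma one_add_pow_mul_exp_le (k : ℕ) {r : ℝ} (hr : 0 ≤ r) :
    (1 + r) ^ k * Real.exp (-r ^ 2 / 4) ≤ (k.factorial * Real.exp 3) * Real.exp (-(1 / 8) * r ^ 2) := by
  have h1 : (1 + r) ^ k ≤ k.factorial * Real.exp (1 + r) := by
    have := Real.pow_div_factorial_le_exp (x := 1 + r) (by linarith) k
    rwa [div_le_iff₀ (by positivity), mul_comm] at this
  calc _ ≤ k.factorial * Real.exp (1 + r) * Real.exp (-r ^ 2 / 4) := by gcongr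
    _ = k.factorial * Real.exp (1 + r + -r ^ 2 / 4) := by rw [Real.exp_add (1 + r)]; ring
    _ ≤ k.factorial * Real.exp (3 + -(1 / 8) * r ^ 2) := by
        refine mul_le_mul_of_nonneg_left (Real.exp_le_exp.2 ?_) (by positivity)
        nlinarith [sq_nonneg (r - 4)]
    _ = _ := by rw [Real.exp_add]; ring

lemma integrable_exp_neg_norm_sq {b : ℝ} (hb : 0 < b) :
    Integrable (fun y : Eu n => Real.exp (-b * ‖y‖ ^ 2)) := by
  have := GaussianFourier.integrable_cexp_neg_mul_sq_norm_add (V := Eu n) (b := (b : ℂ))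
    (by simpa using hb) 0 0
  have h2 := this.norm
  refine h2.congr (Eventually.of_forall fun y => ?_)
  simp only [zero_mul, add_zero, Complex.norm_exp]
  congr 1
  have : (-(b:ℂ) * (‖y‖:ℂ) ^ 2) = ((-b * ‖y‖ ^ 2 : ℝ) : ℂ) := by push_cast; ring
  rw [this, Complex.ofReal_re]

lemma integrable_pow_mul_rho (k : ℕ) : Integrable (fun y : Eu n => (1 + ‖y‖) ^ k * rho n y) := by
  refine Integrable.mono' ((integrable_exp_neg_norm_sq (n := n) (b := 1 / 8) (by norm_num)).const_mul
    ((4 * Real.pi) ^ (-(n : ℝ) / 2) * (k.factorial * Real.exp 3)))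
    (by have := continuous_rho (n := n); exact (by fun_prop : Continuous _).aestronglyMeasurable)
    (Eventually.of_forall fun y => ?_)
  rw [Real.norm_of_nonneg (mul_nonneg (by positivity) (rho_pos y).le)]
  have := one_add_pow_mul_exp_le k (norm_nonneg y)
  unfold rho
  calc _ = (4 * Real.pi) ^ (-(n : ℝ) / 2) * ((1 + ‖y‖) ^ k * Real.exp (-‖y‖ ^ 2 / 4)) := by ring
    _ ≤ (4 * Real.pi) ^ (-(n : ℝ) / 2) *
        ((k.factorial * Real.exp 3) * Real.exp (-(1 / 8) * ‖y‖ ^ 2)) := by gcongr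
    _ = _ := by ring

lemma integrable_rho : Integrable (rho n) := by
  simpa using integrable_pow_mul_rho (n := n) 0

lemma integral_rho : ∫ y, rho n y = 1 := by
  unfold rho
  rw [integral_const_mul]
  have := GaussianFourier.integral_rexp_neg_mul_sq_norm (V := Eu n) (b := 1 / 4) (by norm_num)
  have h2 : ∀ y : Eu n, Real.exp (-‖y‖ ^ 2 / 4) = Real.exp (-(1 / 4) * ‖y‖ ^ 2) := by
    intro y; congr 1; ring
  simp only [h2]
  rw [this, finrank_euclideanSpace_fin]
  have : Real.pi / (1 / 4) = 4 * Real.pi := by ring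
  rw [this, ← Real.rpow_add (by positivity)]
  have : -(n : ℝ) / 2 + (n : ℝ) / 2 = 0 := by ring
  rw [this, Real.rpow_zero]

lemma PolyGrowth.integrable {ι : Type*} {S : Set ι} {G : Eu n → ι → ℝ} (h : PolyGrowth S G)
    {s : ι} (hs : s ∈ S) (hm : AEStronglyMeasurable (fun y => G y s)) :
    Integrable (fun y => G y s * rho n y) := by
  obtain ⟨A, k, hA, h⟩ := h
  refine Integrable.mono' ((integrable_pow_mul_rho (n := n) k).const_mul A)
    (hm.mul continuous_rho.aestronglyMeasurable) (Eventually.of_forall fun y => ?_)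
  rw [norm_mul, Real.norm_of_nonneg (rho_pos y).le, ← mul_assoc]
  exact mul_le_mul_of_nonneg_right (h s hs y) (rho_pos y).le

/-- Integrability against `rho` of a single function of polynomial growth. -/
lemma integrable_mul_rho {g : Eu n → ℝ} (h : PolyGrowth (Set.univ : Set Unit) (fun y _ => g y))
    (hm : AEStronglyMeasurable g) : Integrable (fun y => g y * rho n y) :=
  h.integrable (s := ()) trivial hm

lemma integrable_mul_rho_of_bdd {g : Eu n → ℝ} {M : ℝ} (h : ∀ y, |g y| ≤ M)
    (hm : AEStronglyMeasurable g) : Integrable (fun y => g y * rho n y) :=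
  integrable_mul_rho (PolyGrowth.of_bdd fun _ _ => h) hm

lemma abs_integral_mul_rho_le {g : Eu n → ℝ} {M : ℝ} (h : ∀ y, |g y| ≤ M) :
    |∫ y, g y * rho n y| ≤ M := by
  have h1 : ‖∫ y, g y * rho n y‖ ≤ ∫ y, M * rho n y := by
    refine norm_integral_le_of_norm_le (integrable_rho.const_mul M) (Eventually.of_forall fun y => ?_)
    rw [norm_mul, Real.norm_of_nonneg (rho_pos y).le]
    exact mul_le_mul_of_nonneg_right (h y) (rho_pos y).le
  rwa [integral_const_mul, integral_rho, mul_one] at h1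

lemma hasLineDerivAt_norm_sq (y : Eu n) (i : Fin n) :
    HasDerivAt (fun r : ℝ => ‖y + r • bv i‖ ^ 2) (2 * y i) 0 := by
  have h : ∀ r : ℝ, ‖y + r • bv i‖ ^ 2 = ‖y‖ ^ 2 + 2 * r * y i + r ^ 2 := by
    intro r
    rw [norm_add_sq_real, inner_smul_right, norm_smul]
    simp [EuclideanSpace.inner_single_right]
    ring
  simp only [h]
  have := (((hasDerivAt_id (0:ℝ)).const_mul 2).mul_const (y i)).const_add (‖y‖ ^ 2) |>.add
    ((hasDerivAt_id (0:ℝ)).pow 2)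
  exact this.congr_deriv (by simp)

lemma hasLineDerivAt_rho (y : Eu n) (i : Fin n) :
    HasLineDerivAt ℝ (rho n) (-(1 / 2) * y i * rho n y) y (bv i) := by
  unfold HasLineDerivAt rho
  have := (((hasLineDerivAt_norm_sq y i).neg.div_const 4).exp).const_mul
    ((4 * Real.pi) ^ (-(n : ℝ) / 2))
  exact this.congr_deriv (by simp; ring)

/-- Gaussian integration by parts. -/
lemma integral_lineDeriv_mul_rho {φ φ' : Eu n → ℝ} {i : Fin n}
    (hd : ∀ y, HasLineDerivAt ℝ φ (φ' y) y (bv i))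
    (hφ : PolyGrowth (Set.univ : Set Unit) (fun y _ => φ y))
    (hφ' : PolyGrowth (Set.univ : Set Unit) (fun y _ => φ' y))
    (hm : AEStronglyMeasurable φ) (hm' : AEStronglyMeasurable φ') :
    ∫ y, φ' y * rho n y = 1 / 2 * ∫ y, y i * φ y * rho n y := by
  have hc : AEStronglyMeasurable (fun y : Eu n => y i) volume :=
    (by fun_prop : Continuous fun y : Eu n => y i).aestronglyMeasurable
  have key := integral_bilinear_hasLineDerivAt_right_eq_neg_left_of_integrable
    (μ := volume) (f := φ) (f' := φ') (g := rho n) (g' := fun y => -(1 / 2) * y i * rho n y)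
    (v := bv i) (B := ContinuousLinearMap.mul ℝ ℝ)
    (by simpa using integrable_mul_rho hφ' hm')
    (by
      have := (integrable_mul_rho (g := fun y => y i * φ y) ((PolyGrowth.coord i).mul hφ)
        (hc.mul hm)).const_mul (-(1 / 2))
      refine this.congr (Eventually.of_forall fun y => ?_)
      simp; ring)
    (by simpa using integrable_mul_rho hφ hm) (fun y _ => hd y)
    (fun y _ => hasLineDerivAt_rho y i)
  simp only [ContinuousLinearMap.mul_apply'] at key
  have h2 : ∀ y : Eu n, φ y * (-(1 / 2) * y i * rho n y) = -(1 / 2) * (y i * φ y * rho n y) := by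
    intro y; ring
  simp only [h2] at key
  rw [integral_const_mul] at key
  linarith

lemma integral_coord_sq_mul_rho (i : Fin n) : ∫ y : Eu n, y i ^ 2 * rho n y = 2 := by
  have := integral_lineDeriv_mul_rho (φ := fun y : Eu n => y i) (φ' := fun _ => 1) (i := i)
    (fun y => by
      unfold HasLineDerivAt
      have := (hasDerivAt_id (0:ℝ)).const_add (y i)
      simpa using this)
    (PolyGrowth.coord i) (PolyGrowth.const 1)
    (by fun_prop : Continuous fun y : Eu n => y i).aestronglyMeasurable
    aestronglyMeasurable_const
  simp only [one_mul, integral_rho, ← sq] at this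
  linarith

lemma integral_norm_sq_mul_rho : ∫ y : Eu n, ‖y‖ ^ 2 * rho n y = 2 * n := by
  have h : ∀ y : Eu n, ‖y‖ ^ 2 * rho n y = ∑ i, y i ^ 2 * rho n y := by
    intro y
    rw [EuclideanSpace.norm_sq_eq, Finset.sum_mul]
    simp
  simp only [h]
  rw [integral_finsetSum]
  · simp only [integral_coord_sq_mul_rho]
    simp [mul_comm]
  · intro i _
    exact integrable_mul_rho ((PolyGrowth.coord i).pow 2)
      (by fun_prop : Continuous fun y : Eu n => y i ^ 2).aestronglyMeasurable

lemma rho_smul_le {k : ℝ} (hk : 1 ≤ k) (y : Eu n) : rho n (k • y) ≤ rho n y := by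
  unfold rho
  gcongr
  rw [norm_smul, Real.norm_of_nonneg (by linarith)]
  nlinarith [norm_nonneg y, mul_nonneg (by linarith : (0:ℝ) ≤ k - 1) (norm_nonneg y)]

lemma integral_scaled_mul_rho_le {g : Eu n → ℝ} (hg : ∀ y, 0 ≤ g y) {k : ℝ} (hk : 1 ≤ k)
    (hi : Integrable (fun y => g y * rho n y)) :
    ∫ z, g (k⁻¹ • z) * rho n z ≤ k ^ n * ∫ y, g y * rho n y := by
  have hk0 : 0 < k := by linarith
  have h1 := Measure.integral_comp_smul (μ := (volume : Measure (Eu n)))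
    (fun y => g y * rho n (k • y)) k⁻¹
  have h2 : ∀ z : Eu n, k • (k⁻¹ • z) = z := fun z => smul_inv_smul₀ hk0.ne' z
  simp only [h2] at h1
  rw [h1, finrank_euclideanSpace_fin, smul_eq_mul, abs_of_nonneg (by positivity), inv_pow, inv_inv]
  refine mul_le_mul_of_nonneg_left ?_ (by positivity)
  exact integral_mono_of_nonneg (Eventually.of_forall fun y => mul_nonneg (hg y) (rho_pos _).le) hi
    (Eventually.of_forall fun y => mul_le_mul_of_nonneg_left (rho_smul_le hk y) (hg y))

/-- Parametric Gaussian integrals are continuous. -/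
lemma continuousOn_integral_rho {X : Type*} [TopologicalSpace X] [FirstCountableTopology X]
    {S : Set X} {G : Eu n → X → ℝ}
    (hS : IsOpen S) (hg : PolyGrowth S G) (hc : ∀ y, ContinuousOn (fun s => G y s) S)
    (hm : ∀ s ∈ S, AEStronglyMeasurable (fun y => G y s)) :
    ContinuousOn (fun s => ∫ y, G y s * rho n y) S := by
  obtain ⟨A, k, hA, h⟩ := hg
  intro s hs
  refine ContinuousAt.continuousWithinAt ?_
  refine continuousAt_of_dominated (bound := fun y => A * ((1 + ‖y‖) ^ k * rho n y)) ?_ ?_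
    ((integrable_pow_mul_rho k).const_mul A) ?_
  · filter_upwards [hS.mem_nhds hs] with s' hs'
    exact (hm s' hs').mul continuous_rho.aestronglyMeasurable
  · filter_upwards [hS.mem_nhds hs] with s' hs'
    refine Eventually.of_forall fun y => ?_
    rw [norm_mul, Real.norm_of_nonneg (rho_pos y).le, ← mul_assoc]
    exact mul_le_mul_of_nonneg_right (h s' hs' y) (rho_pos y).le
  · refine Eventually.of_forall fun y => ?_
    exact ((hc y).continuousAt (hS.mem_nhds hs)).mul_const _

lemma hasDerivAt_integral_rho {S : Set ℝ} {G G' : Eu n → ℝ → ℝ} (hS : IsOpen S)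
    (hg : PolyGrowth S G) (hg' : PolyGrowth S G')
    (hm : ∀ s ∈ S, AEStronglyMeasurable (fun y => G y s))
    (hm' : ∀ s ∈ S, AEStronglyMeasurable (fun y => G' y s))
    (hd : ∀ y, ∀ s ∈ S, HasDerivAt (fun s => G y s) (G' y s) s) {s : ℝ} (hs : s ∈ S) :
    HasDerivAt (fun s => ∫ y, G y s * rho n y) (∫ y, G' y s * rho n y) s := by
  have hi := hg.integrable hs (hm s hs)
  obtain ⟨A, k, hA, h⟩ := hg'
  refine (hasDerivAt_integral_of_dominated_loc_of_deriv_le (F := fun s y => G y s * rho n y)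
    (F' := fun s y => G' y s * rho n y)
    (bound := fun y => A * ((1 + ‖y‖) ^ k * rho n y)) (hS.mem_nhds hs) ?_ hi ?_ ?_
    ((integrable_pow_mul_rho k).const_mul A) ?_).2
  · filter_upwards [hS.mem_nhds hs] with s' hs'
    exact (hm s' hs').mul continuous_rho.aestronglyMeasurable
  · exact (hm' s hs).mul continuous_rho.aestronglyMeasurable
  · refine Eventually.of_forall fun y s' hs' => ?_
    rw [norm_mul, Real.norm_of_nonneg (rho_pos y).le, ← mul_assoc]
    exact mul_le_mul_of_nonneg_right (h s' hs' y) (rho_pos y).le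
  · exact Eventually.of_forall fun y s' hs' => (hd y s' hs').mul_const _

end Gaussian

section Heat

variable {n : ℕ}

/-- The heat semigroup on `ℝⁿ`. -/
noncomputable def heat (h : ℝ) (φ : Eu n → ℝ) (x : Eu n) : ℝ :=
  ∫ y, φ (x + √h • y) * rho n y

/-- Partial derivative in the direction of the `i`-th basis vector. -/
noncomputable def pd (i : Fin n) (φ : Eu n → ℝ) (x : Eu n) : ℝ := fderiv ℝ φ x (bv i)

lemma lap_eq_sum_pd (φ : Eu n → ℝ) (x : Eu n) : lap n φ x = ∑ i, pd i (pd i φ) x := rfl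

lemma heat_zero (φ : Eu n → ℝ) (x : Eu n) : heat 0 φ x = φ x := by
  simp [heat, integral_const_mul, integral_rho]

lemma measurable_heat_arg {φ : Eu n → ℝ} (hφ : Continuous φ) (h : ℝ) (x : Eu n) :
    AEStronglyMeasurable (fun y => φ (x + √h • y)) volume :=
  (by fun_prop : Continuous fun y => φ (x + √h • y)).aestronglyMeasurable

lemma integrable_heat {φ : Eu n → ℝ} (hφ : Continuous φ) {M : ℝ} (hM : ∀ y, |φ y| ≤ M) (h : ℝ)
    (x : Eu n) : Integrable (fun y => φ (x + √h • y) * rho n y) :=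
  integrable_mul_rho_of_bdd (fun _ => hM _) (measurable_heat_arg hφ h x)

lemma abs_heat_le {φ : Eu n → ℝ} {M : ℝ} (hM : ∀ y, |φ y| ≤ M) (h : ℝ) (x : Eu n) :
    |heat h φ x| ≤ M :=
  abs_integral_mul_rho_le fun _ => hM _

lemma heat_add {φ ψ : Eu n → ℝ} (hφ : Continuous φ) (hψ : Continuous ψ) {M M' : ℝ}
    (hM : ∀ y, |φ y| ≤ M) (hM' : ∀ y, |ψ y| ≤ M') (h : ℝ) (x : Eu n) :
    heat h (fun y => φ y + ψ y) x = heat h φ x + heat h ψ x := by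
  unfold heat
  rw [← integral_add (integrable_heat hφ hM h x) (integrable_heat hψ hM' h x)]
  congr 1; ext y; ring

lemma heat_neg (φ : Eu n → ℝ) (h : ℝ) (x : Eu n) :
    heat h (fun y => -φ y) x = -heat h φ x := by
  unfold heat
  rw [← integral_neg]; congr 1; ext y; ring

/-- A Chebyshev type bound for the heat semigroup. -/
lemma heat_le_of_le_on_ball {φ : Eu n → ℝ} (hφ : Continuous φ) {M : ℝ} (hM : ∀ y, |φ y| ≤ M)
    {h : ℝ} (hh : 0 ≤ h) {x : Eu n} {r c : ℝ} (hr : 0 < r)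
    (hc : ∀ y ∈ Metric.closedBall x r, φ y ≤ c) :
    heat h φ x ≤ c + 4 * n * M * h / r ^ 2 := by
  have hM0 : 0 ≤ M := (abs_nonneg _).trans (hM x)
  have hcM : -M ≤ c := (neg_le_of_abs_le (hM x)).trans (hc x (by simp [hr.le]))
  have h1 : Integrable fun y : Eu n => (c + 2 * M * h / r ^ 2 * ‖y‖ ^ 2) * rho n y :=
    integrable_mul_rho (g := fun y => c + 2 * M * h / r ^ 2 * ‖y‖ ^ 2)
      ((PolyGrowth.const _).add ((PolyGrowth.norm.pow 2).const_mul _))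
      (by fun_prop : Continuous fun y : Eu n => c + 2 * M * h / r ^ 2 * ‖y‖ ^ 2).aestronglyMeasurable
  have h2 : heat h φ x ≤ ∫ y : Eu n, (c + 2 * M * h / r ^ 2 * ‖y‖ ^ 2) * rho n y := by
    refine integral_mono (integrable_heat hφ hM h x) h1 fun y => ?_
    refine mul_le_mul_of_nonneg_right ?_ (rho_pos y).le
    by_cases hy : x + √h • y ∈ Metric.closedBall x r
    · exact (hc _ hy).trans (le_add_of_nonneg_right (by positivity))
    · simp only [Metric.mem_closedBall, dist_self_add_left, norm_smul,
        Real.norm_of_nonneg (Real.sqrt_nonneg h), not_le] at hy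
      have h3 : r ^ 2 ≤ h * ‖y‖ ^ 2 := by
        have : r ^ 2 ≤ (√h * ‖y‖) ^ 2 := by gcongr
        rwa [mul_pow, Real.sq_sqrt hh] at this
      have h4 : 2 * M ≤ 2 * M * h / r ^ 2 * ‖y‖ ^ 2 := by
        rw [div_mul_eq_mul_div, le_div_iff₀ (by positivity), mul_assoc (2 * M)]
        gcongr
      have := le_of_abs_le (hM (x + √h • y))
      linarith
  have h5 : ∫ y : Eu n, (c + 2 * M * h / r ^ 2 * ‖y‖ ^ 2) * rho n y
      = c + 2 * M * h / r ^ 2 * (2 * n) := by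
    have : ∀ y : Eu n, (c + 2 * M * h / r ^ 2 * ‖y‖ ^ 2) * rho n y =
      c * rho n y + 2 * M * h / r ^ 2 * (‖y‖ ^ 2 * rho n y) := by intro y; ring
    simp only [this]
    rw [integral_add (integrable_rho.const_mul c), integral_const_mul, integral_const_mul,
      integral_rho, integral_norm_sq_mul_rho, mul_one]
    exact (integrable_mul_rho (PolyGrowth.norm.pow 2)
      (by fun_prop : Continuous fun y : Eu n => ‖y‖ ^ 2).aestronglyMeasurable).const_mul _
  rw [h5] at h2
  convert h2 using 2
  ring

lemma continuous_heat {φ : Eu n → ℝ} (hφ : Continuous φ) {M : ℝ} (hM : ∀ y, |φ y| ≤ M) :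
    Continuous (fun P : Eu n × ℝ => heat P.2 φ P.1) := by
  unfold heat
  rw [← continuousOn_univ]
  refine continuousOn_integral_rho (G := fun y (P : Eu n × ℝ) => φ (P.1 + √P.2 • y)) isOpen_univ
    (PolyGrowth.of_bdd fun _ _ _ => hM _) (fun y => ?_) (fun P _ => measurable_heat_arg hφ _ _)
  have : Continuous fun P : Eu n × ℝ => φ (P.1 + √P.2 • y) := by fun_prop
  exact this.continuousOn

lemma HasLineDerivAt.comp_line {g : Eu n → ℝ} {g' : Eu n → ℝ} {v : Eu n}
    (hd : ∀ x, HasLineDerivAt ℝ g (g' x) x v) (x : Eu n) (r : ℝ) :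
    HasDerivAt (fun r : ℝ => g (x + r • v)) (g' (x + r • v)) r := by
  have h := hd (x + r • v)
  unfold HasLineDerivAt at h
  have h2 : HasDerivAt (fun t : ℝ => g (x + r • v + t • v)) (g' (x + r • v)) (r - r) := by
    simpa using h
  refine (h2.comp_sub_const r r).congr_of_eventuallyEq (Eventually.of_forall fun s => ?_)
  exact congrArg g (by module)

lemma hasLineDerivAt_heat {g g' : Eu n → ℝ} {v : Eu n} (hd : ∀ x, HasLineDerivAt ℝ g (g' x) x v)
    (hg : Continuous g) (hg' : Continuous g') {M M' : ℝ} (hM : ∀ y, |g y| ≤ M)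
    (hM' : ∀ y, |g' y| ≤ M') (h : ℝ) (x : Eu n) :
    HasLineDerivAt ℝ (heat h g) (heat h g' x) x v := by
  unfold HasLineDerivAt heat
  have := hasDerivAt_integral_rho (G := fun y r => g (x + r • v + √h • y))
    (G' := fun y r => g' (x + r • v + √h • y)) (S := Set.univ) isOpen_univ
    (PolyGrowth.of_bdd fun _ _ _ => hM _) (PolyGrowth.of_bdd fun _ _ _ => hM' _)
    (fun r _ => measurable_heat_arg hg h _) (fun r _ => measurable_heat_arg hg' h _)
    (fun y r _ => ?_) (s := 0) trivial
  · simpa using this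
  · have := HasLineDerivAt.comp_line hd (x + √h • y) r
    simpa only [add_right_comm x (√h • y)] using this

/-- Bounded `C²` functions with bounded derivatives. -/
structure C2b (φ : Eu n → ℝ) : Prop where
  contDiff : ContDiff ℝ 2 φ
  bdd : ∃ M, ∀ x, |φ x| ≤ M
  bdd_pd : ∃ M, ∀ i x, |pd i φ x| ≤ M
  bdd_pd_pd : ∃ M, ∀ i x, |pd i (pd i φ) x| ≤ M

lemma contDiff_pd {φ : Eu n → ℝ} {m : ℕ} (h : ContDiff ℝ (m + 1 : ℕ) φ) (i : Fin n) :
    ContDiff ℝ m (pd i φ) :=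
  (h.fderiv_right (m := m) (by norm_cast)).clm_apply contDiff_const

lemma hasLineDerivAt_pd {φ : Eu n → ℝ} (h : Differentiable ℝ φ) (i : Fin n) (x : Eu n) :
    HasLineDerivAt ℝ φ (pd i φ x) x (bv i) :=
  (h x).hasFDerivAt.hasLineDerivAt _

lemma fderiv_eq_sum_pd (φ : Eu n → ℝ) (x y : Eu n) : fderiv ℝ φ x y = ∑ i, y i * pd i φ x := by
  have h : y = ∑ i, y i • bv i := by
    ext j
    simp [Finset.sum_apply, Pi.single_apply]
  conv_lhs => rw [h]
  simp [pd]

namespace C2b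

variable {φ : Eu n → ℝ}

lemma differentiable (h : C2b φ) : Differentiable ℝ φ := h.contDiff.differentiable (by norm_num)

lemma contDiff_pd (h : C2b φ) (i : Fin n) : ContDiff ℝ 1 (pd i φ) :=
  _root_.contDiff_pd (m := 1) (by exact_mod_cast h.contDiff) i

lemma continuous_pd_pd (h : C2b φ) (i : Fin n) : Continuous (pd i (pd i φ)) :=
  (_root_.contDiff_pd (m := 0) (by exact_mod_cast h.contDiff_pd i) i).continuous

lemma lineDeriv_pd (h : C2b φ) (i : Fin n) (x : Eu n) :
    HasLineDerivAt ℝ (pd i φ) (pd i (pd i φ) x) x (bv i) :=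
  hasLineDerivAt_pd ((h.contDiff_pd i).differentiable (by norm_num)) i x

lemma continuous_lap (h : C2b φ) : Continuous (lap n φ) := by
  have : lap n φ = fun x => ∑ i, pd i (pd i φ) x := rfl
  rw [this]
  exact continuous_finsetSum _ fun i _ => h.continuous_pd_pd i

lemma bdd_lap (h : C2b φ) : ∃ M, ∀ x, |lap n φ x| ≤ M := by
  obtain ⟨M, hM⟩ := h.bdd_pd_pd
  refine ⟨∑ _i : Fin n, M, fun x => ?_⟩
  rw [lap_eq_sum_pd]
  exact (Finset.abs_sum_le_sum_abs _ _).trans (Finset.sum_le_sum fun i _ => hM i x)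

lemma heat_lap (h : C2b φ) (t : ℝ) (x : Eu n) :
    heat t (lap n φ) x = ∑ i, heat t (pd i (pd i φ)) x := by
  obtain ⟨M, hM⟩ := h.bdd_pd_pd
  unfold heat
  rw [← integral_finsetSum _ fun i _ => integrable_heat (h.continuous_pd_pd i) (hM i) t x]
  simp only [lap_eq_sum_pd, Finset.sum_mul]

/-- The heat semigroup solves the heat equation. -/
lemma hasDerivAt_heat (h : C2b φ) (x : Eu n) {t : ℝ} (ht : 0 < t) :
    HasDerivAt (fun t => heat t φ x) (heat t (lap n φ) x) t := by
  obtain ⟨M, hM⟩ := h.bdd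
  obtain ⟨M1, hM1⟩ := h.bdd_pd
  obtain ⟨M2, hM2⟩ := h.bdd_pd_pd
  have hci : ∀ i, Continuous (pd i φ) := fun i => (h.contDiff_pd i).continuous
  have hgr : ∀ i, PolyGrowth (Set.Ioi (t / 2)) fun y s => y i * pd i φ (x + √s • y) := fun i =>
    (PolyGrowth.coord i).mul (PolyGrowth.of_bdd fun _ _ _ => hM1 i _)
  have hbd : PolyGrowth (Set.Ioi (t / 2)) fun (_ : Eu n) s => 1 / (2 * √s) := by
    refine PolyGrowth.of_bdd (M := 1 / (2 * √(t / 2))) fun s hs _ => ?_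
    have hs' : t / 2 < s := hs
    have : 0 < √(t / 2) := Real.sqrt_pos.2 (by linarith)
    rw [abs_of_nonneg (by positivity)]
    gcongr
  have hcm : ∀ (s : ℝ) i, Continuous fun y : Eu n => y i * pd i φ (x + √s • y) := fun s i => by
    have := hci i; fun_prop
  have key := hasDerivAt_integral_rho (S := Set.Ioi (t / 2)) (G := fun y s => φ (x + √s • y))
    (G' := fun y s => 1 / (2 * √s) * ∑ i, y i * pd i φ (x + √s • y)) isOpen_Ioi
    (PolyGrowth.of_bdd fun _ _ _ => hM _) (hbd.mul (PolyGrowth.sum _ fun i _ => hgr i))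
    (fun s _ => measurable_heat_arg h.contDiff.continuous s x)
    (fun s _ => (continuous_const.mul
      (continuous_finsetSum _ fun i _ => hcm s i)).aestronglyMeasurable)
    (fun y s hs => ?_) (s := t) (show t / 2 < t by linarith)
  · refine key.congr_deriv ?_
    have hts : √t ≠ 0 := (Real.sqrt_pos.2 ht).ne'
    rw [h.heat_lap]
    have h1 : ∀ y : Eu n, 1 / (2 * √t) * (∑ i, y i * pd i φ (x + √t • y)) * rho n y =
        ∑ i, 1 / (2 * √t) * (y i * pd i φ (x + √t • y) * rho n y) := by
      intro y; rw [mul_assoc, Finset.sum_mul, Finset.mul_sum]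
    simp only [h1]
    rw [integral_finsetSum _ fun i _ => ?_]
    swap
    · exact ((hgr i).integrable (show t / 2 < t by linarith)
        (hcm t i).aestronglyMeasurable).const_mul _
    refine Finset.sum_congr rfl fun i _ => ?_
    rw [integral_const_mul]
    have hibp := integral_lineDeriv_mul_rho (φ := fun y => pd i φ (x + √t • y))
      (φ' := fun y => √t * pd i (pd i φ) (x + √t • y)) (i := i) (fun y => ?_)
      (PolyGrowth.of_bdd fun _ _ _ => hM1 i _)
      ((PolyGrowth.const _).mul (PolyGrowth.of_bdd fun _ _ _ => hM2 i _))
      (measurable_heat_arg (hci i) t x)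
      (measurable_heat_arg ((h.continuous_pd_pd i).const_mul √t) t x)
    · unfold heat
      simp only [mul_assoc] at hibp ⊢
      rw [integral_const_mul] at hibp
      have h5 : ∫ y : Eu n, y i * (pd i φ (x + √t • y) * rho n y) =
          2 * (√t * ∫ a : Eu n, pd i (pd i φ) (x + √t • a) * rho n a) := by linarith
      rw [h5]
      field_simp
    · have := HasLineDerivAt.comp_line (h.lineDeriv_pd i) (x + √t • y) 0
      simp only [zero_smul, add_zero] at this
      have h3 : HasDerivAt (fun r : ℝ => pd i φ (x + √t • y + r • bv i))
        (pd i (pd i φ) (x + √t • y)) (√t * 0) := by simpa using this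
      have h4 := HasDerivAt.comp (0:ℝ) h3 ((hasDerivAt_id (0:ℝ)).const_mul √t)
      unfold HasLineDerivAt
      refine (h4.congr_of_eventuallyEq (Eventually.of_forall fun r => ?_)).congr_deriv (by ring)
      simp only [Function.comp]
      congr 1
      module
  · have hs0 : 0 < s := lt_trans (by linarith) (show t / 2 < s from hs)
    have h1 : HasDerivAt (fun s => x + √s • y) ((1 / (2 * √s)) • y) s :=
      ((Real.hasDerivAt_sqrt hs0.ne').smul_const y).const_add x
    have h2 := (h.differentiable (x + √s • y)).hasFDerivAt.comp_hasDerivAt s h1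
    refine h2.congr_deriv ?_
    rw [map_smul, fderiv_eq_sum_pd, smul_eq_mul]

lemma hasDerivWithinAt_heat_zero (h : C2b φ) (x : Eu n) :
    HasDerivWithinAt (fun t => heat t φ x) (lap n φ x) (Set.Ici 0) 0 := by
  obtain ⟨M, hM⟩ := h.bdd
  obtain ⟨M2, hM2⟩ := h.bdd_lap
  have hc := continuous_heat h.contDiff.continuous hM
  have hc2 := continuous_heat h.continuous_lap hM2
  refine hasDerivWithinAt_Ici_of_tendsto_deriv (s := Set.Ioi 0)
    (fun t ht => (h.hasDerivAt_heat x ht).differentiableAt.differentiableWithinAt)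
    ((hc.comp (by fun_prop : Continuous fun t : ℝ => (x, t))).continuousWithinAt)
    self_mem_nhdsWithin ?_
  have h1 : Tendsto (fun t : ℝ => heat t (lap n φ) x) (𝓝[>] 0) (𝓝 (lap n φ x)) := by
    have := (hc2.comp (by fun_prop : Continuous fun t : ℝ => (x, t))).tendsto 0
    simp only [Function.comp, heat_zero] at this
    exact this.mono_left nhdsWithin_le_nhds
  refine h1.congr' ?_
  filter_upwards [self_mem_nhdsWithin] with t ht
  exact (h.hasDerivAt_heat x ht).deriv.symm

end C2b

end Heat

section MaximumPrinciple

variable {n : ℕ}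

/-- Joint continuity at `(x, t)` from the right in time. -/
def RightCont (u : Eu n → ℝ → ℝ) (x : Eu n) (t : ℝ) : Prop :=
  Tendsto (fun P : Eu n × ℝ => u P.1 P.2) (𝓝 x ×ˢ 𝓝[≥] t) (𝓝 (u x t))

lemma RightCont.of_continuousAt {u : Eu n → ℝ → ℝ} {x : Eu n} {t : ℝ}
    (h : ContinuousAt (fun P : Eu n × ℝ => u P.1 P.2) (x, t)) : RightCont u x t := by
  refine h.tendsto.mono_left ?_
  rw [nhds_prod_eq]
  exact Filter.prod_mono le_rfl nhdsWithin_le_nhds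

lemma RightCont.sub {u v : Eu n → ℝ → ℝ} {x : Eu n} {t : ℝ} (hu : RightCont u x t)
    (hv : RightCont v x t) : RightCont (fun x t => u x t - v x t) x t :=
  Filter.Tendsto.sub hu hv

lemma RightCont.neg {u : Eu n → ℝ → ℝ} {x : Eu n} {t : ℝ} (hu : RightCont u x t) :
    RightCont (fun x t => -u x t) x t :=
  Filter.Tendsto.neg hu

lemma deriv_nonneg_of_le_left {f : ℝ → ℝ} {D t a : ℝ} (hd : HasDerivAt f D t) (ha : a < t)
    (h : ∀ s ∈ Set.Ioo a t, f s ≤ f t) : 0 ≤ D := by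
  have h1 := (hasDerivAt_iff_tendsto_slope.1 hd).mono_left
    (nhdsWithin_mono t (s := Set.Iio t) (fun s hs => ne_of_lt hs))
  refine ge_of_tendsto h1 ?_
  filter_upwards [Ioo_mem_nhdsLT ha] with s hs
  rw [slope_def_field]
  exact div_nonneg_of_nonpos (by linarith [h s hs]) (by linarith [hs.2])

lemma second_deriv_nonpos {F F' : ℝ → ℝ} {c : ℝ} (hF : ∀ r, HasDerivAt F (F' r) r)
    (hF' : HasDerivAt F' c 0) (hmax : IsLocalMax F 0) : c ≤ 0 := by
  by_contra! hc
  have hdF : deriv F = F' := funext fun r => (hF r).deriv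
  have h0 : F' 0 = 0 := hmax.hasDerivAt_eq_zero (hF 0)
  have hmin := isLocalMin_of_deriv_deriv_pos (f := F) (x₀ := 0)
    (by rw [hdF, hF'.deriv]; exact hc) (by rw [hdF, h0]) (hF 0).continuousAt
  have hconst : F =ᶠ[𝓝 0] fun _ => F 0 := by
    filter_upwards [hmin, hmax] with r h1 h2 using le_antisymm h2 h1
  have hz : F' =ᶠ[𝓝 0] fun _ => 0 := by
    filter_upwards [hconst.eventuallyEq_nhds] with r hr
    exact (hF r).unique ((hasDerivAt_const r (F 0)).congr_of_eventuallyEq hr)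
  have := hF'.unique ((hasDerivAt_const 0 (0:ℝ)).congr_of_eventuallyEq hz)
  linarith

/-- A weak form of the parabolic maximum principle on a cylinder. -/
lemma neg_of_parabolic {d : Eu n → ℝ → ℝ} {x₀ : Eu n} {r t₁ t₂ : ℝ} (ht : t₁ ≤ t₂)
    (hrc : ∀ x ∈ Metric.closedBall x₀ r, ∀ t ∈ Set.Icc t₁ t₂, RightCont d x t)
    (hinit : ∀ x ∈ Metric.closedBall x₀ r, d x t₁ < 0)
    (hside : ∀ x ∈ Metric.sphere x₀ r, ∀ t ∈ Set.Icc t₁ t₂, d x t < 0)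
    (hder : ∀ x ∈ Metric.closedBall x₀ r, ∀ t ∈ Set.Ioc t₁ t₂, ∃ D,
      HasDerivAt (fun s => d x s) D t ∧ (IsLocalMax (fun z => d z t) x → D < 0)) :
    ∀ x ∈ Metric.closedBall x₀ r, d x t₂ < 0 := by
  by_contra! hcon
  obtain ⟨z, hz, hz0⟩ := hcon
  set bad : Set ℝ := {t | t ∈ Set.Icc t₁ t₂ ∧ ∃ x ∈ Metric.closedBall x₀ r, 0 ≤ d x t} with hbad
  have hne : bad.Nonempty := ⟨t₂, ⟨ht, le_rfl⟩, z, hz, hz0⟩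
  have hbb : BddBelow bad := ⟨t₁, fun t ht => ht.1.1⟩
  set τ := sInf bad with hτ
  have hτ1 : t₁ ≤ τ := le_csInf hne fun t ht => ht.1.1
  have hτ2 : τ ≤ t₂ := csInf_le hbb ⟨⟨ht, le_rfl⟩, z, hz, hz0⟩
  have hgood : ∀ t ∈ Set.Ico t₁ τ, ∀ x ∈ Metric.closedBall x₀ r, d x t < 0 := by
    intro t ht' x hx
    by_contra! h
    exact (not_lt.2 (csInf_le hbb ⟨⟨ht'.1, ht'.2.le.trans hτ2⟩, x, hx, h⟩)) ht'.2
  obtain ⟨x, hx, hx0⟩ : ∃ x ∈ Metric.closedBall x₀ r, 0 ≤ d x τ := by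
    by_contra! h
    have h1 := (isCompact_closedBall x₀ r).mem_nhdsSet_prod_of_forall (l := 𝓝[≥] τ)
      (s := {P : Eu n × ℝ | d P.1 P.2 < 0})
      (fun x hx => (hrc x hx τ ⟨hτ1, hτ2⟩).eventually_lt_const (h x hx))
    obtain ⟨A, hA, B, hB, hAB⟩ := Filter.mem_prod_iff.1 h1
    obtain ⟨b, hb, hbB⟩ := (mem_nhdsGE_iff_exists_Ico_subset).1 hB
    obtain ⟨t, ht', htb⟩ := (csInf_lt_iff hbb hne).1 (show sInf bad < b from hb)
    obtain ⟨y, hy, hy0⟩ := ht'.2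
    have : (y, t) ∈ A ×ˢ B := ⟨subset_of_mem_nhdsSet hA hy, hbB ⟨csInf_le hbb ht', htb⟩⟩
    exact absurd (hAB this) (not_lt.2 hy0)
  have hlt : t₁ < τ := lt_of_le_of_ne hτ1 fun h => by
    rw [← h] at hx0; exact absurd (hinit x hx) (not_lt.2 hx0)
  have hle : ∀ y ∈ Metric.closedBall x₀ r, d y τ ≤ 0 := by
    intro y hy
    obtain ⟨D, hD, -⟩ := hder y hy τ ⟨hlt, hτ2⟩
    refine le_of_tendsto (hD.continuousAt.tendsto.mono_left
      (nhdsWithin_le_nhds (s := Set.Iio τ))) ?_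
    filter_upwards [Ioo_mem_nhdsLT hlt] with s hs
    exact (hgood s ⟨hs.1.le, hs.2⟩ y hy).le
  have hxb : x ∈ Metric.ball x₀ r := by
    rcases eq_or_lt_of_le (Metric.mem_closedBall.1 hx) with h | h
    · exact absurd (hside x h τ ⟨hτ1, hτ2⟩) (not_lt.2 hx0)
    · exact h
  obtain ⟨D, hD, hD'⟩ := hder x hx τ ⟨hlt, hτ2⟩
  have hmax : IsLocalMax (fun z => d z τ) x := by
    filter_upwards [Metric.isOpen_ball.mem_nhds hxb] with y hy
    exact (hle y (Metric.ball_subset_closedBall hy)).trans hx0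
  have h1 := hD' hmax
  have h2 := deriv_nonneg_of_le_left hD hlt fun s hs =>
    (hgood s ⟨hs.1.le, hs.2⟩ x hx).le.trans hx0
  linarith

lemma hasDerivAt_line_norm_sq (x x₀ : Eu n) (i : Fin n) (r : ℝ) :
    HasDerivAt (fun r : ℝ => ‖x + r • bv i - x₀‖ ^ 2) (2 * (x i - x₀ i + r)) r := by
  have h : ∀ r : ℝ, ‖x + r • bv i - x₀‖ ^ 2 = ‖x - x₀‖ ^ 2 + 2 * r * (x i - x₀ i) + r ^ 2 := by
    intro r
    rw [show x + r • bv i - x₀ = (x - x₀) + r • bv i by abel, norm_add_sq_real, inner_smul_right,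
      norm_smul]
    simp [EuclideanSpace.inner_single_right]
    ring
  simp only [h]
  have := (((hasDerivAt_id r).const_mul 2).mul_const (x i - x₀ i)).const_add (‖x - x₀‖ ^ 2) |>.add
    ((hasDerivAt_id r).pow 2)
  exact this.congr_deriv (by simp; ring)

/-- At a local maximum of `f - g - c|· - x₀|²` the Laplacian of `f` is controlled. -/
lemma lap_le_of_isLocalMax {f g : Eu n → ℝ} (hf : ContDiff ℝ 2 f) {g' g'' : Fin n → Eu n → ℝ}
    (hg : ∀ i x, HasLineDerivAt ℝ g (g' i x) x (bv i))
    (hg' : ∀ i x, HasLineDerivAt ℝ (g' i) (g'' i x) x (bv i)) {x x₀ : Eu n} {b e : ℝ}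
    (hmax : IsLocalMax (fun z => f z - g z - b * ‖z - x₀‖ ^ 2 - e) x) :
    lap n f x ≤ (∑ i, g'' i x) + 2 * n * b := by
  have key : ∀ i, pd i (pd i f) x ≤ g'' i x + 2 * b := by
    intro i
    have hf1 : ∀ y, HasLineDerivAt ℝ f (pd i f y) y (bv i) :=
      hasLineDerivAt_pd (hf.differentiable (by norm_num)) i
    have hf2 : ∀ y, HasLineDerivAt ℝ (pd i f) (pd i (pd i f) y) y (bv i) :=
      hasLineDerivAt_pd ((contDiff_pd (m := 1) (by exact_mod_cast hf) i).differentiable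
        (by norm_num)) i
    have h := second_deriv_nonpos
      (F := fun r : ℝ => f (x + r • bv i) - g (x + r • bv i) - b * ‖x + r • bv i - x₀‖ ^ 2 - e)
      (F' := fun r : ℝ => pd i f (x + r • bv i) - g' i (x + r • bv i) - b * (2 * (x i - x₀ i + r)))
      (c := pd i (pd i f) x - g'' i x - 2 * b) (fun r => ?_) ?_ ?_
    · linarith
    · exact (((HasLineDerivAt.comp_line hf1 x r).sub (HasLineDerivAt.comp_line (hg i) x r)).sub
        ((hasDerivAt_line_norm_sq x x₀ i r).const_mul b)).sub_const e
    · have h1 := ((HasLineDerivAt.comp_line hf2 x 0).sub (HasLineDerivAt.comp_line (hg' i) x 0)).sub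
        ((((hasDerivAt_id (0:ℝ)).const_add (x i - x₀ i)).const_mul 2).const_mul b)
      exact h1.congr_deriv (by simp; ring)
    · have h1 : IsLocalMax (fun z => f z - g z - b * ‖z - x₀‖ ^ 2 - e) (x + (0:ℝ) • bv i) := by
        simpa using hmax
      exact h1.comp_continuous (g := fun r : ℝ => x + r • bv i)
        (by fun_prop : Continuous fun r : ℝ => x + r • bv i).continuousAt
  rw [lap_eq_sum_pd]
  calc _ ≤ ∑ i, (g'' i x + 2 * b) := Finset.sum_le_sum fun i _ => key i
    _ = _ := by rw [Finset.sum_add_distrib]; simp; ring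

/-- Comparison with the heat semigroup on a cylinder. -/
lemma le_heat_of_subsolution {u : Eu n → ℝ → ℝ} {x₀ : Eu n} {r t₁ h c κ M M' : ℝ} (hr : 0 < r)
    (hh : 0 < h) (hκ : 0 ≤ κ)
    (hrc : ∀ x ∈ Metric.closedBall x₀ r, ∀ t ∈ Set.Icc t₁ (t₁ + h), RightCont u x t)
    (hc2 : ∀ t ∈ Set.Ioc t₁ (t₁ + h), ContDiff ℝ 2 (fun x => u x t))
    (hut : ∀ x ∈ Metric.closedBall x₀ r, ∀ t ∈ Set.Ioc t₁ (t₁ + h), ∃ D,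
      HasDerivAt (fun s => u x s) D t ∧ D ≤ lap n (fun x => u x t) x + c + κ * ‖x - x₀‖ ^ 2)
    (hM : ∀ x ∈ Metric.closedBall x₀ r, ∀ t ∈ Set.Icc t₁ (t₁ + h), |u x t| ≤ M)
    {φ : Eu n → ℝ} (hφ : C2b φ) (hφM : ∀ x, |φ x| ≤ M')
    (hle : ∀ x ∈ Metric.closedBall x₀ r, u x t₁ ≤ φ x) :
    u x₀ (t₁ + h) ≤ heat h φ x₀ + c * h + n * κ * h ^ 2
      + (M + M' + |c| * h) * (2 * n * h) / r ^ 2 := by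
  have hM0 : 0 ≤ M := (abs_nonneg _).trans
    (hM x₀ (by simp [hr.le]) t₁ ⟨le_rfl, by linarith⟩)
  have hM'0 : 0 ≤ M' := (abs_nonneg _).trans (hφM x₀)
  set B := (M + M' + |c| * h) / r ^ 2 with hB
  have hB0 : 0 ≤ B := by positivity
  have hBr : B * r ^ 2 = M + M' + |c| * h := by rw [hB]; field_simp
  refine le_of_forall_pos_le_add fun δ hδ => ?_
  set ε := δ / (1 + h) with hε
  have hε0 : 0 < ε := by positivity
  set d : Eu n → ℝ → ℝ := fun x t => u x t - (heat (t - t₁) φ x + c * (t - t₁)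
    + κ * (‖x - x₀‖ ^ 2 * (t - t₁) + n * (t - t₁) ^ 2) + B * (‖x - x₀‖ ^ 2 + 2 * n * (t - t₁))
    + ε * (1 + (t - t₁))) with hd
  have hheat := continuous_heat hφ.contDiff.continuous hφM
  have hcont : Continuous fun P : Eu n × ℝ => heat (P.2 - t₁) φ P.1 :=
    hheat.comp (by fun_prop : Continuous fun P : Eu n × ℝ => (P.1, P.2 - t₁))
  have key := neg_of_parabolic (d := d) (x₀ := x₀) (r := r) (t₁ := t₁) (t₂ := t₁ + h)
    (by linarith) ?_ ?_ ?_ ?_ x₀ (by simp [hr.le])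
  · simp only [hd, sub_self, norm_zero, add_sub_cancel_left] at key
    have h1 : ε * (1 + h) = δ := by rw [hε]; field_simp
    have h2 : (M + M' + |c| * h) * (2 * n * h) / r ^ 2 = B * (2 * n * h) := by rw [hB]; ring
    rw [h2]
    nlinarith
  · intro x hx t ht
    refine (hrc x hx t ht).sub (RightCont.of_continuousAt ?_)
    exact (by fun_prop : Continuous fun P : Eu n × ℝ => heat (P.2 - t₁) φ P.1 + c * (P.2 - t₁)
      + κ * (‖P.1 - x₀‖ ^ 2 * (P.2 - t₁) + n * (P.2 - t₁) ^ 2)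
      + B * (‖P.1 - x₀‖ ^ 2 + 2 * n * (P.2 - t₁)) + ε * (1 + (P.2 - t₁))).continuousAt
  · intro x hx
    simp only [hd, sub_self, heat_zero]
    have := hle x hx
    nlinarith [mul_nonneg hB0 (sq_nonneg ‖x - x₀‖)]
  · intro x hx t ht
    have hxr : ‖x - x₀‖ = r := by rw [← dist_eq_norm]; exact hx
    have h1 := le_of_abs_le (hM x (Metric.sphere_subset_closedBall hx) t ht)
    have h2 := neg_le_of_abs_le (abs_heat_le hφM (t - t₁) x)
    have hs0 : 0 ≤ t - t₁ := by linarith [ht.1]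
    have hsh : t - t₁ ≤ h := by linarith [ht.2]
    have h3 : -(|c| * h) ≤ c * (t - t₁) := by
      have : |c * (t - t₁)| ≤ |c| * h := by
        rw [abs_mul, abs_of_nonneg hs0]; gcongr
      exact neg_le_of_abs_le this
    have h4 : 0 ≤ κ * (‖x - x₀‖ ^ 2 * (t - t₁) + n * (t - t₁) ^ 2) := by positivity
    have h5 : 0 ≤ B * (2 * n * (t - t₁)) := by positivity
    have h6 : 0 < ε * (1 + (t - t₁)) := by positivity
    simp only [hd, hxr] at h4 ⊢
    nlinarith
  · intro x hx t ht
    obtain ⟨D, hD, hD'⟩ := hut x hx t ht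
    have hs0 : 0 < t - t₁ := by linarith [ht.1]
    have hV : HasDerivAt (fun s => heat (s - t₁) φ x) (heat (t - t₁) (lap n φ) x) t :=
      (hφ.hasDerivAt_heat x hs0).comp_sub_const t t₁
    have hid : HasDerivAt (fun s : ℝ => s - t₁) 1 t := (hasDerivAt_id t).sub_const t₁
    have hall := hD.sub ((((hV.add (hid.const_mul c)).add
      (((hid.const_mul (‖x - x₀‖ ^ 2)).add ((hid.pow 2).const_mul (n : ℝ))).const_mul κ)).add
      (((hid.const_mul (2 * (n : ℝ))).const_add (‖x - x₀‖ ^ 2)).const_mul B)).add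
      ((hid.const_add 1).const_mul ε))
    refine ⟨_, hall, fun hmax => ?_⟩
    obtain ⟨M1, hM1⟩ := hφ.bdd_pd
    obtain ⟨M2, hM2⟩ := hφ.bdd_pd_pd
    have hl := lap_le_of_isLocalMax (f := fun x => u x t) (g := heat (t - t₁) φ)
      (g' := fun i => heat (t - t₁) (pd i φ)) (g'' := fun i => heat (t - t₁) (pd i (pd i φ)))
      (hc2 t ht) (fun i y => hasLineDerivAt_heat (hasLineDerivAt_pd hφ.differentiable i)
        hφ.contDiff.continuous (hφ.contDiff_pd i).continuous hφM (hM1 i) _ _)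
      (fun i y => hasLineDerivAt_heat (hφ.lineDeriv_pd i) (hφ.contDiff_pd i).continuous
        (hφ.continuous_pd_pd i) (hM1 i) (hM2 i) _ _) (x := x) (x₀ := x₀)
      (b := κ * (t - t₁) + B)
      (e := c * (t - t₁) + κ * (n * (t - t₁) ^ 2) + B * (2 * n * (t - t₁)) + ε * (1 + (t - t₁)))
      (by
        convert hmax using 2
        simp only [hd]
        ring)
    rw [hφ.heat_lap]
    simp only [pow_one, Nat.cast_ofNat, mul_one, Nat.add_one_sub_one]
    nlinarith

end MaximumPrinciple

section Comparison

variable {n : ℕ}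

lemma c2b_of_hasCompactSupport {φ : Eu n → ℝ} (h : ContDiff ℝ 2 φ) (hs : HasCompactSupport φ) :
    C2b φ := by
  have h1 : ∀ i, ContDiff ℝ 1 (pd i φ) := fun i => contDiff_pd (m := 1) (by exact_mod_cast h) i
  have h2 : ∀ i, Continuous (pd i (pd i φ)) := fun i =>
    (contDiff_pd (m := 0) (by exact_mod_cast h1 i) i).continuous
  have hs1 : ∀ i, HasCompactSupport (pd i φ) := fun i => hs.fderiv_apply ℝ _
  have hs2 : ∀ i, HasCompactSupport (pd i (pd i φ)) := fun i => (hs1 i).fderiv_apply ℝ _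
  refine ⟨h, hs.exists_bound_of_continuous h.continuous, ?_, ?_⟩
  · choose M hM using fun i => (hs1 i).exists_bound_of_continuous (h1 i).continuous
    refine ⟨∑ i, |M i|, fun i x => (hM i x).trans ((le_abs_self _).trans ?_)⟩
    exact Finset.single_le_sum (f := fun i => |M i|) (fun i _ => abs_nonneg _) (Finset.mem_univ i)
  · choose M hM using fun i => (hs2 i).exists_bound_of_continuous (h2 i)
    refine ⟨∑ i, |M i|, fun i x => (hM i x).trans ((le_abs_self _).trans ?_)⟩
    exact Finset.single_le_sum (f := fun i => |M i|) (fun i _ => abs_nonneg _) (Finset.mem_univ i)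

/-- Comparison of a subsolution with the heat flow of its own initial value. -/
lemma le_heat_self {u : Eu n → ℝ → ℝ} {x₀ : Eu n} {r t₁ h c κ M : ℝ} (hr : 0 < r)
    (hh : 0 < h) (hκ : 0 ≤ κ)
    (hrc : ∀ x ∈ Metric.closedBall x₀ r, ∀ t ∈ Set.Icc t₁ (t₁ + h), RightCont u x t)
    (hc2 : ∀ t ∈ Set.Icc t₁ (t₁ + h), ContDiff ℝ 2 (fun x => u x t))
    (hut : ∀ x ∈ Metric.closedBall x₀ r, ∀ t ∈ Set.Ioc t₁ (t₁ + h), ∃ D,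
      HasDerivAt (fun s => u x s) D t ∧ D ≤ lap n (fun x => u x t) x + c + κ * ‖x - x₀‖ ^ 2)
    (hM : ∀ x, ∀ t ∈ Set.Icc t₁ (t₁ + h), |u x t| ≤ M) :
    u x₀ (t₁ + h) ≤ heat h (fun x => u x t₁) x₀ + c * h + n * κ * h ^ 2
      + (2 * M + |c| * h) * (2 * n * h) / r ^ 2 + 4 * n * M * h / r ^ 2 := by
  have ht1 : t₁ ∈ Set.Icc t₁ (t₁ + h) := ⟨le_rfl, by linarith⟩
  let f : ContDiffBump x₀ := ⟨r, r + 1, hr, by linarith⟩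
  set φ : Eu n → ℝ := fun x => f x * u x t₁ with hφdef
  have hcu : Continuous fun x => u x t₁ := (hc2 t₁ ht1).continuous
  have hφ2 : ContDiff ℝ 2 φ := f.contDiff.mul (hc2 t₁ ht1)
  have hφ : C2b φ := c2b_of_hasCompactSupport hφ2 f.hasCompactSupport.mul_right
  have hφM : ∀ x, |φ x| ≤ M := fun x => by
    rw [hφdef, abs_mul, abs_of_nonneg f.nonneg]
    exact (mul_le_of_le_one_left (abs_nonneg _) f.le_one).trans (hM x t₁ ht1)
  have heq : ∀ x ∈ Metric.closedBall x₀ r, φ x = u x t₁ := fun x hx => by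
    simp only [hφdef]
    rw [f.one_of_mem_closedBall hx, one_mul]
  have h1 := le_heat_of_subsolution hr hh hκ hrc
    (fun t ht => hc2 t ⟨ht.1.le, ht.2⟩) hut (fun x _ t ht => hM x t ht) hφ hφM
    (fun x hx => (heq x hx).ge)
  have h2 := heat_le_of_le_on_ball (φ := fun x => φ x + -u x t₁) (M := M) (h := h) (x := x₀)
    (r := r) (c := 0) (by have := hφ2.continuous; fun_prop) (fun x => ?_) hh.le hr
    (fun x hx => by rw [heq x hx]; simp)
  · rw [heat_add (ψ := fun x => -u x t₁) hφ2.continuous (hcu.neg) hφM (M' := M) (fun y => by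
      rw [abs_neg]; exact hM y t₁ ht1), heat_neg (fun x => u x t₁)] at h2
    rw [show M + M = 2 * M by ring] at h1
    linarith
  · have : φ x + -u x t₁ = -((1 - f x) * u x t₁) := by rw [hφdef]; ring
    rw [this, abs_neg, abs_mul, abs_of_nonneg (by linarith [f.le_one (x := x)])]
    exact (mul_le_of_le_one_left (abs_nonneg _) (by linarith [f.nonneg (x := x)])).trans
      (hM x t₁ ht1)

lemma tendsto_heat {ι : Type*} {l : Filter ι} [l.IsCountablyGenerated] {g : ι → Eu n → ℝ}
    {g₀ : Eu n → ℝ} {M : ℝ} (hc : ∀ᶠ i in l, Continuous (g i)) (hM : ∀ᶠ i in l, ∀ x, |g i x| ≤ M)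
    (hl : ∀ x, Tendsto (fun i => g i x) l (𝓝 (g₀ x))) (h : ℝ) (x : Eu n) :
    Tendsto (fun i => heat h (g i) x) l (𝓝 (heat h g₀ x)) := by
  refine tendsto_integral_filter_of_dominated_convergence (fun y => M * rho n y) ?_ ?_
    (integrable_rho.const_mul M) (Eventually.of_forall fun y => (hl _).mul_const _)
  · filter_upwards [hc] with i hi
    exact (measurable_heat_arg hi h x).mul continuous_rho.aestronglyMeasurable
  · filter_upwards [hM] with i hi
    refine Eventually.of_forall fun y => ?_
    rw [norm_mul, Real.norm_of_nonneg (rho_pos y).le]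
    exact mul_le_mul_of_nonneg_right (hi _) (rho_pos y).le

/-- A local upper bound for subsolutions that are only known to be jointly right continuous
after the initial time. -/
lemma le_of_subsolution_open {u : Eu n → ℝ → ℝ} {x₀ : Eu n} {r α s c c₀ M : ℝ} (hr : 0 < r)
    (hα : α < s)
    (hrc : ∀ x ∈ Metric.closedBall x₀ r, ∀ t ∈ Set.Ioc α s, RightCont u x t)
    (hc2 : ∀ t ∈ Set.Icc α s, ContDiff ℝ 2 (fun x => u x t))
    (hut : ∀ x, ∀ t ∈ Set.Icc α s, ∃ D,
      HasDerivAt (fun s => u x s) D t ∧ D ≤ lap n (fun x => u x t) x + c)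
    (hM : ∀ x, ∀ t ∈ Set.Icc α s, |u x t| ≤ M)
    (hle : ∀ x ∈ Metric.closedBall x₀ r, u x α ≤ c₀) :
    u x₀ s ≤ c₀ + c * (s - α) + (2 * M + |c| * (s - α)) * (2 * n * (s - α)) / r ^ 2
      + 8 * n * M * (s - α) / r ^ 2 := by
  set E : ℝ → ℝ := fun h => c * h + (2 * M + |c| * h) * (2 * n * h) / r ^ 2
    + 4 * n * M * h / r ^ 2 with hE
  have hcu : ∀ x, ContinuousOn (fun t => u x t) (Set.Icc α s) := fun x t ht => by
    obtain ⟨D, hD, -⟩ := hut x t ht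
    exact hD.continuousAt.continuousWithinAt
  have hαm : α ∈ Set.Icc α s := ⟨le_rfl, hα.le⟩
  have step : ∀ h ∈ Set.Ioo 0 (s - α), u x₀ (α + h) ≤ c₀ + E h + 4 * n * M * h / r ^ 2 := by
    intro h hh
    have hlim1 : Tendsto (fun ε => u x₀ (ε + h)) (𝓝[>] α) (𝓝 (u x₀ (α + h))) := by
      obtain ⟨D, hD, -⟩ := hut x₀ (α + h) ⟨by linarith [hh.1], by linarith [hh.2]⟩
      have : Tendsto (fun ε : ℝ => ε + h) (𝓝[>] α) (𝓝 (α + h)) :=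
        ((by fun_prop : Continuous fun ε : ℝ => ε + h).tendsto α).mono_left nhdsWithin_le_nhds
      exact hD.continuousAt.tendsto.comp this
    have hIoo : ∀ᶠ ε in 𝓝[>] α, ε ∈ Set.Ioo α (s - h) :=
      Ioo_mem_nhdsGT (by linarith [hh.2])
    have hlim2 : Tendsto (fun ε => heat h (fun x => u x ε) x₀) (𝓝[>] α)
        (𝓝 (heat h (fun x => u x α) x₀)) := by
      refine tendsto_heat (M := M) ?_ ?_ (fun x => ?_) h x₀
      · filter_upwards [hIoo] with ε hε
        exact (hc2 ε ⟨hε.1.le, by linarith [hε.2, hh.1]⟩).continuous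
      · filter_upwards [hIoo] with ε hε x
        exact hM x ε ⟨hε.1.le, by linarith [hε.2, hh.1]⟩
      · obtain ⟨D, hD, -⟩ := hut x α hαm
        exact hD.continuousAt.tendsto.mono_left nhdsWithin_le_nhds
    have hineq : u x₀ (α + h) ≤ heat h (fun x => u x α) x₀ + E h := by
      refine le_of_tendsto_of_tendsto hlim1 (hlim2.add_const _) ?_
      filter_upwards [hIoo] with ε hε
      have hsub : Set.Icc ε (ε + h) ⊆ Set.Icc α s := fun t ht =>
        ⟨hε.1.le.trans ht.1, by linarith [ht.2, hε.2]⟩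
      have := le_heat_self (u := u) (x₀ := x₀) (r := r) (t₁ := ε) (h := h) (c := c) (κ := 0)
        (M := M) hr hh.1 le_rfl
        (fun x hx t ht => hrc x hx t ⟨hε.1.trans_le ht.1, (hsub ht).2⟩)
        (fun t ht => hc2 t (hsub ht))
        (fun x hx t ht => by
          obtain ⟨D, hD, hD'⟩ := hut x t (hsub ⟨ht.1.le, ht.2⟩)
          exact ⟨D, hD, by linarith⟩)
        (fun x t ht => hM x t (hsub ht))
      simp only [hE]
      linarith
    have h3 := heat_le_of_le_on_ball (φ := fun x => u x α) (hc2 α hαm).continuous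
      (fun x => hM x α hαm) hh.1.le hr hle
    linarith
  have hl1 : Tendsto (fun h => u x₀ (α + h)) (𝓝[<] (s - α)) (𝓝 (u x₀ s)) := by
    obtain ⟨D, hD, -⟩ := hut x₀ s ⟨hα.le, le_rfl⟩
    have : Tendsto (fun h : ℝ => α + h) (𝓝[<] (s - α)) (𝓝 s) := by
      have := ((by fun_prop : Continuous fun ε : ℝ => α + ε).tendsto (s - α))
      rw [add_sub_cancel] at this
      exact this.mono_left nhdsWithin_le_nhds
    exact hD.continuousAt.tendsto.comp this
  have hl2 : Tendsto (fun h => c₀ + E h + 4 * n * M * h / r ^ 2) (𝓝[<] (s - α))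
      (𝓝 (c₀ + E (s - α) + 4 * n * M * (s - α) / r ^ 2)) :=
    ((by fun_prop : Continuous fun h => c₀ + E h + 4 * n * M * h / r ^ 2).tendsto _).mono_left
      nhdsWithin_le_nhds
  have := le_of_tendsto_of_tendsto hl1 hl2 (by
    filter_upwards [Ioo_mem_nhdsLT (show 0 < s - α by linarith)] with h hh using step h hh)
  refine this.trans (le_of_eq ?_)
  simp only [hE]
  ring

end Comparison

section Regularity

variable {n : ℕ}

/-- Bounded classical solutions of `u_t = Δu + f(u)` on `ℝⁿ × (0, τ)`; no joint regularity is
assumed. -/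
structure IsSol (f : ℝ → ℝ) (u : Eu n → ℝ → ℝ) (τ M K : ℝ) : Prop where
  contf : Continuous f
  c2 : ∀ t ∈ Set.Ioo 0 τ, ContDiff ℝ 2 (fun x => u x t)
  eqn : ∀ x, ∀ t ∈ Set.Ioo 0 τ,
    HasDerivAt (fun s => u x s) (lap n (fun x => u x t) x + f (u x t)) t
  bdd : ∀ x, ∀ t ∈ Set.Ioo 0 τ, |u x t| ≤ M
  bddf : ∀ x, ∀ t ∈ Set.Ioo 0 τ, |f (u x t)| ≤ K

lemma pd_neg (i : Fin n) (g : Eu n → ℝ) : pd i (fun x => -g x) = fun x => -pd i g x := by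
  ext x
  unfold pd
  rw [fderiv_fun_neg]
  rfl

lemma lap_neg (g : Eu n → ℝ) (x : Eu n) : lap n (fun x => -g x) x = -lap n g x := by
  simp [lap_eq_sum_pd, pd_neg]

namespace IsSol

variable {f : ℝ → ℝ} {u : Eu n → ℝ → ℝ} {τ M K : ℝ}

lemma neg (h : IsSol f u τ M K) :
    IsSol (fun z => -f (-z)) (fun x t => -u x t) τ M K where
  contf := (h.contf.comp continuous_neg).neg
  c2 t ht := (h.c2 t ht).neg
  eqn x t ht := by
    refine (h.eqn x t ht).neg.congr_deriv ?_
    rw [lap_neg, neg_neg]; ring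
  bdd x t ht := by simpa using h.bdd x t ht
  bddf x t ht := by simpa using h.bddf x t ht

lemma le_local (h : IsSol f u τ M K) {x₀ : Eu n} {r α s c₀ : ℝ} (hr : 0 < r) (hα0 : 0 < α)
    (hα : α < s) (hs : s < τ)
    (hrc : ∀ x ∈ Metric.closedBall x₀ r, ∀ t ∈ Set.Ioc α s, RightCont u x t)
    (hle : ∀ x ∈ Metric.closedBall x₀ r, u x α ≤ c₀) :
    u x₀ s ≤ c₀ + K * (s - α) + (2 * M + K * (s - α)) * (2 * n * (s - α)) / r ^ 2
      + 8 * n * M * (s - α) / r ^ 2 := by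
  have hsub : Set.Icc α s ⊆ Set.Ioo 0 τ := fun t ht => ⟨hα0.trans_le ht.1, ht.2.trans_lt hs⟩
  have hK : 0 ≤ K := (abs_nonneg _).trans (h.bddf x₀ s (hsub ⟨hα.le, le_rfl⟩))
  have := le_of_subsolution_open (u := u) (c := K) (M := M) (c₀ := c₀) hr hα hrc
    (fun t ht => h.c2 t (hsub ht))
    (fun x t ht => ⟨_, h.eqn x t (hsub ht), by
      linarith [le_of_abs_le (h.bddf x t (hsub ht))]⟩)
    (fun x t ht => h.bdd x t (hsub ht)) hle
  rwa [abs_of_nonneg hK] at this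

lemma abs_sub_local (h : IsSol f u τ M K) {x₀ : Eu n} {r α s v c : ℝ} (hr : 0 < r) (hα0 : 0 < α)
    (hα : α < s) (hs : s < τ)
    (hrc : ∀ x ∈ Metric.closedBall x₀ r, ∀ t ∈ Set.Ioc α s, RightCont u x t)
    (hle : ∀ x ∈ Metric.closedBall x₀ r, |u x α - v| ≤ c) :
    |u x₀ s - v| ≤ c + K * (s - α) + (2 * M + K * (s - α)) * (2 * n * (s - α)) / r ^ 2
      + 8 * n * M * (s - α) / r ^ 2 := by
  have h1 := h.le_local hr hα0 hα hs hrc (c₀ := v + c)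
    (fun x hx => by linarith [le_of_abs_le (hle x hx)])
  have h2 := h.neg.le_local hr hα0 hα hs (fun x hx t ht => (hrc x hx t ht).neg) (c₀ := -v + c)
    (fun x hx => by linarith [neg_le_of_abs_le (hle x hx)])
  rw [abs_le]
  constructor <;> linarith

/-- Quantitative Lipschitz bounds at the point `P`. -/
def LipAt (u : Eu n → ℝ → ℝ) (τ : ℝ) (N : ℕ) (P : Eu n × ℝ) : Prop :=
  (∀ s ∈ Set.Ioo 0 τ, |s - P.2| < 1 / (N + 1 : ℝ) → |u P.1 s - u P.1 P.2| ≤ (N + 1) * |s - P.2|) ∧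
  ∀ y, ‖y - P.1‖ < 1 / (N + 1 : ℝ) → |u y P.2 - u P.1 P.2| ≤ (N + 1) * ‖y - P.1‖

lemma exists_lipAt (h : IsSol f u τ M K) (P : Eu n × ℝ) (hP : P.2 ∈ Set.Ioo 0 τ) :
    ∃ N, LipAt u τ N P := by
  obtain ⟨c1, h1⟩ := (h.eqn P.1 P.2 hP).isBigO_sub.bound
  obtain ⟨c2, h2⟩ := (((h.c2 P.2 hP).differentiable (by norm_num)) P.1).isBigO_sub.bound
  obtain ⟨δ1, hδ1, h1⟩ := Metric.eventually_nhds_iff.1 h1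
  obtain ⟨δ2, hδ2, h2⟩ := Metric.eventually_nhds_iff.1 h2
  obtain ⟨N, hN⟩ := exists_nat_gt (max (max c1 c2) (max (1 / δ1) (1 / δ2)))
  simp only [max_lt_iff] at hN
  have hN1 : 1 / (N + 1 : ℝ) < δ1 := by
    rw [div_lt_comm₀ (by positivity) hδ1]; linarith [hN.2.1]
  have hN2 : 1 / (N + 1 : ℝ) < δ2 := by
    rw [div_lt_comm₀ (by positivity) hδ2]; linarith [hN.2.2]
  refine ⟨N, fun s _ hs => ?_, fun y hy => ?_⟩
  · have := h1 (y := s) (by rw [Real.dist_eq]; linarith)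
    simp only [Real.norm_eq_abs] at this
    exact this.trans (mul_le_mul_of_nonneg_right (by linarith [hN.1.1]) (abs_nonneg _))
  · have := h2 (y := y) (by rw [dist_eq_norm]; linarith)
    simp only [Real.norm_eq_abs] at this
    exact this.trans (mul_le_mul_of_nonneg_right (by linarith [hN.1.2]) (norm_nonneg _))

lemma lipAt_of_tendsto (h : IsSol f u τ M K) {N : ℕ} {P : ℕ → Eu n × ℝ} {Q : Eu n × ℝ}
    (hP : ∀ k, LipAt u τ N (P k)) (hQ : Q.2 ∈ Set.Ioo 0 τ)
    (hl : Tendsto P atTop (𝓝 Q)) : LipAt u τ N Q := by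
  have hl1 : Tendsto (fun k => (P k).1) atTop (𝓝 Q.1) := (continuous_fst.tendsto Q).comp hl
  have hl2 : Tendsto (fun k => (P k).2) atTop (𝓝 Q.2) := (continuous_snd.tendsto Q).comp hl
  have hcx : ∀ s ∈ Set.Ioo 0 τ, Tendsto (fun k => u (P k).1 s) atTop (𝓝 (u Q.1 s)) :=
    fun s hs => ((h.c2 s hs).continuous.tendsto Q.1).comp hl1
  have hN : (0:ℝ) < 1 / (N + 1) := by positivity
  have hu : Tendsto (fun k => u (P k).1 (P k).2) atTop (𝓝 (u Q.1 Q.2)) := by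
    have h0 : Tendsto (fun k => u (P k).1 Q.2 - u (P k).1 (P k).2) atTop (𝓝 0) := by
      have hz : Tendsto (fun k => (N + 1 : ℝ) * |Q.2 - (P k).2|) atTop (𝓝 0) := by
        have := ((tendsto_const_nhds (x := Q.2)).sub hl2).abs.const_mul (N + 1 : ℝ)
        simpa using this
      refine squeeze_zero_norm' ?_ hz
      have : ∀ᶠ k in atTop, |Q.2 - (P k).2| < 1 / (N + 1 : ℝ) := by
        have := ((tendsto_const_nhds (x := Q.2)).sub hl2).abs
        rw [sub_self, abs_zero] at this
        exact this.eventually_lt_const hN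
      filter_upwards [this] with k hk using (hP k).1 Q.2 hQ hk
    have := (hcx Q.2 hQ).sub h0
    simpa using this
  constructor
  · intro s hs hsN
    have hls : Tendsto (fun k => |s - (P k).2|) atTop (𝓝 |s - Q.2|) :=
      ((tendsto_const_nhds (x := s)).sub hl2).abs
    refine le_of_tendsto_of_tendsto ((hcx s hs).sub hu).abs (hls.const_mul _) ?_
    filter_upwards [hls.eventually_lt_const hsN] with k hk using (hP k).1 s hs hk
  · intro y hy
    have hls : Tendsto (fun k => ‖y - (P k).1‖) atTop (𝓝 ‖y - Q.1‖) :=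
      ((tendsto_const_nhds (x := y)).sub hl1).norm
    have hyt : Tendsto (fun k => u y (P k).2) atTop (𝓝 (u y Q.2)) :=
      (h.eqn y Q.2 hQ).continuousAt.tendsto.comp hl2
    refine le_of_tendsto_of_tendsto (hyt.sub hu).abs (hls.const_mul _) ?_
    filter_upwards [hls.eventually_lt_const hy] with k hk using (hP k).2 y hk

/-- The singular set: points without a neighbourhood of joint right continuity. -/
def singSet (u : Eu n → ℝ → ℝ) (τ : ℝ) : Set (Eu n × ℝ) :=
  (Set.univ ×ˢ Set.Ioo 0 τ) \ interior {P | RightCont u P.1 P.2}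

lemma rightCont_of_not_mem {P : Eu n × ℝ} (hP : P.2 ∈ Set.Ioo 0 τ) (h : P ∉ singSet u τ) :
    RightCont u P.1 P.2 := by
  by_contra hcon
  exact h ⟨⟨trivial, hP⟩, fun hi => hcon (interior_subset hi)⟩

lemma rightCont_of_lip (h : IsSol f u τ M K) {P : Eu n × ℝ} (hP : P ∈ singSet u τ) {N : ℕ}
    (hN : ∀ᶠ Q in 𝓝 P, Q ∈ singSet u τ → LipAt u τ N Q) : RightCont u P.1 P.2 := by
  obtain ⟨x₀, t₀⟩ := P
  have ht₀ : t₀ ∈ Set.Ioo 0 τ := hP.1.2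
  obtain ⟨δ, hδ, hN⟩ := Metric.eventually_nhds_iff.1 hN
  have hM : 0 ≤ M := (abs_nonneg _).trans (h.bdd x₀ t₀ ht₀)
  have hK : 0 ≤ K := (abs_nonneg _).trans (h.bddf x₀ t₀ ht₀)
  have hP0 := hN (y := (x₀, t₀)) (by simpa using hδ) hP
  set C : ℝ := 4 * (N + 1) + K + (2 * M + K) * (8 * n) + 32 * n * M with hC
  have hC0 : 0 < C := by positivity
  refine Metric.tendsto_nhds.2 fun ε hε => ?_
  have hN1 : (0:ℝ) < 1 / (N + 1) := by positivity
  obtain ⟨ρ, hρ0, hρ1, hρ2, hρ3, hρ4, hρ5⟩ : ∃ ρ : ℝ, 0 < ρ ∧ ρ < 1 ∧ 2 * ρ < 1 / (N + 1 : ℝ) ∧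
      t₀ + ρ < τ ∧ ρ < δ ∧ C * ρ < ε := by
    have e : ∀ {a : ℝ}, 0 < a → ∀ᶠ ρ : ℝ in 𝓝[>] 0, ρ < a := fun ha => by
      filter_upwards [Ioo_mem_nhdsGT ha] with x hx using hx.2
    have e0 : ∀ᶠ ρ : ℝ in 𝓝[>] 0, 0 < ρ := self_mem_nhdsWithin
    obtain ⟨ρ, h0, h1, h2, h3, h4, h5⟩ := (e0.and
      ((e one_pos).and ((e (half_pos hN1)).and ((e (sub_pos.2 ht₀.2)).and
      ((e hδ).and (e (div_pos hε hC0))))))).exists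
    exact ⟨ρ, h0, h1, by linarith, by linarith, h4, by rwa [lt_div_iff₀ hC0, mul_comm] at h5⟩
  have hρ3' : ρ ^ 3 ≤ ρ := by
    calc ρ ^ 3 ≤ ρ ^ 1 := pow_le_pow_of_le_one hρ0.le hρ1.le (by norm_num)
      _ = ρ := pow_one ρ
  have hnb : Metric.closedBall x₀ (ρ / 2) ×ˢ Set.Icc t₀ (t₀ + ρ ^ 3) ∈ 𝓝 x₀ ×ˢ 𝓝[≥] t₀ :=
    Filter.prod_mem_prod (Metric.closedBall_mem_nhds _ (by positivity))
      (Icc_mem_nhdsGE (by linarith [pow_pos hρ0 3]))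
  filter_upwards [hnb] with Q hQ
  obtain ⟨y, s⟩ := Q
  obtain ⟨hy, hs1, hs2⟩ := hQ
  simp only at hy hs1 hs2 ⊢
  rw [Real.dist_eq]
  refine lt_of_le_of_lt ?_ hρ5
  -- the last singular time before `s`
  set Z : Set (Eu n × ℝ) := singSet u τ ∩ (Metric.closedBall x₀ ρ ×ˢ Set.Icc t₀ s) with hZ
  have hZc : IsCompact Z := by
    have : Z = (Metric.closedBall x₀ ρ ×ˢ Set.Icc t₀ s) \ interior {P | RightCont u P.1 P.2} := by
      ext Q
      constructor
      · rintro ⟨h1, h2⟩; exact ⟨h2, h1.2⟩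
      · rintro ⟨h1, h2⟩
        exact ⟨⟨⟨trivial, ht₀.1.trans_le h1.2.1, by linarith [h1.2.2]⟩, h2⟩, h1⟩
    rw [this]
    exact ((isCompact_closedBall x₀ ρ).prod isCompact_Icc).diff isOpen_interior
  have hPZ : (x₀, t₀) ∈ Z := ⟨hP, by simp [hρ0.le], le_rfl, hs1⟩
  obtain ⟨α, ⟨⟨x₁, α'⟩, hx₁, hαα⟩, hαmax⟩ :=
    (hZc.image continuous_snd).exists_isGreatest ⟨_, _, hPZ, rfl⟩
  simp only at hαα
  subst hαα
  have hα1 : t₀ ≤ α' := hx₁.2.2.1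
  have hα2 : α' ≤ s := hx₁.2.2.2
  have hx₁b : ‖x₁ - x₀‖ ≤ ρ := by rw [← dist_eq_norm]; exact hx₁.2.1
  have hαρ : |α' - t₀| ≤ ρ ^ 3 := by rw [abs_of_nonneg] <;> linarith
  have hατ : α' ∈ Set.Ioo 0 τ := ⟨ht₀.1.trans_le hα1, by linarith⟩
  have hL1 := hN (y := (x₁, α')) (by
    rw [Prod.dist_eq, max_lt_iff]
    simp only [dist_eq_norm, Real.norm_eq_abs]
    constructor <;> linarith) hx₁.1
  have hslice : ∀ z ∈ Metric.closedBall x₀ ρ, |u z α' - u x₀ t₀| ≤ (N + 1) * (3 * ρ + ρ ^ 3) := by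
    intro z hz
    have hz' : ‖z - x₀‖ ≤ ρ := by rw [← dist_eq_norm]; exact hz
    have hzx : ‖z - x₁‖ ≤ 2 * ρ := by
      calc ‖z - x₁‖ = ‖(z - x₀) - (x₁ - x₀)‖ := by congr 1; abel
        _ ≤ _ := (norm_sub_le _ _).trans (by linarith)
    have hx0' : ‖x₀ - x₁‖ ≤ ρ := by rw [norm_sub_rev]; exact hx₁b
    have h1 := hL1.2 z (by simp only; linarith)
    have h2 := hL1.2 x₀ (by simp only; linarith)
    have h3 := hP0.1 α' hατ (by simp only; linarith)
    simp only at h1 h2 h3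
    have hNp : (0:ℝ) ≤ N + 1 := by positivity
    have h1' := h1.trans (mul_le_mul_of_nonneg_left hzx hNp)
    have h2' := h2.trans (mul_le_mul_of_nonneg_left hx0' hNp)
    have h3' := h3.trans (mul_le_mul_of_nonneg_left hαρ hNp)
    rw [abs_le] at h1' h2' h3' ⊢
    constructor <;> linarith [h1'.1, h1'.2, h2'.1, h2'.2, h3'.1, h3'.2]
  have hyρ : Metric.closedBall y (ρ / 2) ⊆ Metric.closedBall x₀ ρ := by
    refine Metric.closedBall_subset_closedBall' ?_
    have : dist y x₀ ≤ ρ / 2 := hy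
    linarith
  have hn : (0:ℝ) ≤ n := by positivity
  rcases hα2.eq_or_lt with heq | hlt
  · rw [← heq]
    have := hslice y (hyρ (Metric.mem_closedBall_self (by positivity)))
    refine this.trans ?_
    rw [hC]
    nlinarith [mul_nonneg hK hρ0.le, mul_nonneg (mul_nonneg (by linarith : (0:ℝ) ≤ 2 * M + K) hn)
      hρ0.le, mul_nonneg (mul_nonneg hn hM) hρ0.le, Nat.cast_nonneg (α := ℝ) N]
  · have hrc : ∀ x ∈ Metric.closedBall y (ρ / 2), ∀ t ∈ Set.Ioc α' s, RightCont u x t := by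
      intro x hx t ht
      refine rightCont_of_not_mem (P := (x, t)) (τ := τ) ⟨hατ.1.trans ht.1, by
        simp only; linarith [ht.2]⟩ fun hmem => ?_
      exact absurd (hαmax ⟨(x, t), ⟨hmem, hyρ hx, hα1.trans ht.1.le, ht.2⟩, rfl⟩) (not_le.2 ht.1)
    have hkey := h.abs_sub_local (x₀ := y) (r := ρ / 2) (v := u x₀ t₀) (by positivity) hατ.1 hlt
      (by linarith) hrc (fun x hx => hslice x (hyρ hx))
    refine hkey.trans ?_
    have hd0 : 0 ≤ s - α' := by linarith
    have hd : s - α' ≤ ρ ^ 3 := by linarith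
    have hd1 : s - α' ≤ ρ := hd.trans hρ3'
    have hq : (s - α') / (ρ / 2) ^ 2 ≤ 4 * ρ := by
      rw [div_le_iff₀ (by positivity)]
      nlinarith
    have hq0 : 0 ≤ (s - α') / (ρ / 2) ^ 2 := by positivity
    have e1 : (2 * M + K * (s - α')) * (2 * n * (s - α')) / (ρ / 2) ^ 2 ≤
        (2 * M + K) * (8 * n) * ρ := by
      calc _ = (2 * M + K * (s - α')) * (2 * n) * ((s - α') / (ρ / 2) ^ 2) := by ring
        _ ≤ (2 * M + K * 1) * (2 * n) * (4 * ρ) := by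
          gcongr
          linarith
        _ = _ := by ring
    have e2 : 8 * n * M * (s - α') / (ρ / 2) ^ 2 ≤ 32 * n * M * ρ := by
      calc _ = 8 * n * M * ((s - α') / (ρ / 2) ^ 2) := by ring
        _ ≤ 8 * n * M * (4 * ρ) := by gcongr
        _ = _ := by ring
    have e3 : K * (s - α') ≤ K * ρ := by gcongr
    have e4 : (N + 1 : ℝ) * (3 * ρ + ρ ^ 3) ≤ 4 * (N + 1) * ρ := by nlinarith
    rw [hC]
    linarith

/-- Bounded classical solutions are jointly right continuous. -/
theorem rightCont (h : IsSol f u τ M K) (x : Eu n) {t : ℝ} (ht : t ∈ Set.Ioo 0 τ) :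
    RightCont u x t := by
  suffices hS : singSet u τ = ∅ from
    rightCont_of_not_mem (P := (x, t)) (τ := τ) ht (by rw [hS]; exact Set.notMem_empty _)
  by_contra hne
  obtain ⟨P₁, hP₁⟩ := Set.nonempty_iff_ne_empty.2 hne
  have : IsLocallyClosed (singSet u τ) := by
    unfold singSet
    rw [Set.sdiff_eq]
    exact (isOpen_univ.prod isOpen_Ioo).isLocallyClosed.inter
      isOpen_interior.isClosed_compl.isLocallyClosed
  have := this.locallyCompactSpace
  have : Nonempty (singSet u τ) := ⟨⟨P₁, hP₁⟩⟩
  have hcl : ∀ N : ℕ, IsClosed {P : singSet u τ | LipAt u τ N P} := fun N =>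
    IsSeqClosed.isClosed fun P Q hP hl =>
      h.lipAt_of_tendsto (P := fun k => (P k : Eu n × ℝ)) hP Q.2.1.2
        ((continuous_subtype_val.tendsto Q).comp hl)
  obtain ⟨N, P, hP⟩ := nonempty_interior_of_iUnion_of_closed hcl
    (Set.eq_univ_of_forall fun P => Set.mem_iUnion.2 (h.exists_lipAt P P.2.1.2))
  obtain ⟨V, hV, hVN⟩ := (mem_nhds_subtype _ _ _).1 (mem_interior_iff_mem_nhds.1 hP)
  obtain ⟨W, hWV, hWo, hPW⟩ := mem_nhds_iff.1 hV
  have hrc : ∀ Q ∈ W ∩ (Set.univ ×ˢ Set.Ioo 0 τ), RightCont u Q.1 Q.2 := by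
    intro Q hQ
    by_cases hQS : Q ∈ singSet u τ
    · refine h.rightCont_of_lip hQS (N := N) ?_
      filter_upwards [hWo.mem_nhds hQ.1] with Q' hQ' hQ'S
      exact hVN (a := ⟨Q', hQ'S⟩) (hWV hQ')
    · exact rightCont_of_not_mem hQ.2.2 hQS
  exact P.2.2 (mem_interior.2 ⟨_, hrc, hWo.inter (isOpen_univ.prod isOpen_Ioo), hPW, P.2.1⟩)

end IsSol

end Regularity

section HeatApprox

variable {n : ℕ} {f : ℝ → ℝ} {u : Eu n → ℝ → ℝ} {τ M K : ℝ}

namespace IsSol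

lemma le_heat_quad (h : IsSol f u τ M K) {x₀ : Eu n} {t ε c κ : ℝ} (ht : 0 < t) (hε : 0 < ε)
    (htε : t + ε < τ) (hκ : 0 ≤ κ)
    (hf : ∀ x, ∀ s ∈ Set.Icc t (t + ε), f (u x s) ≤ c + κ * ‖x - x₀‖ ^ 2) :
    u x₀ (t + ε) ≤ heat ε (fun x => u x t) x₀ + c * ε + n * κ * ε ^ 2 := by
  have hsub : Set.Icc t (t + ε) ⊆ Set.Ioo 0 τ := fun s hs => ⟨ht.trans_le hs.1, hs.2.trans_lt htε⟩
  have hlim : Tendsto (fun r : ℝ => heat ε (fun x => u x t) x₀ + c * ε + n * κ * ε ^ 2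
      + (2 * M + |c| * ε) * (2 * n * ε) / r ^ 2 + 4 * n * M * ε / r ^ 2) atTop
      (𝓝 (heat ε (fun x => u x t) x₀ + c * ε + n * κ * ε ^ 2 + 0 + 0)) := by
    have h2 : Tendsto (fun r : ℝ => r ^ 2) atTop atTop := tendsto_pow_atTop two_ne_zero
    exact (tendsto_const_nhds.add (h2.const_div_atTop _)).add (h2.const_div_atTop _)
  rw [add_zero, add_zero] at hlim
  refine ge_of_tendsto hlim ?_
  filter_upwards [eventually_gt_atTop 0] with r hr
  exact le_heat_self hr hε hκ (fun x _ s hs => h.rightCont x (hsub hs)) (fun s hs => h.c2 s (hsub hs))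
    (fun x _ s hs => ⟨_, h.eqn x s (hsub ⟨hs.1.le, hs.2⟩), by linarith [hf x s ⟨hs.1.le, hs.2⟩]⟩)
    (fun x s hs => h.bdd x s (hsub hs))

lemma abs_sub_heat_le (h : IsSol f u τ M K) (x₀ : Eu n) {t ε K' : ℝ} (ht : 0 < t) (hε : 0 < ε)
    (htε : t + ε < τ) (hf : ∀ x, ∀ s ∈ Set.Icc t (t + ε), |f (u x s)| ≤ K') :
    |u x₀ (t + ε) - heat ε (fun x => u x t) x₀| ≤ K' * ε := by
  have h1 := h.le_heat_quad (x₀ := x₀) (c := K') ht hε htε le_rfl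
    (fun x s hs => by linarith [le_of_abs_le (hf x s hs)])
  have h2 := h.neg.le_heat_quad (x₀ := x₀) (c := K') ht hε htε le_rfl
    (fun x s hs => by rw [neg_neg]; linarith [neg_le_of_abs_le (hf x s hs)])
  rw [heat_neg] at h2
  rw [abs_le]
  constructor <;> linarith

lemma limsup_sub_heat (h : IsSol f u τ M K) (x₀ : Eu n) {t δ : ℝ} (ht : t ∈ Set.Ioo 0 τ)
    (hδ : 0 < δ) :
    ∀ᶠ ε in 𝓝[>] 0, (u x₀ (t + ε) - heat ε (fun x => u x t) x₀) / ε ≤ f (u x₀ t) + δ := by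
  have hrc : Tendsto (fun P : Eu n × ℝ => f (u P.1 P.2)) (𝓝 x₀ ×ˢ 𝓝[≥] t) (𝓝 (f (u x₀ t))) :=
    (h.contf.tendsto _).comp (h.rightCont x₀ ht)
  have hev := hrc.eventually_le_const (show f (u x₀ t) < f (u x₀ t) + δ / 2 by linarith)
  obtain ⟨pa, ha, pb, hb, hab⟩ := eventually_prod_iff.1 hev
  obtain ⟨r, hr, hra⟩ := Metric.eventually_nhds_iff.1 ha
  obtain ⟨η, hη, hηb⟩ := (mem_nhdsGE_iff_exists_Ico_subset' (lt_add_one t)).1 hb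
  have hK : 0 ≤ K := (abs_nonneg _).trans (h.bddf x₀ t ht)
  have hf0 := neg_le_of_abs_le (h.bddf x₀ t ht)
  set κ := 2 * K / r ^ 2 with hκ
  have hκ0 : 0 ≤ κ := by positivity
  have hnear : ∀ᶠ ε : ℝ in 𝓝[>] 0, n * κ * ε ≤ δ / 2 := by
    have : Tendsto (fun ε : ℝ => n * κ * ε) (𝓝[>] 0) (𝓝 (n * κ * 0)) :=
      ((continuous_const.mul continuous_id).tendsto _).mono_left nhdsWithin_le_nhds
    rw [mul_zero] at this
    exact this.eventually_le_const (by linarith)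
  filter_upwards [hnear, Ioo_mem_nhdsGT (sub_pos.2 ht.2), Ioo_mem_nhdsGT (sub_pos.2 hη)]
    with ε h1 h2 h3
  have := h.le_heat_quad (x₀ := x₀) (c := f (u x₀ t) + δ / 2) (κ := κ) ht.1 h2.1
    (by linarith [h2.2]) hκ0 (fun x s hs => by
      by_cases hx : ‖x - x₀‖ < r
      · have := hab (hra (y := x) (by rwa [dist_eq_norm])) (hηb ⟨hs.1, by linarith [hs.2, h3.2]⟩)
        have : 0 ≤ κ * ‖x - x₀‖ ^ 2 := by positivity
        simp only at *
        linarith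
      · have hs' := le_of_abs_le (h.bddf x s ⟨ht.1.trans_le hs.1, by linarith [hs.2, h2.2]⟩)
        have : 2 * K ≤ κ * ‖x - x₀‖ ^ 2 := by
          rw [hκ, div_mul_eq_mul_div, le_div_iff₀ (by positivity)]
          gcongr
          exact not_lt.1 hx
        linarith)
  rw [div_le_iff₀ h2.1]
  nlinarith [h2.1]

lemma tendsto_sub_heat_div (h : IsSol f u τ M K) (x₀ : Eu n) {t : ℝ} (ht : t ∈ Set.Ioo 0 τ) :
    Tendsto (fun ε => (u x₀ (t + ε) - heat ε (fun x => u x t) x₀) / ε) (𝓝[>] 0)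
      (𝓝 (f (u x₀ t))) := by
  refine Metric.tendsto_nhds.2 fun δ hδ => ?_
  filter_upwards [h.limsup_sub_heat x₀ ht (half_pos hδ), h.neg.limsup_sub_heat x₀ ht (half_pos hδ)]
    with ε h1 h2
  rw [heat_neg, neg_neg, neg_sub_neg, ← neg_sub, neg_div] at h2
  rw [Real.dist_eq, abs_lt]
  constructor <;> linarith

end IsSol

end HeatApprox

section Mollify

variable {n : ℕ}

/-- Convolution of `g` with the kernel `χ`. -/
noncomputable def moll (χ g : Eu n → ℝ) (x : Eu n) : ℝ := ∫ z, g z * χ (x - z)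

/-- Admissible mollifiers. -/
structure Moll (χ : Eu n → ℝ) : Prop where
  smooth : ∀ m : ℕ, ContDiff ℝ m χ
  supp : HasCompactSupport χ

namespace Moll

variable {χ g : Eu n → ℝ} {M : ℝ}

lemma continuous (h : Moll χ) : Continuous χ := (h.smooth 0).continuous

lemma pd (h : Moll χ) (i : Fin n) : Moll (pd i χ) where
  smooth m := contDiff_pd (h.smooth (m + 1)) i
  supp := h.supp.fderiv_apply (𝕜 := ℝ) _

lemma integrable (h : Moll χ) : Integrable χ := h.continuous.integrable_of_hasCompactSupport h.supp

lemma integrable_mul (h : Moll χ) (hg : Continuous g) (x : Eu n) :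
    Integrable fun z => g z * χ (x - z) := by
  have h1 : HasCompactSupport fun z => χ (x - z) :=
    h.supp.comp_homeomorph (Homeomorph.subLeft x)
  have := h.continuous
  exact Continuous.integrable_of_hasCompactSupport (by fun_prop) h1.mul_left

lemma moll_eq_convolution (χ g : Eu n → ℝ) :
    moll χ g = convolution g χ (ContinuousLinearMap.mul ℝ ℝ) volume := rfl

lemma differentiable (h : Moll χ) (hg : Continuous g) : Differentiable ℝ (moll χ g) := fun x =>
  (h.supp.hasFDerivAt_convolution_right (ContinuousLinearMap.mul ℝ ℝ) hg.locallyIntegrable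
    (h.smooth 1) x).differentiableAt

lemma contDiff (h : Moll χ) (hg : Continuous g) (m : ℕ) : ContDiff ℝ m (moll χ g) :=
  h.supp.contDiff_convolution_right (n := (m : ℕ∞)) (ContinuousLinearMap.mul ℝ ℝ)
    hg.locallyIntegrable (h.smooth m)

lemma pd_moll (h : Moll χ) (hg : Continuous g) (i : Fin n) :
    _root_.pd i (moll χ g) = moll (_root_.pd i χ) g := by
  ext x
  have h1 := h.supp.hasFDerivAt_convolution_right (ContinuousLinearMap.mul ℝ ℝ)
    (hg.locallyIntegrable (μ := volume)) (h.smooth 1) x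
  rw [_root_.pd, moll_eq_convolution, h1.fderiv, convolution_precompR_apply _ hg.locallyIntegrable
    (h.supp.fderiv (𝕜 := ℝ)) ((h.smooth 1).continuous_fderiv (by norm_num))]
  rfl

lemma integral_abs_sub (χ : Eu n → ℝ) (x : Eu n) : ∫ z, |χ (x - z)| = ∫ z, |χ z| :=
  integral_sub_left_eq_self (fun z => |χ z|) volume x

lemma abs_moll_le (h : Moll χ) (hM : ∀ x, |g x| ≤ M) (x : Eu n) :
    |moll χ g x| ≤ M * ∫ z, |χ z| := by
  have := h.continuous
  rw [← integral_abs_sub χ x, ← integral_const_mul]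
  refine norm_integral_le_of_norm_le (f := fun z => g z * χ (x - z))
    (Integrable.const_mul ?_ _) (Eventually.of_forall fun z => ?_)
  · exact (h.integrable.comp_sub_left x).abs
  · rw [norm_mul]
    exact mul_le_mul_of_nonneg_right (hM z) (abs_nonneg _)

lemma lap_moll (h : Moll χ) (hg : Continuous g) (x : Eu n) :
    lap n (moll χ g) x = ∑ i, moll (_root_.pd i (_root_.pd i χ)) g x := by
  simp_rw [lap_eq_sum_pd, h.pd_moll hg, (h.pd _).pd_moll hg]

lemma c2b (h : Moll χ) (hg : Continuous g) (hM : ∀ x, |g x| ≤ M) : C2b (moll χ g) where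
  contDiff := h.contDiff hg 2
  bdd := ⟨_, h.abs_moll_le hM⟩
  bdd_pd := by
    refine ⟨∑ i, |M * (∫ z, |_root_.pd i χ z|)|, fun i x => ?_⟩
    rw [h.pd_moll hg]
    exact ((h.pd i).abs_moll_le hM x).trans ((le_abs_self _).trans
      (Finset.single_le_sum (f := fun i => |M * (∫ z, |_root_.pd i χ z|)|)
        (fun _ _ => abs_nonneg _) (Finset.mem_univ i)))
  bdd_pd_pd := by
    refine ⟨∑ i, |M * (∫ z, |_root_.pd i (_root_.pd i χ) z|)|, fun i x => ?_⟩
    rw [h.pd_moll hg, (h.pd i).pd_moll hg]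
    exact (((h.pd i).pd i).abs_moll_le hM x).trans ((le_abs_self _).trans
      (Finset.single_le_sum (f := fun i => |M * (∫ z, |_root_.pd i (_root_.pd i χ) z|)|)
        (fun _ _ => abs_nonneg _) (Finset.mem_univ i)))

lemma moll_heat (h : Moll χ) (hg : Continuous g) (hM : ∀ x, |g x| ≤ M) (ε : ℝ) (x : Eu n) :
    moll χ (heat ε g) x = heat ε (moll χ g) x := by
  have hχ := h.continuous
  have h_integ : Integrable (Function.uncurry fun z y => g (z + √ε • y) * (χ (x - z) * rho n y))
      (volume.prod volume) := by
    refine Integrable.bdd_mul (c := M)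
      (f := fun P : Eu n × Eu n => g (P.1 + √ε • P.2)) ?_ ?_ (Eventually.of_forall fun _ => hM _)
    · exact (h.integrable.comp_sub_left x).mul_prod integrable_rho
    · exact (by fun_prop : Continuous fun P : Eu n × Eu n => g (P.1 + √ε • P.2)).aestronglyMeasurable
  calc moll χ (heat ε g) x = ∫ z, ∫ y, g (z + √ε • y) * (χ (x - z) * rho n y) := by
        unfold moll heat
        simp_rw [← integral_mul_const]
        congr 1; ext z; congr 1; ext y; ring
    _ = ∫ y, ∫ z, g (z + √ε • y) * (χ (x - z) * rho n y) := integral_integral_swap h_integ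
    _ = heat ε (moll χ g) x := by
        unfold moll heat
        congr 1; ext y
        rw [← integral_mul_const]
        symm
        rw [← integral_add_right_eq_self _ (√ε • y)]
        congr 1; ext z
        rw [add_sub_add_right_eq_sub]; ring

lemma continuousOn_moll (h : Moll χ) {G : Eu n → ℝ → ℝ} {S : Set ℝ} (hS : IsOpen S)
    (hM : ∀ x, ∀ t ∈ S, |G x t| ≤ M) (hx : ∀ t ∈ S, Continuous fun x => G x t)
    (ht : ∀ x, ContinuousOn (fun t => G x t) S) :
    ContinuousOn (fun P : Eu n × ℝ => moll χ (fun x => G x P.2) P.1) (Set.univ ×ˢ S) := by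
  have hχ := h.continuous
  rintro ⟨x₀, t₀⟩ ⟨-, ht₀⟩
  refine ContinuousAt.continuousWithinAt ?_
  obtain ⟨R, hR⟩ := h.supp.isCompact.isBounded.subset_closedBall 0
  obtain ⟨C, hC⟩ := h.supp.exists_bound_of_continuous hχ
  have hnb : ∀ᶠ P : Eu n × ℝ in 𝓝 (x₀, t₀), ‖P.1 - x₀‖ < 1 ∧ P.2 ∈ S := by
    refine Filter.Eventually.and ?_ (continuous_snd.continuousAt.eventually_mem (hS.mem_nhds ht₀))
    have : ContinuousAt (fun P : Eu n × ℝ => ‖P.1 - x₀‖) (x₀, t₀) := by fun_prop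
    exact this.eventually_lt_const (by simp)
  refine continuousAt_of_dominated (bound := (Metric.closedBall (0 : Eu n) (‖x₀‖ + 1 + R)).indicator
    fun _ => M * C) ?_ ?_ ?_ (Eventually.of_forall fun z => ?_)
  · filter_upwards [hnb] with P hP
    have := hx P.2 hP.2
    exact (by fun_prop : Continuous fun z => G z P.2 * χ (P.1 - z)).aestronglyMeasurable
  · filter_upwards [hnb] with P hP
    refine Eventually.of_forall fun z => ?_
    by_cases hz : z ∈ Metric.closedBall (0 : Eu n) (‖x₀‖ + 1 + R)
    · rw [Set.indicator_of_mem hz, norm_mul]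
      exact mul_le_mul (hM z _ hP.2) (hC _) (norm_nonneg _) ((abs_nonneg _).trans (hM z _ hP.2))
    · rw [Set.indicator_of_notMem hz, image_eq_zero_of_notMem_tsupport (f := χ) (x := P.1 - z),
        mul_zero, norm_zero]
      intro hmem
      refine hz ?_
      have h1 := hR hmem
      rw [mem_closedBall_zero_iff] at h1 ⊢
      calc ‖z‖ = ‖x₀ + (P.1 - x₀) - (P.1 - z)‖ := by congr 1; abel
        _ ≤ ‖x₀‖ + ‖P.1 - x₀‖ + ‖P.1 - z‖ := (norm_sub_le _ _).trans (by gcongr; exact norm_add_le _ _)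
        _ ≤ _ := by linarith [hP.1]
  · exact (integrableOn_const (measure_closedBall_lt_top.ne)).integrable_indicator
      measurableSet_closedBall
  · have h1 : ContinuousAt (fun P : Eu n × ℝ => G z P.2) (x₀, t₀) :=
      ((ht z).continuousAt (hS.mem_nhds ht₀)).comp (f := Prod.snd) continuousAt_snd
    exact h1.mul (by fun_prop)

end Moll

namespace IsSol

variable {f : ℝ → ℝ} {u : Eu n → ℝ → ℝ} {τ M K : ℝ} {χ : Eu n → ℝ}

lemma continuousOn_time (h : IsSol f u τ M K) (x : Eu n) :
    ContinuousOn (fun t => u x t) (Set.Ioo 0 τ) := fun t ht =>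
  (h.eqn x t ht).continuousAt.continuousWithinAt

lemma continuousOn_moll (h : IsSol f u τ M K) (hχ : Moll χ) :
    ContinuousOn (fun P : Eu n × ℝ => moll χ (fun x => u x P.2) P.1) (Set.univ ×ˢ Set.Ioo 0 τ) :=
  hχ.continuousOn_moll isOpen_Ioo h.bdd (fun t ht => (h.c2 t ht).continuous) h.continuousOn_time

lemma continuousOn_moll_f (h : IsSol f u τ M K) (hχ : Moll χ) :
    ContinuousOn (fun P : Eu n × ℝ => moll χ (fun x => f (u x P.2)) P.1)
      (Set.univ ×ˢ Set.Ioo 0 τ) :=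
  hχ.continuousOn_moll (G := fun x t => f (u x t)) isOpen_Ioo h.bddf
    (fun t ht => h.contf.comp (h.c2 t ht).continuous)
    fun x => h.contf.comp_continuousOn (h.continuousOn_time x)

lemma hasDerivWithinAt_moll (h : IsSol f u τ M K) (hχ : Moll χ) (x : Eu n) {t : ℝ}
    (ht : t ∈ Set.Ioo 0 τ) :
    HasDerivWithinAt (fun t => moll χ (fun x => u x t) x)
      (∑ i, moll (pd i (pd i χ)) (fun x => u x t) x + moll χ (fun x => f (u x t)) x)
      (Set.Ici t) t := by
  have hc := (h.c2 t ht).continuous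
  have hM := fun x => h.bdd x t ht
  have hK : 0 ≤ K := (abs_nonneg _).trans (h.bddf x t ht)
  have hcχ := hχ.continuous
  have hheat : ∀ ε, Continuous (heat ε fun x => u x t) := fun ε =>
    (continuous_heat hc hM).comp (f := fun x => (x, ε)) (by fun_prop)
  have h1 : Tendsto (fun ε => ∫ z, (u z (t + ε) - heat ε (fun x => u x t) z) / ε * χ (x - z))
      (𝓝[>] 0) (𝓝 (moll χ (fun x => f (u x t)) x)) := by
    refine tendsto_integral_filter_of_dominated_convergence (fun z => K * |χ (x - z)|) ?_ ?_
      ((hχ.integrable.comp_sub_left x).abs.const_mul K) (Eventually.of_forall fun z =>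
        (h.tendsto_sub_heat_div z ht).mul_const _)
    · filter_upwards [Ioo_mem_nhdsGT (sub_pos.2 ht.2)] with ε hε
      have hc' := (h.c2 (t + ε) ⟨by linarith [ht.1, hε.1], by linarith [hε.2]⟩).continuous
      have := hheat ε
      exact Continuous.aestronglyMeasurable (by fun_prop)
    · filter_upwards [Ioo_mem_nhdsGT (sub_pos.2 ht.2)] with ε hε
      refine Eventually.of_forall fun z => ?_
      rw [norm_mul, norm_div, Real.norm_of_nonneg hε.1.le]
      refine mul_le_mul_of_nonneg_right ?_ (abs_nonneg _)
      rw [div_le_iff₀ hε.1]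
      exact h.abs_sub_heat_le z ht.1 hε.1 (by linarith [hε.2]) fun y s hs =>
        h.bddf y s ⟨ht.1.trans_le hs.1, by linarith [hs.2, hε.2]⟩
  have h2 : Tendsto (fun ε => (heat ε (moll χ fun x => u x t) x - moll χ (fun x => u x t) x) / ε)
      (𝓝[>] 0) (𝓝 (∑ i, moll (pd i (pd i χ)) (fun x => u x t) x)) := by
    have := (hχ.c2b hc hM).hasDerivWithinAt_heat_zero x
    rw [← hasDerivWithinAt_Ioi_iff_Ici, hasDerivWithinAt_iff_tendsto_slope' (by simp),
      hχ.lap_moll hc] at this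
    refine this.congr fun ε => ?_
    rw [slope_def_field, heat_zero, sub_zero]
  rw [← hasDerivWithinAt_Ioi_iff_Ici, hasDerivWithinAt_iff_tendsto_slope' (by simp)]
  have h3 : Tendsto (fun s : ℝ => s - t) (𝓝[>] t) (𝓝[>] 0) := by
    refine tendsto_nhdsWithin_iff.2 ⟨?_, ?_⟩
    · have : Tendsto (fun s : ℝ => s - t) (𝓝 t) (𝓝 (t - t)) := by
        exact (continuous_id.sub continuous_const).tendsto t
      rw [sub_self] at this
      exact this.mono_left nhdsWithin_le_nhds
    · filter_upwards [self_mem_nhdsWithin] with s (hs : t < s) using sub_pos.2 hs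
  refine ((h2.add h1).comp h3).congr' ?_
  filter_upwards [Ioo_mem_nhdsGT ht.2] with s hs
  simp only [Function.comp, slope_def_field]
  have hs0 : 0 < s - t := sub_pos.2 hs.1
  have hc' := (h.c2 s ⟨ht.1.trans hs.1, hs.2⟩).continuous
  have e : (∫ z, (u z (t + (s - t)) - heat (s - t) (fun x => u x t) z) / (s - t) * χ (x - z)) =
      (moll χ (fun x => u x s) x - heat (s - t) (moll χ fun x => u x t) x) / (s - t) := by
    rw [← hχ.moll_heat hc hM, moll, moll, ← integral_sub (hχ.integrable_mul hc' x)
      (hχ.integrable_mul (hheat _) x), ← integral_div]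
    congr 1; ext z
    rw [add_sub_cancel]; ring
  rw [e]
  field_simp
  ring

lemma hasDerivAt_moll (h : IsSol f u τ M K) (hχ : Moll χ) (x : Eu n) {t : ℝ}
    (ht : t ∈ Set.Ioo 0 τ) :
    HasDerivAt (fun t => moll χ (fun x => u x t) x)
      (∑ i, moll (pd i (pd i χ)) (fun x => u x t) x + moll χ (fun x => f (u x t)) x) t := by
  set D : ℝ → ℝ := fun t =>
    ∑ i, moll (pd i (pd i χ)) (fun x => u x t) x + moll χ (fun x => f (u x t)) x with hD
  have hline : ContinuousOn (fun t : ℝ => (x, t)) (Set.Ioo 0 τ) := by fun_prop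
  have hmaps : Set.MapsTo (fun t : ℝ => (x, t)) (Set.Ioo 0 τ) (Set.univ ×ˢ Set.Ioo 0 τ) :=
    fun _ ht => ⟨trivial, ht⟩
  have hDc : ContinuousOn D (Set.Ioo 0 τ) :=
    (continuousOn_finsetSum _ fun i _ => (h.continuousOn_moll ((hχ.pd i).pd i)).comp hline hmaps).add
      ((h.continuousOn_moll_f hχ).comp hline hmaps)
  obtain ⟨a, ha0, hat⟩ := exists_between ht.1
  obtain ⟨b, htb, hbτ⟩ := exists_between ht.2
  have hsub : Set.Icc a b ⊆ Set.Ioo 0 τ := fun s hs => ⟨ha0.trans_le hs.1, hs.2.trans_lt hbτ⟩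
  have h_integ : ∀ s ∈ Set.Icc a b, HasDerivAt (fun s => ∫ r in a..s, D r) (D s) s := fun s hs => by
    refine intervalIntegral.integral_hasDerivAt_right ?_ ?_ (hDc.continuousAt (isOpen_Ioo.mem_nhds (hsub hs)))
    · exact (hDc.mono ((Set.uIcc_of_le hs.1).trans_subset
        ((Set.Icc_subset_Icc_right hs.2).trans hsub))).intervalIntegrable
    · exact hDc.stronglyMeasurableAtFilter isOpen_Ioo s (hsub hs)
  have heq : ∀ s ∈ Set.Icc a b, moll χ (fun x => u x s) x =
      moll χ (fun x => u x a) x + ∫ r in a..s, D r := by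
    refine eq_of_has_deriv_right_eq (f' := D) (fun s hs => h.hasDerivWithinAt_moll hχ x
      (hsub (Set.Ico_subset_Icc_self hs))) (fun s hs =>
      ((h_integ s (Set.Ico_subset_Icc_self hs)).const_add _).hasDerivWithinAt) ?_ ?_ (by simp)
    · exact ((h.continuousOn_moll hχ).comp hline hmaps).mono hsub
    · exact continuousOn_const.add fun s hs => (h_integ s hs).continuousAt.continuousWithinAt
  refine ((h_integ t ⟨hat.le, htb.le⟩).const_add (moll χ (fun x => u x a) x)).congr_of_eventuallyEq ?_
  filter_upwards [Ioo_mem_nhds hat htb] with s hs using heq s ⟨hs.1.le, hs.2.le⟩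

end IsSol

end Mollify

section Similarity

variable {n : ℕ}

/-- Functions of polynomial growth in space, uniformly in time, which are jointly continuous. -/
structure Good (S : Set ℝ) (G : Eu n → ℝ → ℝ) : Prop where
  growth : PolyGrowth S G
  cont : ContinuousOn (fun P : Eu n × ℝ => G P.1 P.2) (Set.univ ×ˢ S)

namespace Good

variable {S : Set ℝ} {G H : Eu n → ℝ → ℝ}

lemma slice (h : Good S G) {s : ℝ} (hs : s ∈ S) : Continuous fun y => G y s := by
  rw [← continuousOn_univ]
  exact h.cont.comp (f := fun y => (y, s)) (by fun_prop) fun _ _ => ⟨trivial, hs⟩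

lemma time (h : Good S G) (y : Eu n) : ContinuousOn (fun s => G y s) S :=
  h.cont.comp (f := fun s => (y, s)) (by fun_prop) fun _ hs => ⟨trivial, hs⟩

lemma const (c : ℝ) : Good S (fun (_ : Eu n) _ => c) := ⟨.const c, continuousOn_const⟩

lemma coord (i : Fin n) : Good S (fun (y : Eu n) _ => y i) :=
  ⟨.coord i, by fun_prop⟩

lemma add (hG : Good S G) (hH : Good S H) : Good S (fun y s => G y s + H y s) :=
  ⟨hG.growth.add hH.growth, hG.cont.add hH.cont⟩

lemma sub (hG : Good S G) (hH : Good S H) : Good S (fun y s => G y s - H y s) :=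
  ⟨hG.growth.sub hH.growth, hG.cont.sub hH.cont⟩

lemma mul (hG : Good S G) (hH : Good S H) : Good S (fun y s => G y s * H y s) :=
  ⟨hG.growth.mul hH.growth, hG.cont.mul hH.cont⟩

lemma neg (hG : Good S G) : Good S (fun y s => -G y s) := ⟨hG.growth.neg, hG.cont.neg⟩

lemma const_mul (c : ℝ) (hG : Good S G) : Good S (fun y s => c * G y s) := (const c).mul hG

lemma pow (hG : Good S G) (m : ℕ) : Good S (fun y s => G y s ^ m) :=
  ⟨hG.growth.pow m, hG.cont.pow m⟩

lemma sum {κ : Type*} (t : Finset κ) {G : κ → Eu n → ℝ → ℝ} (h : ∀ j ∈ t, Good S (G j)) :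
    Good S (fun y s => ∑ j ∈ t, G j y s) :=
  ⟨.sum t fun j hj => (h j hj).growth, continuousOn_finsetSum _ fun j hj => (h j hj).cont⟩

lemma comp_bdd (hG : Good S G) {M : ℝ} (hM : ∀ y, ∀ s ∈ S, |G y s| ≤ M) {g : ℝ → ℝ}
    (hg : Continuous g) : Good S (fun y s => g (G y s)) := by
  obtain ⟨C, hC⟩ := (isCompact_Icc (a := -M) (b := M)).exists_bound_of_continuousOn hg.continuousOn
  exact ⟨.of_bdd (M := C) fun s hs y => hC _ (abs_le.1 (hM y s hs)), hg.comp_continuousOn hG.cont⟩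

lemma integrable (hG : Good S G) {s : ℝ} (hs : s ∈ S) : Integrable fun y => G y s * rho n y :=
  hG.growth.integrable hs (hG.slice hs).aestronglyMeasurable

lemma continuousOn_integral (hG : Good S G) (hS : IsOpen S) :
    ContinuousOn (fun s => ∫ y, G y s * rho n y) S :=
  continuousOn_integral_rho hS hG.growth hG.time fun _ hs => (hG.slice hs).aestronglyMeasurable

lemma hasDerivAt_integral (hG : Good S G) (hS : IsOpen S) (hH : Good S H)
    (hd : ∀ y, ∀ s ∈ S, HasDerivAt (fun s => G y s) (H y s) s) {s : ℝ} (hs : s ∈ S) :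
    HasDerivAt (fun s => ∫ y, G y s * rho n y) (∫ y, H y s * rho n y) s :=
  hasDerivAt_integral_rho hS hG.growth hH.growth (fun _ hs => (hG.slice hs).aestronglyMeasurable)
    (fun _ hs => (hH.slice hs).aestronglyMeasurable) hd hs

lemma integral_lineDeriv (hG : Good S G) (hH : Good S H) {s : ℝ} (hs : s ∈ S) {i : Fin n}
    (hd : ∀ y, HasLineDerivAt ℝ (fun y => G y s) (H y s) y (bv i)) :
    ∫ y, H y s * rho n y = 1 / 2 * ∫ y, y i * G y s * rho n y := by
  refine integral_lineDeriv_mul_rho hd ?_ ?_ (hG.slice hs).aestronglyMeasurable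
    (hH.slice hs).aestronglyMeasurable
  · obtain ⟨A, k, hA, h⟩ := hG.growth
    exact ⟨A, k, hA, fun _ _ => h s hs⟩
  · obtain ⟨A, k, hA, h⟩ := hH.growth
    exact ⟨A, k, hA, fun _ _ => h s hs⟩

end Good

/-- Similarity variables of weight `k` centred at `(b, T)`. -/
noncomputable def sim (b : Eu n) (T k : ℝ) (V : Eu n → ℝ → ℝ) (y : Eu n) (s : ℝ) : ℝ :=
  Real.exp (-k * s) * V (b + Real.exp (-s / 2) • y) (T - Real.exp (-s))

lemma sub_exp_mem {T s : ℝ} (hT : 0 < T) (hs : s ∈ Set.Ioi (-Real.log T)) :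
    T - Real.exp (-s) ∈ Set.Ioo 0 T := by
  have : Real.exp (-s) < T := (Real.lt_log_iff_exp_lt hT).1 (by linarith [hs.out])
  constructor <;> linarith [Real.exp_pos (-s)]

lemma exp_weight_le {T k s : ℝ} (hk : 0 ≤ k) (hs : s ∈ Set.Ioi (-Real.log T)) :
    Real.exp (-k * s) ≤ Real.exp (k * Real.log T) := by
  rw [Real.exp_le_exp]
  nlinarith [hs.out]

lemma good_sim (b : Eu n) {T k M : ℝ} (hT : 0 < T) (hk : 0 ≤ k) {V : Eu n → ℝ → ℝ}
    (hV : ContinuousOn (fun P : Eu n × ℝ => V P.1 P.2) (Set.univ ×ˢ Set.Ioo 0 T))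
    (hM : ∀ x, ∀ t ∈ Set.Ioo 0 T, |V x t| ≤ M) :
    Good (Set.Ioi (-Real.log T)) (sim b T k V) where
  growth := .of_bdd (M := Real.exp (k * Real.log T) * M) fun s hs y => by
    rw [sim, abs_mul, Real.abs_exp]
    exact mul_le_mul (exp_weight_le hk hs) (hM _ _ (sub_exp_mem hT hs)) (abs_nonneg _)
      (Real.exp_pos _).le
  cont := by
    refine ContinuousOn.mul (by fun_prop) ?_
    exact hV.comp (f := fun P : Eu n × ℝ =>
      (b + Real.exp (-P.2 / 2) • P.1, T - Real.exp (-P.2))) (by fun_prop)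
      fun P hP => ⟨trivial, sub_exp_mem hT hP.2⟩

lemma good_exp {T k : ℝ} (hT : 0 < T) (hk : 0 ≤ k) :
    Good (Set.Ioi (-Real.log T)) (fun (_ : Eu n) s => Real.exp (-k * s)) := by
  have := good_sim (n := n) 0 hT hk (V := fun _ _ => 1) (M := 1) continuousOn_const (by simp)
  have e : sim (0 : Eu n) T k (fun _ _ => 1) = fun _ s => Real.exp (-k * s) := by
    ext y s
    simp [sim]
  rwa [e] at this

lemma hasLineDerivAt_sim {b : Eu n} {T k : ℝ} {V V' : Eu n → ℝ → ℝ} {i : Fin n} {s : ℝ}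
    (h : ∀ x, HasLineDerivAt ℝ (fun x => V x (T - Real.exp (-s))) (V' x (T - Real.exp (-s))) x (bv i))
    (y : Eu n) :
    HasLineDerivAt ℝ (fun y => sim b T k V y s) (sim b T (k + 1 / 2) V' y s) y (bv i) := by
  have h1 := HasLineDerivAt.comp_line h (b + Real.exp (-s / 2) • y) 0
  have h2 : HasDerivAt (fun r : ℝ => Real.exp (-s / 2) * r) (Real.exp (-s / 2)) 0 := by
    simpa using (hasDerivAt_id (0:ℝ)).const_mul (Real.exp (-s / 2))
  have h3 := (HasDerivAt.comp_of_eq (h := fun r : ℝ => Real.exp (-s / 2) * r) (x := 0) (y := 0)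
    h1 h2 (by simp)).const_mul (Real.exp (-k * s))
  unfold HasLineDerivAt
  refine (h3.congr_of_eventuallyEq (Eventually.of_forall fun r => ?_)).congr_deriv ?_
  · simp only [sim, Function.comp, smul_add, smul_smul, add_assoc]
  · simp only [sim, zero_smul, add_zero]
    rw [show -(k + 1 / 2) * s = -k * s + -s / 2 by ring, Real.exp_add]
    ring

/-- A solution in similarity variables, together with its derivatives. -/
structure SimSol (q : ℝ) (f : ℝ → ℝ) (S : Set ℝ) (w ws ξ : Eu n → ℝ → ℝ)
    (wi wii wis : Fin n → Eu n → ℝ → ℝ) : Prop where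
  good_w : Good S w
  good_ws : Good S ws
  good_ξ : Good S ξ
  good_wi : ∀ i, Good S (wi i)
  good_wii : ∀ i, Good S (wii i)
  good_wis : ∀ i, Good S (wis i)
  deriv_w : ∀ y, ∀ s ∈ S, HasDerivAt (fun s => w y s) (ws y s) s
  deriv_wi : ∀ i y, ∀ s ∈ S, HasDerivAt (fun s => wi i y s) (wis i y s) s
  line_w : ∀ i, ∀ s ∈ S, ∀ y, HasLineDerivAt ℝ (fun y => w y s) (wi i y s) y (bv i)
  line_wi : ∀ i, ∀ s ∈ S, ∀ y, HasLineDerivAt ℝ (fun y => wi i y s) (wii i y s) y (bv i)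
  line_ws : ∀ i, ∀ s ∈ S, ∀ y, HasLineDerivAt ℝ (fun y => ws y s) (wis i y s) y (bv i)
  eqn : ∀ y, ∀ s ∈ S, ws y s = ∑ i, (wii i y s - 1 / 2 * (y i * wi i y s)) - q * w y s +
    Real.exp (-(q + 1) * s) * f (Real.exp (q * s) * w y s) + ξ y s
  bdd : ∃ M, ∀ y, ∀ s ∈ S, |Real.exp (q * s) * w y s| ≤ M

lemma pd_comm {φ : Eu n → ℝ} (h : ContDiff ℝ 2 φ) (i j : Fin n) : pd i (pd j φ) = pd j (pd i φ) := by
  have key : ∀ (a b : Fin n) (x : Eu n), pd a (pd b φ) x = fderiv ℝ (fderiv ℝ φ) x (bv a) (bv b) := by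
    intro a b x
    have hd : DifferentiableAt ℝ (fderiv ℝ φ) x :=
      (h.fderiv_right (m := 1) (by norm_num)).differentiable (by norm_num) x
    unfold pd
    rw [fderiv_clm_apply hd (differentiableAt_const _)]
    simp
  ext x
  rw [key, key]
  exact (h.contDiffAt.isSymmSndFDerivAt (by simp)).eq _ _

/-- Mollification of a function of space and time. -/
noncomputable def stm (χ : Eu n → ℝ) (u : Eu n → ℝ → ℝ) (x : Eu n) (t : ℝ) : ℝ :=
  moll χ (fun z => u z t) x

lemma exp_mul_sim (b : Eu n) (T k : ℝ) (V : Eu n → ℝ → ℝ) (y : Eu n) (s : ℝ) :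
    Real.exp (k * s) * sim b T k V y s = V (b + Real.exp (-s / 2) • y) (T - Real.exp (-s)) := by
  rw [sim, ← mul_assoc, ← Real.exp_add, show k * s + -k * s = 0 by ring, Real.exp_zero, one_mul]

namespace IsSol

variable {f : ℝ → ℝ} {u : Eu n → ℝ → ℝ} {τ M K : ℝ} {χ : Eu n → ℝ}

lemma hasDerivAt_moll_comp (h : IsSol f u τ M K) (hχ : Moll χ) {x : ℝ → Eu n} {t : ℝ → ℝ}
    {x' : Eu n} {t' s : ℝ} (hx : HasDerivAt x x' s) (ht : HasDerivAt t t' s)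
    (hts : t s ∈ Set.Ioo 0 τ) :
    HasDerivAt (fun s => moll χ (fun z => u z (t s)) (x s))
      (∑ i, x' i * moll (pd i χ) (fun z => u z (t s)) (x s) +
        t' * (∑ i, moll (pd i (pd i χ)) (fun z => u z (t s)) (x s) +
          moll χ (fun z => f (u z (t s))) (x s))) s := by
  have hopen : IsOpen ((Set.univ : Set (Eu n)) ×ˢ Set.Ioo 0 τ) := isOpen_univ.prod isOpen_Ioo
  have hmem : (x s, t s) ∈ (Set.univ : Set (Eu n)) ×ˢ Set.Ioo 0 τ := ⟨trivial, hts⟩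
  let V : Eu n → ℝ → ℝ := fun x t => moll χ (fun z => u z t) x
  let V1 : Eu n → ℝ → Eu n →L[ℝ] ℝ := fun x t =>
    ∑ i, moll (pd i χ) (fun z => u z t) x • EuclideanSpace.proj i
  let V2 : Eu n → ℝ → ℝ →L[ℝ] ℝ := fun x t => ContinuousLinearMap.toSpanSingleton ℝ
    (∑ i, moll (pd i (pd i χ)) (fun z => u z t) x + moll χ (fun z => f (u z t)) x)
  have h1 : ∀ᶠ P in 𝓝 (x s, t s), HasFDerivAt (fun x => V x P.2) (V1 P.1 P.2) P.1 := by
    filter_upwards [hopen.mem_nhds hmem] with P hP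
    have hc := (h.c2 P.2 hP.2).continuous
    refine (hχ.differentiable hc P.1).hasFDerivAt.congr_fderiv ?_
    ext y
    rw [fderiv_eq_sum_pd]
    simp only [V1, hχ.pd_moll hc, _root_.sum_apply, _root_.smul_apply,
      PiLp.proj_apply, smul_eq_mul]
    exact Finset.sum_congr rfl fun i _ => mul_comm _ _
  have h2 : ∀ᶠ P in 𝓝 (x s, t s), HasFDerivAt (fun t => V P.1 t) (V2 P.1 P.2) P.2 := by
    filter_upwards [hopen.mem_nhds hmem] with P hP
    exact (h.hasDerivAt_moll hχ P.1 hP.2).hasFDerivAt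
  have h3 : ContinuousAt (fun P : Eu n × ℝ => V1 P.1 P.2) (x s, t s) := by
    refine ContinuousOn.continuousAt (s := Set.univ ×ˢ Set.Ioo 0 τ) ?_ (hopen.mem_nhds hmem)
    exact continuousOn_finsetSum _ fun i _ => (h.continuousOn_moll (hχ.pd i)).smul continuousOn_const
  have h4 : ContinuousAt (fun P : Eu n × ℝ => V2 P.1 P.2) (x s, t s) := by
    refine ContinuousOn.continuousAt (s := Set.univ ×ˢ Set.Ioo 0 τ) ?_ (hopen.mem_nhds hmem)
    refine (ContinuousLinearMap.toSpanSingletonCLE (𝕜 := ℝ) (E := ℝ)).continuous.comp_continuousOn ?_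
    exact (continuousOn_finsetSum _ fun i _ => h.continuousOn_moll ((hχ.pd i).pd i)).add
      (h.continuousOn_moll_f hχ)
  have hV : HasFDerivAt (fun P : Eu n × ℝ => V P.1 P.2)
      ((V1 (x s) (t s)).coprod (V2 (x s) (t s))) (x s, t s) := by
    clear_value V V1 V2
    exact (hasStrictFDerivAt_uncurry_coprod (f := V) (f₁ := V1) (f₂ := V2) h1 h2 h3 h4).hasFDerivAt
  have := hV.comp_hasDerivAt s (hx.prodMk ht)
  refine this.congr_deriv ?_
  simp [V1, V2, mul_comm]

lemma good_sim_stm (h : IsSol f u τ M K) (hτ : 0 < τ) (hχ : Moll χ) (b : Eu n) {k : ℝ}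
    (hk : 0 ≤ k) : Good (Set.Ioi (-Real.log τ)) (sim b τ k (stm χ u)) :=
  good_sim b hτ hk (h.continuousOn_moll hχ) fun x t ht => hχ.abs_moll_le (fun z => h.bdd z t ht) x

lemma good_sim_stm_f (h : IsSol f u τ M K) (hτ : 0 < τ) (hχ : Moll χ) (b : Eu n) {k : ℝ}
    (hk : 0 ≤ k) : Good (Set.Ioi (-Real.log τ)) (sim b τ k (stm χ fun x t => f (u x t))) :=
  good_sim b hτ hk (h.continuousOn_moll_f hχ) fun x t ht =>
    hχ.abs_moll_le (fun z => h.bddf z t ht) x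

lemma hasDerivAt_sim (h : IsSol f u τ M K) (hτ : 0 < τ) (hχ : Moll χ) (b : Eu n) (k : ℝ) (y : Eu n)
    {s : ℝ} (hs : s ∈ Set.Ioi (-Real.log τ)) :
    HasDerivAt (fun s => sim b τ k (stm χ u) y s)
      (-k * sim b τ k (stm χ u) y s - 1 / 2 * ∑ i, y i * sim b τ (k + 1 / 2) (stm (pd i χ) u) y s +
        ∑ i, sim b τ (k + 1) (stm (pd i (pd i χ)) u) y s +
        sim b τ (k + 1) (stm χ fun x t => f (u x t)) y s) s := by
  have e1 : HasDerivAt (fun s : ℝ => Real.exp (-k * s)) (Real.exp (-k * s) * -k) s := by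
    simpa using ((hasDerivAt_id s).const_mul (-k)).exp
  have e2 : HasDerivAt (fun s : ℝ => Real.exp (-s / 2)) (Real.exp (-s / 2) * (-1 / 2)) s := by
    simpa using ((hasDerivAt_id s).neg.div_const 2).exp
  have e3 : HasDerivAt (fun s : ℝ => Real.exp (-s)) (Real.exp (-s) * -1) s := by
    simpa using (hasDerivAt_id s).neg.exp
  have h1 := h.hasDerivAt_moll_comp hχ ((e2.smul_const y).const_add b) (e3.const_sub τ)
    (sub_exp_mem hτ hs)
  refine (e1.mul h1).congr_deriv ?_
  have w1 : Real.exp (-(k + 1 / 2) * s) = Real.exp (-k * s) * Real.exp (-s / 2) := by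
    rw [← Real.exp_add]; congr 1; ring
  have w2 : Real.exp (-(k + 1) * s) = Real.exp (-k * s) * Real.exp (-s) := by
    rw [← Real.exp_add]; congr 1; ring
  simp only [sim, stm, w1, w2, PiLp.smul_apply, smul_eq_mul, Finset.mul_sum, mul_add,
    sub_eq_add_neg, ← Finset.sum_neg_distrib]
  rw [← add_assoc, ← add_assoc]
  congr 1
  congr 1
  · congr 1
    · ring
    · exact Finset.sum_congr rfl fun i _ => by ring
  · exact Finset.sum_congr rfl fun i _ => by ring
  · ring

lemma hasLineDerivAt_stm (h : IsSol f u τ M K) (hτ : 0 < τ) (hχ : Moll χ) (b : Eu n) {k k' : ℝ}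
    (hk : k' = k + 1 / 2) (i : Fin n) {s : ℝ} (hs : s ∈ Set.Ioi (-Real.log τ)) (y : Eu n) :
    HasLineDerivAt ℝ (fun y => sim b τ k (stm χ u) y s) (sim b τ k' (stm (pd i χ) u) y s) y
      (bv i) := by
  subst hk
  refine hasLineDerivAt_sim (fun x => ?_) y
  have hc := (h.c2 _ (sub_exp_mem hτ hs)).continuous
  have := hasLineDerivAt_pd (hχ.differentiable hc) i x
  rwa [hχ.pd_moll hc] at this

lemma hasLineDerivAt_stm_f (h : IsSol f u τ M K) (hτ : 0 < τ) (hχ : Moll χ) (b : Eu n) {k k' : ℝ}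
    (hk : k' = k + 1 / 2) (i : Fin n) {s : ℝ} (hs : s ∈ Set.Ioi (-Real.log τ)) (y : Eu n) :
    HasLineDerivAt ℝ (fun y => sim b τ k (stm χ fun x t => f (u x t)) y s)
      (sim b τ k' (stm (pd i χ) fun x t => f (u x t)) y s) y (bv i) := by
  subst hk
  refine hasLineDerivAt_sim (fun x => ?_) y
  have hc := h.contf.comp (h.c2 _ (sub_exp_mem hτ hs)).continuous
  have := hasLineDerivAt_pd (hχ.differentiable hc) i x
  rwa [hχ.pd_moll hc] at this

/-- The consistency error of the mollified equation. -/
noncomputable def err (f : ℝ → ℝ) (u : Eu n → ℝ → ℝ) (χ : Eu n → ℝ) (b : Eu n) (τ q : ℝ) (y : Eu n)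
    (s : ℝ) : ℝ :=
  sim b τ (q + 1) (stm χ fun x t => f (u x t)) y s -
    Real.exp (-(q + 1) * s) * f (Real.exp (q * s) * sim b τ q (stm χ u) y s)

theorem simSol (h : IsSol f u τ M K) (hτ : 0 < τ) (hχ : Moll χ) (b : Eu n) {q : ℝ} (hq : 0 < q) :
    ∃ ws wi wii wis, SimSol q f (Set.Ioi (-Real.log τ)) (sim b τ q (stm χ u)) ws
      (err f u χ b τ q) wi wii wis := by
  have hbd : ∀ y, ∀ s ∈ Set.Ioi (-Real.log τ),
      |Real.exp (q * s) * sim b τ q (stm χ u) y s| ≤ M * ∫ z, |χ z| := fun y s hs => by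
    rw [exp_mul_sim]
    exact hχ.abs_moll_le (fun z => h.bdd z _ (sub_exp_mem hτ hs)) _
  have hexp : Good (Set.Ioi (-Real.log τ)) fun y s => Real.exp (q * s) * sim b τ q (stm χ u) y s :=
    ⟨.of_bdd fun s hs y => hbd y s hs,
      ContinuousOn.mul (by fun_prop) (h.good_sim_stm hτ hχ b hq.le).cont⟩
  have g0 := h.good_sim_stm hτ hχ b hq.le
  have g1 := fun i => h.good_sim_stm hτ (hχ.pd i) b (k := q + 1 / 2) (by positivity)
  have g2 := fun i j => h.good_sim_stm hτ ((hχ.pd j).pd i) b (k := q + 1) (by positivity)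
  have g3 := fun i j => h.good_sim_stm hτ (((hχ.pd i).pd j).pd j) b (k := q + 3 / 2) (by positivity)
  have gf := h.good_sim_stm_f hτ hχ b (k := q + 1) (by positivity)
  have gf1 := fun i => h.good_sim_stm_f hτ (hχ.pd i) b (k := q + 3 / 2) (by positivity)
  refine ⟨_, _, _, _,
    { good_w := g0
      good_ws := (((g0.const_mul (-q)).sub (.const_mul (1 / 2)
        (.sum Finset.univ fun i _ => (Good.coord i).mul (g1 i)))).add
        (.sum Finset.univ fun i _ => g2 i i)).add gf
      good_ξ := gf.sub ((good_exp hτ (by positivity)).mul (hexp.comp_bdd hbd h.contf))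
      good_wi := g1
      good_wii := fun i => g2 i i
      good_wis := fun i => ((((g1 i).const_mul (-(q + 1 / 2))).sub (.const_mul (1 / 2)
        (.sum Finset.univ fun j _ => (Good.coord j).mul (g2 j i)))).add
        (.sum Finset.univ fun j _ => g3 i j)).add (gf1 i)
      deriv_w := fun y s hs => h.hasDerivAt_sim hτ hχ b q y hs
      deriv_wi := fun i y s hs => ?_
      line_w := fun i s hs y => h.hasLineDerivAt_stm hτ hχ b rfl i hs y
      line_wi := fun i s hs y => h.hasLineDerivAt_stm hτ (hχ.pd i) b (by ring) i hs y
      line_ws := fun i s hs y => ?_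
      eqn := fun y s hs => ?_
      bdd := ⟨_, hbd⟩ }⟩
  · refine (h.hasDerivAt_sim hτ (hχ.pd i) b (q + 1 / 2) y hs).congr_deriv ?_
    rw [show q + 1 / 2 + 1 / 2 = q + 1 by ring, show q + 1 / 2 + 1 = q + 3 / 2 by ring]
  · have l0 := h.hasLineDerivAt_stm hτ hχ b (k := q) rfl i hs y
    have l1 := fun j => h.hasLineDerivAt_stm hτ (hχ.pd j) b (k := q + 1 / 2) (k' := q + 1)
      (by ring) i hs y
    have l2 := fun j => h.hasLineDerivAt_stm hτ ((hχ.pd j).pd j) b (k := q + 1) (k' := q + 3 / 2)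
      (by ring) i hs y
    have l3 := h.hasLineDerivAt_stm_f hτ hχ b (k := q + 1) (k' := q + 3 / 2) (by ring) i hs y
    unfold HasLineDerivAt at *
    have lc : ∀ j, HasDerivAt (fun t : ℝ => (y + t • bv i) j) (bv (n := n) i j) 0 := fun j => by
      simpa using ((hasDerivAt_id (0:ℝ)).mul_const (bv (n := n) i j)).const_add (y j)
    refine ((((l0.const_mul (-q)).sub ((HasDerivAt.fun_sum fun j _ =>
      (lc j).mul (l1 j)).const_mul (1 / 2))).add (HasDerivAt.fun_sum fun j _ => l2 j)).add l3).congr_deriv ?_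
    have c1 : ∀ j, pd i (pd j χ) = pd j (pd i χ) := fun j => pd_comm (hχ.smooth 2) i j
    have c2 : ∀ j, pd i (pd j (pd j χ)) = pd j (pd j (pd i χ)) := fun j => by
      rw [pd_comm ((hχ.pd j).smooth 2) i j, c1]
    have hs' : ∀ X : Fin n → ℝ, ∑ j, bv (n := n) i j * X j = X i := fun X => by
      simp
    simp only [c1, c2, zero_smul, add_zero, Finset.sum_add_distrib, hs']
    ring
  · simp only [err, Finset.sum_sub_distrib, ← Finset.mul_sum]
    ring

end IsSol

end Similarity

section Nonlinearity

/-- The full nonlinearity of the equation. -/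
noncomputable def nl (p a μ : ℝ) (z : ℝ) : ℝ := |z| ^ (p - 1) * z + hfun p a μ z

/-- The primitive of `f` vanishing at the origin. -/
noncomputable def prim (f : ℝ → ℝ) (z : ℝ) : ℝ := ∫ x in (0 : ℝ)..z, f x

lemma hasDerivAt_prim {f : ℝ → ℝ} (hf : Continuous f) (z : ℝ) : HasDerivAt (prim f) (f z) z :=
  intervalIntegral.integral_hasDerivAt_right (hf.intervalIntegrable _ _)
    (hf.stronglyMeasurableAtFilter _ _) hf.continuousAt

lemma continuous_prim {f : ℝ → ℝ} (hf : Continuous f) : Continuous (prim f) :=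
  continuous_iff_continuousAt.2 fun z => (hasDerivAt_prim hf z).continuousAt

lemma prim_neg {f : ℝ → ℝ} (hf : ∀ z, f (-z) = -f z) (z : ℝ) : prim f (-z) = prim f z := by
  unfold prim
  have := intervalIntegral.integral_comp_neg (a := 0) (b := z) f
  rw [neg_zero] at this
  rw [intervalIntegral.integral_symm, ← this]
  simp [hf]

variable {p a μ : ℝ}

/-- The relative size of the perturbation. -/
noncomputable def relSize (a μ z : ℝ) : ℝ := μ / Real.log (2 + z ^ 2) ^ a

lemma log_two_add_sq_pos (z : ℝ) : 0 < Real.log (2 + z ^ 2) :=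
  Real.log_pos (by nlinarith [sq_nonneg z])

lemma nl_eq (p a μ z : ℝ) : nl p a μ z = |z| ^ (p - 1) * z * (1 + relSize a μ z) := by
  unfold nl hfun relSize; ring

lemma continuous_relSize (a μ : ℝ) : Continuous (relSize a μ) := by
  refine continuous_const.div ?_ fun z => (Real.rpow_pos_of_pos (log_two_add_sq_pos z) a).ne'
  refine Continuous.rpow_const ?_ fun z => Or.inl (log_two_add_sq_pos z).ne'
  exact Continuous.log (by fun_prop) fun z => by nlinarith [sq_nonneg z]

lemma tendsto_relSize (ha : 0 < a) : Tendsto (relSize a μ) atTop (𝓝 0) := by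
  refine Tendsto.div_atTop tendsto_const_nhds ?_
  refine (tendsto_rpow_atTop ha).comp (Real.tendsto_log_atTop.comp ?_)
  exact tendsto_atTop_add_const_left _ _ (tendsto_pow_atTop two_ne_zero)

lemma relSize_neg (z : ℝ) : relSize a μ (-z) = relSize a μ z := by simp [relSize]

lemma relSize_abs (z : ℝ) : relSize a μ |z| = relSize a μ z := by simp [relSize]

lemma nl_neg (z : ℝ) : nl p a μ (-z) = -nl p a μ z := by
  rw [nl_eq, nl_eq, relSize_neg, abs_neg]; ring

lemma continuous_nl (hp : 1 < p) : Continuous (nl p a μ) := by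
  have : nl p a μ = fun z => |z| ^ (p - 1) * z * (1 + relSize a μ z) := funext (nl_eq p a μ)
  rw [this]
  exact ((continuous_abs.rpow_const fun _ => Or.inr (by linarith)).mul continuous_id).mul
    (continuous_const.add (continuous_relSize a μ))

lemma nl_of_nonneg {z : ℝ} (hp : 1 < p) (hz : 0 ≤ z) :
    nl p a μ z = z ^ p * (1 + relSize a μ z) := by
  rw [nl_eq, abs_of_nonneg hz]
  congr 1
  rcases hz.eq_or_lt with rfl | hz
  · rw [mul_zero, Real.zero_rpow (by linarith)]
  · rw [Real.rpow_sub_one hz.ne']; field_simp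

lemma relSize_small (hp : 0 < p) (ha : 0 < a) {ε : ℝ} (hε : 0 < ε) :
    ∃ C, 0 ≤ C ∧ ∀ z, 0 ≤ z → z ^ p * |relSize a μ z| ≤ ε * z ^ p + C := by
  obtain ⟨R, hR⟩ := eventually_atTop.1
    ((tendsto_relSize (μ := μ) ha).abs.eventually (ge_mem_nhds (by simpa using hε)))
  obtain ⟨C, hC⟩ := (isCompact_Icc (a := 0) (b := R)).exists_bound_of_continuousOn
    (f := fun z => z ^ p * |relSize a μ z|)
    ((continuous_id.rpow_const fun _ => Or.inr hp.le).mul (continuous_relSize a μ).abs).continuousOn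
  refine ⟨max C 0, le_max_right _ _, fun z hz => ?_⟩
  have hzp : 0 ≤ z ^ p := Real.rpow_nonneg hz p
  rcases le_or_gt R z with h | h
  · have := mul_le_mul_of_nonneg_left (hR z h) hzp
    linarith [le_max_right C 0]
  · have := (le_abs_self _).trans (hC z ⟨hz, h.le⟩)
    linarith [le_max_left C 0, mul_nonneg hε.le hzp]

lemma abs_relSize_le (ha : 0 < a) (z : ℝ) : |relSize a μ z| ≤ |μ| / Real.log 2 ^ a := by
  unfold relSize
  rw [abs_div, abs_of_pos (Real.rpow_pos_of_pos (log_two_add_sq_pos z) a)]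
  have h2 : 0 < Real.log 2 := Real.log_pos (by norm_num)
  gcongr
  nlinarith [sq_nonneg z]

lemma abs_nl_le (hp : 1 < p) (ha : 0 < a) :
    ∃ K, 0 < K ∧ ∀ z, |nl p a μ z| ≤ K * |z| ^ p := by
  refine ⟨1 + |μ| / Real.log 2 ^ a, by
    have h2 : 0 < Real.log 2 := Real.log_pos (by norm_num)
    positivity, fun z => ?_⟩
  have h : |nl p a μ z| = |z| ^ p * |1 + relSize a μ z| := by
    rw [← relSize_abs, ← abs_of_nonneg (Real.rpow_nonneg (abs_nonneg z) p), ← abs_mul,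
      ← nl_of_nonneg hp (abs_nonneg z)]
    rcases abs_cases z with ⟨h, _⟩ | ⟨h, _⟩ <;> simp [h, nl_neg]
  rw [h, mul_comm]
  gcongr
  refine (abs_add_le _ _).trans ?_
  rw [abs_one]
  gcongr
  exact abs_relSize_le ha z

lemma young_rpow {r s ε : ℝ} (hr : 0 < r) (hrs : r < s) (hε : 0 < ε) :
    ∃ C, 0 ≤ C ∧ ∀ x, 0 ≤ x → x ^ r ≤ ε * x ^ s + C := by
  obtain ⟨R, hR⟩ := eventually_atTop.1 ((tendsto_rpow_atTop (sub_pos.2 hrs)).eventually_ge_atTop (1 / ε))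
  have hR1 : (0:ℝ) < max R 1 := by positivity
  refine ⟨max R 1 ^ r, by positivity, fun x hx => ?_⟩
  rcases le_or_gt (max R 1) x with h | h
  · have hx0 : 0 < x := hR1.trans_le h
    have h1 := hR x ((le_max_left _ _).trans h)
    rw [show s = r + (s - r) by ring, Real.rpow_add hx0]
    have h2 : 1 ≤ ε * x ^ (s - r) := by
      rw [div_le_iff₀ hε] at h1; linarith
    nlinarith [Real.rpow_pos_of_pos hx0 r, Real.rpow_pos_of_pos hR1 r]
  · have := Real.rpow_le_rpow hx h.le hr.le
    have h3 := Real.rpow_nonneg hx s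
    nlinarith

lemma prim_le_of_nonneg {f : ℝ → ℝ} (hf : Continuous f) (hp : 1 < p) {A B z : ℝ} (hz : 0 ≤ z)
    (h : ∀ x, 0 ≤ x → f x ≤ A * x ^ p + B) : prim f z ≤ A * (z ^ (p + 1) / (p + 1)) + B * z := by
  have hc : Continuous fun x : ℝ => A * x ^ p + B :=
    ((continuous_id.rpow_const fun _ => Or.inr (by linarith)).const_mul A).add continuous_const
  refine (intervalIntegral.integral_mono_on hz (hf.intervalIntegrable _ _)
    (hc.intervalIntegrable _ _) fun x hx => h x hx.1).trans_eq ?_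
  have hi : IntervalIntegrable (fun x : ℝ => x ^ p) volume 0 z :=
    (continuous_id.rpow_const fun _ => Or.inr (by linarith)).intervalIntegrable _ _
  rw [intervalIntegral.integral_add (hi.const_mul A) (by simp), intervalIntegral.integral_const_mul,
    integral_rpow (Or.inl (by linarith)), Real.zero_rpow (by linarith)]
  simp [mul_comm]

/-- Superquadratic growth of the potential. -/
lemma nl_superquadratic (hp : 1 < p) (ha : 0 < a) :
    ∃ c C, 0 < c ∧ 0 ≤ C ∧ ∀ z, c * |z| ^ (p + 1) - C ≤ z * nl p a μ z - 2 * prim (nl p a μ) z := by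
  set ε : ℝ := (p - 1) / (8 * (p + 1)) with hε
  have hε0 : 0 < ε := by apply div_pos <;> linarith
  obtain ⟨C, hC0, hC1⟩ := relSize_small (p := p) (μ := μ) (by linarith) ha hε0
  obtain ⟨C', hC0', hC'⟩ := young_rpow (r := 1) (s := p + 1) (ε := ε / (3 * C + 1)) one_pos
    (by linarith) (by positivity)
  have key : ∀ z, 0 ≤ z → 4 * ε * z ^ (p + 1) - 3 * C * C' ≤
      z * nl p a μ z - 2 * prim (nl p a μ) z := by
    intro z hz

    have h1 : prim (nl p a μ) z ≤ (1 + ε) * (z ^ (p + 1) / (p + 1)) + C * z := by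
      refine prim_le_of_nonneg (continuous_nl hp) hp hz fun x hx => ?_
      rw [nl_of_nonneg hp hx]
      have := hC1 x hx
      have h2 := mul_le_mul_of_nonneg_left (le_abs_self (relSize a μ x)) (Real.rpow_nonneg hx p)
      linarith
    have h2 : (1 - ε) * z ^ (p + 1) - C * z ≤ z * nl p a μ z := by
      rw [nl_of_nonneg hp hz]
      have := hC1 z hz
      have h2 := mul_le_mul_of_nonneg_left (neg_abs_le (relSize a μ z)) (Real.rpow_nonneg hz p)
      have h3 : z ^ (p + 1) = z * z ^ p := by
        rcases hz.eq_or_lt with rfl | hz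
        · rw [zero_mul, Real.zero_rpow (by linarith)]
        · rw [Real.rpow_add_one hz.ne', mul_comm]
      rw [h3]
      nlinarith
    have h3 := hC' z hz
    rw [Real.rpow_one] at h3
    have h4 : 0 ≤ z ^ (p + 1) := Real.rpow_nonneg hz _
    have h5 : 3 * C * z ≤ ε * z ^ (p + 1) + 3 * C * C' := by
      have h6 := mul_le_mul_of_nonneg_left h3 (show 0 ≤ 3 * C by positivity)
      have h7 : 3 * C * (ε / (3 * C + 1) * z ^ (p + 1)) ≤ ε * z ^ (p + 1) := by
        rw [← mul_assoc]
        gcongr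
        rw [mul_div_assoc', div_le_iff₀ (by positivity)]
        nlinarith
      linarith
    have h8 : (1 + ε) * (z ^ (p + 1) / (p + 1)) ≤ (1 / (p + 1) + ε) * z ^ (p + 1) := by
      rw [← mul_div_assoc, div_eq_mul_inv, one_div]
      have : (p + 1)⁻¹ ≤ 1 := inv_le_one_of_one_le₀ (by linarith)
      nlinarith [mul_nonneg (mul_nonneg hε0.le h4) (sub_nonneg.2 this)]
    have h9 : 1 - 2 / (p + 1) = 8 * ε := by rw [hε]; field_simp; ring
    have h10 : (1:ℝ) / (p + 1) = (1 - 8 * ε) / 2 := by rw [← h9]; ring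
    rw [h10] at h8
    nlinarith
  refine ⟨4 * ε, 3 * C * C', by positivity, by positivity, fun z => ?_⟩
  rcases abs_cases z with ⟨h, h'⟩ | ⟨h, h'⟩
  · rw [h]; exact key z h'
  · have := key (-z) (by linarith)
    rw [nl_neg, prim_neg nl_neg] at this
    rw [h]
    linarith

end Nonlinearity

section Homogeneity

variable {p a μ : ℝ}

lemma hasDerivAt_relSize (z : ℝ) : HasDerivAt (relSize a μ)
    (μ * (2 * z / (2 + z ^ 2) * -a * Real.log (2 + z ^ 2) ^ (-a - 1))) z := by
  have h1 : HasDerivAt (fun z : ℝ => 2 + z ^ 2) (2 * z) z := by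
    simpa using (hasDerivAt_pow 2 z).const_add 2
  have h2 := (h1.log (by nlinarith [sq_nonneg z])).rpow_const (p := -a)
    (Or.inl (log_two_add_sq_pos z).ne')
  refine (h2.const_mul μ).congr_of_eventuallyEq (.of_forall fun x => ?_)
  simp only [relSize]
  rw [Real.rpow_neg (log_two_add_sq_pos x).le, div_eq_mul_inv]

lemma abs_relSize_sub_le (ha : 0 < a) {x z : ℝ} (hx : 0 < x) (hxz : x ≤ z) :
    |relSize a μ x - relSize a μ z| ≤
      2 * a * |μ| * (z / x) * Real.log (2 + x ^ 2) ^ (-a - 1) := by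
  have hb : ∀ y ∈ Set.Icc x z, ‖μ * (2 * y / (2 + y ^ 2) * -a * Real.log (2 + y ^ 2) ^ (-a - 1))‖ ≤
      2 * a * |μ| * (1 / x) * Real.log (2 + x ^ 2) ^ (-a - 1) := by
    intro y hy
    have hy0 : 0 < y := hx.trans_le hy.1
    have h1 : 2 * y / (2 + y ^ 2) ≤ 2 * (1 / x) := by
      rw [mul_one_div, div_le_div_iff₀ (by positivity) hx]
      nlinarith [hy.1]
    have h2 : Real.log (2 + y ^ 2) ^ (-a - 1) ≤ Real.log (2 + x ^ 2) ^ (-a - 1) :=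
      Real.rpow_le_rpow_of_nonpos (log_two_add_sq_pos x)
        (Real.log_le_log (by positivity) (by nlinarith [hy.1])) (by linarith)
    have h3 : 0 ≤ Real.log (2 + y ^ 2) ^ (-a - 1) := Real.rpow_nonneg (log_two_add_sq_pos y).le _
    rw [Real.norm_eq_abs, abs_mul, abs_mul, abs_mul, abs_neg, abs_of_pos ha, abs_of_nonneg h3,
      abs_of_pos (by positivity : 0 < 2 * y / (2 + y ^ 2))]
    calc _ ≤ |μ| * (2 * (1 / x) * a * Real.log (2 + x ^ 2) ^ (-a - 1)) := by gcongr
      _ = _ := by ring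
  have := (convex_Icc x z).norm_image_sub_le_of_norm_hasDerivWithin_le
    (fun y _ => (hasDerivAt_relSize (a := a) (μ := μ) y).hasDerivWithinAt) hb
    (Set.right_mem_Icc.2 hxz) (Set.left_mem_Icc.2 hxz)
  rw [Real.norm_eq_abs, Real.norm_eq_abs] at this
  refine this.trans ?_
  have h4 : |x - z| ≤ z := by rw [abs_sub_comm, abs_of_nonneg (by linarith)]; linarith
  have h5 : 0 ≤ Real.log (2 + x ^ 2) ^ (-a - 1) := Real.rpow_nonneg (log_two_add_sq_pos x).le _
  calc _ ≤ 2 * a * |μ| * (1 / x) * Real.log (2 + x ^ 2) ^ (-a - 1) * z := by gcongr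
    _ = _ := by ring

lemma prim_nl_defect (hp : 1 < p) {z : ℝ} (hz : 0 ≤ z) :
    (p + 1) * prim (nl p a μ) z - z * nl p a μ z =
      (p + 1) * ∫ x in (0 : ℝ)..z, x ^ p * (relSize a μ x - relSize a μ z) := by
  have c1 : Continuous fun x : ℝ => x ^ p := continuous_id.rpow_const fun _ => Or.inr (by linarith)
  have h1 : prim (nl p a μ) z = ∫ x in (0 : ℝ)..z, x ^ p * (1 + relSize a μ x) := by
    refine intervalIntegral.integral_congr fun x hx => ?_
    rw [Set.uIcc_of_le hz] at hx
    exact nl_of_nonneg hp hx.1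
  have h2 : (fun x => x ^ p * (1 + relSize a μ x)) = fun x =>
      x ^ p * (relSize a μ x - relSize a μ z) + x ^ p * (1 + relSize a μ z) := by ext; ring
  rw [h1, h2, intervalIntegral.integral_add, intervalIntegral.integral_mul_const,
    integral_rpow (Or.inl (by linarith)), nl_of_nonneg hp hz, Real.zero_rpow (by linarith)]
  · have h3 : z ^ (p + 1) = z * z ^ p := by
      rcases hz.eq_or_lt with rfl | hz
      · rw [zero_mul, Real.zero_rpow (by linarith)]
      · rw [Real.rpow_add_one hz.ne', mul_comm]
    rw [h3]
    field_simp
    ring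
  · exact (c1.mul ((continuous_relSize a μ).sub continuous_const)).intervalIntegrable _ _
  · exact (c1.mul continuous_const).intervalIntegrable _ _

lemma abs_defect_le (hp : 1 < p) (ha : 0 < a) :
    ∃ C, 0 ≤ C ∧ ∀ z, |(p + 1) * prim (nl p a μ) z - z * nl p a μ z| ≤
      C * (|z| ^ (p / 2 + 1) + |z| ^ (p + 1) * Real.log (2 + z ^ 2) ^ (-a - 1)) := by
  set G := |μ| / Real.log 2 ^ a
  have hl2 : 0 < Real.log 2 := Real.log_pos (by norm_num)
  have hG : 0 ≤ G := by positivity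
  set A := 2 * a * |μ| * 2 ^ (a + 1)
  have hA : 0 ≤ A := by positivity
  have key : ∀ z, 0 ≤ z → |(p + 1) * prim (nl p a μ) z - z * nl p a μ z| ≤
      (p + 1) * (2 * G + A) * (z ^ (p / 2 + 1) + z ^ (p + 1) * Real.log (2 + z ^ 2) ^ (-a - 1)) := by
    intro z hz
    rcases hz.eq_or_lt with rfl | hz0
    · have : prim (nl p a μ) 0 = 0 := by simp [prim]
      rw [this, mul_zero, zero_mul, sub_zero, abs_zero]
      have := log_two_add_sq_pos 0
      positivity
    have hl := log_two_add_sq_pos z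
    set Λ := Real.log (2 + z ^ 2) ^ (-a - 1) with hΛ
    have hΛ0 : 0 ≤ Λ := by positivity
    have pt : ∀ x ∈ Set.Ioc 0 z, ‖x ^ p * (relSize a μ x - relSize a μ z)‖ ≤
        2 * G * z ^ (p / 2) + A * z ^ p * Λ := by
      intro x hx
      have hx0 := hx.1
      rw [norm_mul, Real.norm_of_nonneg (by positivity), Real.norm_eq_abs]
      rcases le_or_gt (x ^ 2) z with h | h
      · have h1 : x ^ p ≤ z ^ (p / 2) := by
          calc x ^ p = (x ^ 2) ^ (p / 2) := by
                rw [← Real.rpow_natCast, ← Real.rpow_mul hx0.le]; congr 1; push_cast; ring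
            _ ≤ _ := Real.rpow_le_rpow (by positivity) h (by linarith)
        have h2 : |relSize a μ x - relSize a μ z| ≤ 2 * G := by
          refine (abs_sub _ _).trans ?_
          linarith [abs_relSize_le (μ := μ) ha x, abs_relSize_le (μ := μ) ha z]
        calc _ ≤ z ^ (p / 2) * (2 * G) := by gcongr
          _ ≤ _ := by
            have : 0 ≤ A * z ^ p * Λ := by positivity
            linarith
      · have h1 := abs_relSize_sub_le (μ := μ) ha hx0 hx.2
        have h2 : Real.log (2 + x ^ 2) ^ (-a - 1) ≤ 2 ^ (a + 1) * Λ := by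
          have h3 : Real.log (2 + z ^ 2) / 2 ≤ Real.log (2 + x ^ 2) := by
            have : Real.log (2 + z ^ 2) ≤ Real.log ((2 + x ^ 2) ^ 2) :=
              Real.log_le_log (by positivity) (by nlinarith)
            rw [Real.log_pow] at this
            push_cast at this
            linarith
          have h4 := Real.rpow_le_rpow_of_nonpos (by positivity) h3 (by linarith : -a - 1 ≤ 0)
          refine h4.trans_eq ?_
          rw [Real.div_rpow hl.le (by norm_num), hΛ, div_eq_mul_inv, ← Real.rpow_neg (by norm_num),
            mul_comm]
          congr 2; ring
        have h5 : x ^ p * (z / x) ≤ z ^ p := by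
          have : x ^ p * (z / x) = x ^ (p - 1) * z := by
            rw [Real.rpow_sub_one hx0.ne']; field_simp
          rw [this]
          calc _ ≤ z ^ (p - 1) * z := by
                gcongr
                exact hx.2
            _ = _ := by rw [Real.rpow_sub_one hz0.ne']; field_simp
        calc _ ≤ x ^ p * (2 * a * |μ| * (z / x) * (2 ^ (a + 1) * Λ)) := by
              gcongr
              refine h1.trans ?_
              gcongr
          _ = A * (x ^ p * (z / x)) * Λ := by ring
          _ ≤ A * z ^ p * Λ := by gcongr
          _ ≤ _ := by
            have : 0 ≤ 2 * G * z ^ (p / 2) := by positivity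
            linarith
    have := intervalIntegral.norm_integral_le_of_norm_le_const
      (a := 0) (b := z) (f := fun x => x ^ p * (relSize a μ x - relSize a μ z))
      (by rw [Set.uIoc_of_le hz]; exact pt)
    rw [prim_nl_defect hp hz, abs_mul, abs_of_pos (by linarith : 0 < p + 1), mul_assoc]
    refine mul_le_mul_of_nonneg_left (this.trans ?_) (by linarith)
    rw [sub_zero, abs_of_nonneg hz, Real.rpow_add_one hz0.ne', Real.rpow_add_one hz0.ne']
    have e1 : 0 ≤ 2 * G * (z ^ p * z * Λ) := by positivity
    have e2 : 0 ≤ A * (z ^ (p / 2) * z) := by positivity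
    nlinarith
  refine ⟨(p + 1) * (2 * G + A), by positivity, fun z => ?_⟩
  rcases abs_cases z with ⟨h, h'⟩ | ⟨h, h'⟩
  · rw [h]; exact key z h'
  · have := key (-z) (by linarith)
    rw [nl_neg, prim_neg nl_neg, neg_sq] at this
    rw [h]
    convert this using 2
    ring

lemma exp_le_rpow {c k : ℝ} (hc : 0 < c) : ∃ s₀, 1 ≤ s₀ ∧ ∀ s, s₀ ≤ s → Real.exp (-c * s) ≤ s ^ (-k) := by
  obtain ⟨s₀, h⟩ := eventually_atTop.1
    ((tendsto_rpow_mul_exp_neg_mul_atTop_nhds_zero k c hc).eventually (ge_mem_nhds zero_lt_one))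
  refine ⟨max s₀ 1, le_max_right _ _, fun s hs => ?_⟩
  have hs0 : 0 < s := zero_lt_one.trans_le ((le_max_right _ _).trans hs)
  have := h s ((le_max_left _ _).trans hs)
  rw [Real.rpow_neg hs0.le, ← one_div, le_div_iff₀ (by positivity)]
  linarith

/-- In similarity variables the perturbation breaks scaling by an integrable amount. -/
lemma defect_sim_le (hp : 1 < p) (ha : 0 < a) {q : ℝ} (hq : 0 < q) :
    ∃ C s₀, 0 ≤ C ∧ 1 ≤ s₀ ∧ ∀ s w, s₀ ≤ s →
      Real.exp (-((p + 1) * q) * s) * |(p + 1) * prim (nl p a μ) (Real.exp (q * s) * w) -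
        Real.exp (q * s) * w * nl p a μ (Real.exp (q * s) * w)| ≤
      C * s ^ (-1 - a) * (|w| ^ (p + 1) + 1) := by
  obtain ⟨C, hC0, hC⟩ := abs_defect_le (μ := μ) hp ha
  obtain ⟨s1, hs1, h1⟩ := exp_le_rpow (c := p / 2 * q) (k := 1 + a) (by positivity)
  have hl2 : 0 < Real.log 2 := Real.log_pos (by norm_num)
  set B := q ^ (-a - 1) + Real.log 2 ^ (-a - 1)
  refine ⟨C * (1 + B), s1, by positivity, hs1, fun s w hs => ?_⟩
  have hs0 : 0 < s := by linarith
  have hE := h1 s hs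
  rw [show -(1 + a) = -1 - a by ring] at hE
  set σ := s ^ (-1 - a) with hσ
  have hσ0 : 0 < σ := by positivity
  set z := Real.exp (q * s) * w with hz
  have hzabs : |z| = Real.exp (q * s) * |w| := by rw [hz, abs_mul, Real.abs_exp]
  have hw : 0 ≤ |w| := abs_nonneg w
  have r : ∀ k, |z| ^ k = Real.exp (k * q * s) * |w| ^ k := fun k => by
    rw [hzabs, Real.mul_rpow (Real.exp_pos _).le hw, ← Real.exp_mul]; congr 2; ring
  have hw1 : |w| ^ (p / 2 + 1) ≤ |w| ^ (p + 1) + 1 := by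
    rcases le_total |w| 1 with h | h
    · have := Real.rpow_le_one hw h (by linarith : 0 ≤ p / 2 + 1)
      have := Real.rpow_nonneg hw (p + 1)
      linarith
    · have := Real.rpow_le_rpow_of_exponent_le h (by linarith : p / 2 + 1 ≤ p + 1)
      linarith
  have hwp : 0 ≤ |w| ^ (p + 1) := by positivity
  have t1 : Real.exp (-((p + 1) * q) * s) * |z| ^ (p / 2 + 1) ≤ σ * (|w| ^ (p + 1) + 1) := by
    rw [r, ← mul_assoc, ← Real.exp_add,
      show -((p + 1) * q) * s + (p / 2 + 1) * q * s = -(p / 2 * q) * s by ring]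
    gcongr
  have hl := log_two_add_sq_pos z
  have t2 : Real.exp (-((p + 1) * q) * s) * (|z| ^ (p + 1) * Real.log (2 + z ^ 2) ^ (-a - 1)) ≤
      B * σ * (|w| ^ (p + 1) + 1) := by
    rw [r, ← mul_assoc, ← mul_assoc, ← Real.exp_add,
      show -((p + 1) * q) * s + (p + 1) * q * s = 0 by ring, Real.exp_zero, one_mul]
    have hq1 : 0 ≤ q ^ (-a - 1) := by positivity
    have hL1 : 0 ≤ Real.log 2 ^ (-a - 1) := by positivity
    rcases le_or_gt (Real.exp (-(q * s / 2))) |w| with h | h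
    · have h2 : q * s ≤ Real.log (2 + z ^ 2) := by
        rw [Real.le_log_iff_exp_le (by positivity)]
        have : Real.exp (q * s / 2) ≤ |z| := by
          rw [hzabs]
          calc Real.exp (q * s / 2) = Real.exp (q * s) * Real.exp (-(q * s / 2)) := by
                rw [← Real.exp_add]; congr 1; ring
            _ ≤ _ := by gcongr
        have h4 := pow_le_pow_left₀ (Real.exp_pos _).le this 2
        rw [sq_abs, ← Real.exp_nat_mul] at h4
        rw [show ((2 : ℕ) : ℝ) * (q * s / 2) = q * s by push_cast; ring] at h4
        linarith
      have h3 := Real.rpow_le_rpow_of_nonpos (by positivity) h2 (by linarith : -a - 1 ≤ 0)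
      rw [Real.mul_rpow hq.le hs0.le, show s ^ (-a - 1) = σ by rw [hσ]; congr 1; ring] at h3
      calc _ ≤ |w| ^ (p + 1) * (q ^ (-a - 1) * σ) := by gcongr
        _ ≤ (|w| ^ (p + 1) + 1) * (B * σ) := by
          gcongr
          · linarith
          · exact le_add_of_nonneg_right hL1
        _ = _ := by ring
    · have h2 : |w| ^ (p + 1) ≤ σ := by
        refine (Real.rpow_le_rpow hw h.le (by linarith)).trans (le_trans ?_ hE)
        rw [← Real.exp_mul]
        refine Real.exp_le_exp.2 ?_
        have := mul_pos hq hs0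
        linarith
      have h3 : Real.log (2 + z ^ 2) ^ (-a - 1) ≤ Real.log 2 ^ (-a - 1) :=
        Real.rpow_le_rpow_of_nonpos hl2
          (Real.log_le_log (by norm_num) (by nlinarith [sq_nonneg z])) (by linarith)
      calc _ ≤ σ * (Real.log 2 ^ (-a - 1)) := by gcongr
        _ ≤ σ * B * 1 := by
          rw [mul_one]; gcongr; exact le_add_of_nonneg_left hq1
        _ ≤ σ * B * (|w| ^ (p + 1) + 1) := by gcongr; linarith
        _ = _ := by ring
  calc _ ≤ Real.exp (-((p + 1) * q) * s) *
        (C * (|z| ^ (p / 2 + 1) + |z| ^ (p + 1) * Real.log (2 + z ^ 2) ^ (-a - 1))) := by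
        gcongr; exact hC z
    _ = C * (Real.exp (-((p + 1) * q) * s) * |z| ^ (p / 2 + 1) + Real.exp (-((p + 1) * q) * s) *
        (|z| ^ (p + 1) * Real.log (2 + z ^ 2) ^ (-a - 1))) := by ring
    _ ≤ C * (σ * (|w| ^ (p + 1) + 1) + B * σ * (|w| ^ (p + 1) + 1)) := by gcongr
    _ = _ := by ring

end Homogeneity

section Energy

variable {n : ℕ} {q σ₀ : ℝ} {f : ℝ → ℝ} {w ws ξ : Eu n → ℝ → ℝ} {wi wii wis : Fin n → Eu n → ℝ → ℝ}

/-- The squared weighted `L²` norm. -/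
noncomputable def sqInt (g : Eu n → ℝ → ℝ) (s : ℝ) : ℝ := ∫ y, g y s ^ 2 * rho n y

/-- The weighted integral of a power of the modulus. -/
noncomputable def powInt (r : ℝ) (g : Eu n → ℝ → ℝ) (s : ℝ) : ℝ := ∫ y, |g y s| ^ r * rho n y

/-- The weighted energy in similarity variables. -/
noncomputable def energy (q : ℝ) (f : ℝ → ℝ) (w : Eu n → ℝ → ℝ) (wi : Fin n → Eu n → ℝ → ℝ) (s : ℝ) : ℝ :=
  ∫ y, (1 / 2 * ∑ i, wi i y s ^ 2 + q / 2 * w y s ^ 2 -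
    Real.exp (-(2 * q + 1) * s) * prim f (Real.exp (q * s) * w y s)) * rho n y

/-- The defect produced by the lack of scale invariance of `f`. -/
noncomputable def defect (q : ℝ) (f : ℝ → ℝ) (w : Eu n → ℝ → ℝ) (y : Eu n) (s : ℝ) : ℝ :=
  Real.exp (-(2 * q + 1) * s) * ((2 * q + 1) * prim f (Real.exp (q * s) * w y s) -
    q * (Real.exp (q * s) * w y s) * f (Real.exp (q * s) * w y s))

lemma good_exp_Ioi {k : ℝ} (hk : 0 ≤ k) : Good (Set.Ioi σ₀) fun (_ : Eu n) s => Real.exp (-k * s) := by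
  refine ⟨.of_bdd (M := Real.exp (-k * σ₀)) fun s hs _ => ?_, by fun_prop⟩
  rw [Real.abs_exp]
  exact Real.exp_le_exp.2 (by nlinarith [Set.mem_Ioi.1 hs])

lemma integral_ibp {S : Set ℝ} {A B A' B' : Eu n → ℝ → ℝ} {i : Fin n} (hA : Good S A) (hB : Good S B)
    (hA' : Good S A') (hB' : Good S B') {s : ℝ} (hs : s ∈ S)
    (dA : ∀ y, HasLineDerivAt ℝ (fun y => A y s) (A' y s) y (bv i))
    (dB : ∀ y, HasLineDerivAt ℝ (fun y => B y s) (B' y s) y (bv i)) :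
    ∫ y, (A' y s * B y s + A y s * B' y s - 1 / 2 * (y i * (A y s * B y s))) * rho n y = 0 := by
  have h := (hA.mul hB).integral_lineDeriv ((hA'.mul hB).add (hA.mul hB')) hs (i := i) fun y => by
    have := HasDerivAt.fun_mul (dA y) (dB y)
    simpa [HasLineDerivAt] using this
  have i1 := ((hA'.mul hB).add (hA.mul hB')).integrable hs
  have i2 := (((Good.coord i).mul (hA.mul hB)).const_mul (1 / 2)).integrable hs
  simp only [sub_mul]
  rw [integral_sub i1 i2, h, ← integral_const_mul, sub_eq_zero]
  exact integral_congr_ae (.of_forall fun y => by simp only; ring)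

namespace SimSol

variable (h : SimSol q f (Set.Ioi σ₀) w ws ξ wi wii wis)
include h

lemma good_comp {g : ℝ → ℝ} (hg : Continuous g) :
    Good (Set.Ioi σ₀) fun y s => g (Real.exp (q * s) * w y s) := by
  obtain ⟨M, hM⟩ := h.bdd
  have hv : Good (Set.Ioi σ₀) fun y s => Real.exp (q * s) * w y s :=
    ⟨.of_bdd fun s hs y => hM y s hs, ContinuousOn.mul (by fun_prop) h.good_w.cont⟩
  exact hv.comp_bdd hM hg

lemma good_prim (hf : Continuous f) (hq : 0 < q) : Good (Set.Ioi σ₀) fun y s =>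
    Real.exp (-(2 * q + 1) * s) * prim f (Real.exp (q * s) * w y s) :=
  (good_exp_Ioi (by positivity)).mul (h.good_comp (continuous_prim hf))

lemma good_force (hf : Continuous f) (hq : 0 < q) : Good (Set.Ioi σ₀) fun y s =>
    Real.exp (-(q + 1) * s) * f (Real.exp (q * s) * w y s) :=
  (good_exp_Ioi (by positivity)).mul (h.good_comp hf)

lemma good_defect (hf : Continuous f) (hq : 0 < q) : Good (Set.Ioi σ₀) (defect q f w) :=
  (good_exp_Ioi (by positivity)).mul
    (h.good_comp (g := fun v => (2 * q + 1) * prim f v - q * v * f v)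
      (by have := continuous_prim hf; fun_prop))

lemma good_energy (hf : Continuous f) (hq : 0 < q) : Good (Set.Ioi σ₀) fun y s =>
    1 / 2 * ∑ i, wi i y s ^ 2 + q / 2 * w y s ^ 2 -
      Real.exp (-(2 * q + 1) * s) * prim f (Real.exp (q * s) * w y s) :=
  (((Good.sum Finset.univ fun i _ => (h.good_wi i).pow 2).const_mul (1 / 2)).add
    ((h.good_w.pow 2).const_mul (q / 2))).sub (h.good_prim hf hq)

lemma force_deriv (hf : Continuous f) (y : Eu n) {s : ℝ} (hs : s ∈ Set.Ioi σ₀) :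
    HasDerivAt (fun s => Real.exp (-(2 * q + 1) * s) * prim f (Real.exp (q * s) * w y s))
      (Real.exp (-(q + 1) * s) * f (Real.exp (q * s) * w y s) * ws y s - defect q f w y s) s := by
  have e1 : HasDerivAt (fun s : ℝ => Real.exp (-(2 * q + 1) * s))
      (Real.exp (-(2 * q + 1) * s) * -(2 * q + 1)) s := by
    simpa using ((hasDerivAt_id s).const_mul (-(2 * q + 1))).exp
  have e2 : HasDerivAt (fun s : ℝ => Real.exp (q * s)) (Real.exp (q * s) * q) s := by
    simpa using ((hasDerivAt_id s).const_mul q).exp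
  have e3 := (hasDerivAt_prim hf (Real.exp (q * s) * w y s)).comp s (e2.fun_mul (h.deriv_w y s hs))
  refine (e1.mul e3).congr_deriv ?_
  have : Real.exp (-(q + 1) * s) = Real.exp (-(2 * q + 1) * s) * Real.exp (q * s) := by
    rw [← Real.exp_add]; congr 1; ring
  simp only [defect, this, Function.comp]
  ring

lemma hasDerivAt_energy (hf : Continuous f) (hq : 0 < q) {s : ℝ} (hs : s ∈ Set.Ioi σ₀) :
    HasDerivAt (energy q f w wi)
      (∫ y, (-ws y s ^ 2 + ws y s * ξ y s + defect q f w y s) * rho n y) s := by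
  have gd : Good (Set.Ioi σ₀) fun y s => (∑ i, wi i y s * wis i y s) + q * (w y s * ws y s) -
      (Real.exp (-(q + 1) * s) * f (Real.exp (q * s) * w y s) * ws y s - defect q f w y s) :=
    ((Good.sum Finset.univ fun i _ => (h.good_wi i).mul (h.good_wis i)).add
      ((h.good_w.mul h.good_ws).const_mul q)).sub
      (((h.good_force hf hq).mul h.good_ws).sub (h.good_defect hf hq))
  have hd := (h.good_energy hf hq).hasDerivAt_integral isOpen_Ioi gd (fun y s hs => by
    have d1 : HasDerivAt (fun s => ∑ i, wi i y s ^ 2) (∑ i, 2 * wi i y s * wis i y s) s :=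
      HasDerivAt.fun_sum fun i _ => by simpa using (h.deriv_wi i y s hs).fun_pow 2
    have d2 : HasDerivAt (fun s => w y s ^ 2) (2 * w y s * ws y s) s := by
      simpa using (h.deriv_w y s hs).fun_pow 2
    refine (((d1.const_mul (1 / 2)).add (d2.const_mul (q / 2))).sub (h.force_deriv hf y hs)).congr_deriv ?_
    simp only [mul_assoc, ← Finset.mul_sum]
    ring) hs
  refine hd.congr_deriv ?_
  have g1 : Good (Set.Ioi σ₀) fun y s => -ws y s ^ 2 + ws y s * ξ y s + defect q f w y s :=
    (((h.good_ws.pow 2).neg).add (h.good_ws.mul h.good_ξ)).add (h.good_defect hf hq)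
  have gi : ∀ i, Good (Set.Ioi σ₀) fun y s =>
      wis i y s * wi i y s + ws y s * wii i y s - 1 / 2 * (y i * (ws y s * wi i y s)) := fun i =>
    (((h.good_wis i).mul (h.good_wi i)).add (h.good_ws.mul (h.good_wii i))).sub
      (((Good.coord i).mul (h.good_ws.mul (h.good_wi i))).const_mul (1 / 2))
  rw [← sub_eq_zero, ← integral_sub (gd.integrable hs) (g1.integrable hs)]
  calc _ = ∫ y, ∑ i, (wis i y s * wi i y s + ws y s * wii i y s -
        1 / 2 * (y i * (ws y s * wi i y s))) * rho n y := by
        refine integral_congr_ae (.of_forall fun y => ?_)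
        simp only [← Finset.sum_mul, ← sub_mul]
        congr 1
        have e : ∑ i, (wis i y s * wi i y s + ws y s * wii i y s - 1 / 2 * (y i * (ws y s * wi i y s))) =
            ∑ i, wi i y s * wis i y s + ws y s * ∑ i, (wii i y s - 1 / 2 * (y i * wi i y s)) := by
          rw [Finset.mul_sum, ← Finset.sum_add_distrib]
          exact Finset.sum_congr rfl fun i _ => by ring
        rw [e]
        linear_combination ws y s * h.eqn y s hs
    _ = 0 := by
        rw [integral_finsetSum _ fun i _ => (gi i).integrable hs]
        exact Finset.sum_eq_zero fun i _ => integral_ibp h.good_ws (h.good_wi i) (h.good_wis i)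
          (h.good_wii i) hs (h.line_ws i s hs) (h.line_wi i s hs)

lemma hasDerivAt_sqInt {s : ℝ} (hs : s ∈ Set.Ioi σ₀) :
    HasDerivAt (sqInt w) (2 * ∫ y, w y s * ws y s * rho n y) s := by
  have := (h.good_w.pow 2).hasDerivAt_integral isOpen_Ioi ((h.good_w.mul h.good_ws).const_mul 2)
    (fun y s hs => by
      have := (h.deriv_w y s hs).fun_pow 2
      simpa [mul_assoc] using this) hs
  refine this.congr_deriv ?_
  rw [← integral_const_mul]
  exact integral_congr_ae (.of_forall fun y => by simp only; ring)

lemma integral_mul_deriv (hf : Continuous f) (hq : 0 < q) {s : ℝ} (hs : s ∈ Set.Ioi σ₀) :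
    ∫ y, w y s * ws y s * rho n y = ∫ y, (-(∑ i, wi i y s ^ 2) - q * w y s ^ 2 +
      w y s * (Real.exp (-(q + 1) * s) * f (Real.exp (q * s) * w y s)) + w y s * ξ y s) * rho n y := by
  have g1 := h.good_w.mul h.good_ws
  have g2 : Good (Set.Ioi σ₀) fun y s => -(∑ i, wi i y s ^ 2) - q * w y s ^ 2 +
      w y s * (Real.exp (-(q + 1) * s) * f (Real.exp (q * s) * w y s)) + w y s * ξ y s :=
    ((((Good.sum Finset.univ fun i _ => (h.good_wi i).pow 2).neg).sub
      ((h.good_w.pow 2).const_mul q)).add (h.good_w.mul (h.good_force hf hq))).add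
      (h.good_w.mul h.good_ξ)
  have gi : ∀ i, Good (Set.Ioi σ₀) fun y s =>
      wi i y s * wi i y s + w y s * wii i y s - 1 / 2 * (y i * (w y s * wi i y s)) := fun i =>
    (((h.good_wi i).mul (h.good_wi i)).add (h.good_w.mul (h.good_wii i))).sub
      (((Good.coord i).mul (h.good_w.mul (h.good_wi i))).const_mul (1 / 2))
  rw [← sub_eq_zero, ← integral_sub (g1.integrable hs) (g2.integrable hs)]
  calc _ = ∫ y, ∑ i, (wi i y s * wi i y s + w y s * wii i y s -
        1 / 2 * (y i * (w y s * wi i y s))) * rho n y := by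
        refine integral_congr_ae (.of_forall fun y => ?_)
        simp only [← Finset.sum_mul, ← sub_mul]
        congr 1
        have e : ∑ i, (wi i y s * wi i y s + w y s * wii i y s - 1 / 2 * (y i * (w y s * wi i y s))) =
            ∑ i, wi i y s ^ 2 + w y s * ∑ i, (wii i y s - 1 / 2 * (y i * wi i y s)) := by
          rw [Finset.mul_sum, ← Finset.sum_add_distrib]
          exact Finset.sum_congr rfl fun i _ => by ring
        rw [e]
        linear_combination w y s * h.eqn y s hs
    _ = 0 := by
        rw [integral_finsetSum _ fun i _ => (gi i).integrable hs]
        exact Finset.sum_eq_zero fun i _ => integral_ibp h.good_w (h.good_wi i) (h.good_wi i)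
          (h.good_wii i) hs (h.line_w i s hs) (h.line_wi i s hs)

end SimSol

end Energy

section Dissipation

variable {n : ℕ}

/-- Structural properties of the nonlinearity used in the energy method. -/
structure Nonlin (f : ℝ → ℝ) (p q a c C C' s₀ : ℝ) : Prop where
  cont : Continuous f
  hp : 1 < p
  hq : 0 < q
  ha : 0 < a
  hpq : (p + 1) * q = 2 * q + 1
  hc : 0 < c
  hC : 0 ≤ C
  hC' : 0 ≤ C'
  hs₀ : 1 ≤ s₀
  super : ∀ z, c * |z| ^ (p + 1) - C ≤ z * f z - 2 * prim f z
  young : ∀ z, z ^ 2 ≤ c / 2 * |z| ^ (p + 1) + C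
  defect : ∀ s w, s₀ ≤ s → Real.exp (-(2 * q + 1) * s) * |(2 * q + 1) * prim f (Real.exp (q * s) * w) -
    q * (Real.exp (q * s) * w) * f (Real.exp (q * s) * w)| ≤ C' * s ^ (-1 - a) * (|w| ^ (p + 1) + 1)
  small : ∀ s, s₀ ≤ s → 4 * C' / c * s ^ (-1 - a) ≤ 1

lemma Good.integral_add {S : Set ℝ} {G H : Eu n → ℝ → ℝ} (hG : Good S G) (hH : Good S H) {s : ℝ} (hs : s ∈ S) :
    ∫ y, (G y s + H y s) * rho n y = (∫ y, G y s * rho n y) + ∫ y, H y s * rho n y := by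
  simp only [add_mul]
  exact MeasureTheory.integral_add (hG.integrable hs) (hH.integrable hs)

lemma integral_const_mul_rho (k : ℝ) (g : Eu n → ℝ) :
    ∫ y, k * g y * rho n y = k * ∫ y, g y * rho n y := by
  simp only [mul_assoc]
  exact integral_const_mul _ _

lemma exists_nonlin {p a μ : ℝ} (hp : 1 < p) (ha : 0 < a) :
    ∃ c C C' s₀, Nonlin (nl p a μ) p (1 / (p - 1)) a c C C' s₀ := by
  have hq : 0 < 1 / (p - 1) := by apply div_pos <;> linarith
  obtain ⟨c, C1, hc, hC1, h1⟩ := nl_superquadratic (μ := μ) hp ha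
  obtain ⟨C2, hC2, h2⟩ := young_rpow (r := 2) (s := p + 1) (ε := c / 2) (by norm_num) (by linarith)
    (by positivity)
  obtain ⟨C3, s1, hC3, hs1, h3⟩ := defect_sim_le (μ := μ) hp ha hq
  have hpq : (p + 1) * (1 / (p - 1)) = 2 * (1 / (p - 1)) + 1 := by
    have : p - 1 ≠ 0 := by linarith
    field_simp; ring
  set q := 1 / (p - 1)
  have ht : Tendsto (fun s : ℝ => 4 * (q * C3) / c * s ^ (-1 - a)) atTop (𝓝 0) := by
    have := (tendsto_rpow_neg_atTop (by linarith : 0 < 1 + a)).const_mul (4 * (q * C3) / c)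
    rw [mul_zero] at this
    exact this.congr fun s => by rw [neg_add, ← sub_eq_add_neg]
  obtain ⟨s2, h4⟩ := eventually_atTop.1 (ht.eventually (ge_mem_nhds zero_lt_one))
  refine ⟨c, max C1 C2, q * C3, max s1 s2, continuous_nl hp, hp, hq, ha, hpq, hc,
    hC1.trans (le_max_left _ _), by positivity, hs1.trans (le_max_left _ _),
    fun z => (sub_le_sub_left (le_max_left _ _) _).trans (h1 z), fun z => ?_, fun s w hs => ?_,
    fun s hs => h4 s ((le_max_right _ _).trans hs)⟩
  · have := h2 |z| (abs_nonneg z)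
    rw [Real.rpow_two, sq_abs] at this
    exact this.trans (by gcongr; exact le_max_right _ _)
  · have := h3 s w ((le_max_left _ _).trans hs)
    rw [hpq] at this
    have e : (2 * q + 1) * prim (nl p a μ) (Real.exp (q * s) * w) -
        q * (Real.exp (q * s) * w) * nl p a μ (Real.exp (q * s) * w) =
        q * ((p + 1) * prim (nl p a μ) (Real.exp (q * s) * w) -
        Real.exp (q * s) * w * nl p a μ (Real.exp (q * s) * w)) := by rw [← hpq]; ring
    rw [e, abs_mul, abs_of_pos hq]
    calc _ = q * (_ * _) := mul_left_comm _ _ _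
      _ ≤ q * _ := mul_le_mul_of_nonneg_left this hq.le
      _ = _ := by ring

variable {p q a c C C' s₀ σ₀ : ℝ} {f : ℝ → ℝ} {w ws ξ : Eu n → ℝ → ℝ} {wi wii wis : Fin n → Eu n → ℝ → ℝ}

lemma sqInt_nonneg (g : Eu n → ℝ → ℝ) (s : ℝ) : 0 ≤ sqInt g s :=
  integral_nonneg fun _ => mul_nonneg (sq_nonneg _) (rho_pos _).le

namespace SimSol

variable (h : SimSol q f (Set.Ioi σ₀) w ws ξ wi wii wis) (N : Nonlin f p q a c C C' s₀)
include h N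

lemma good_pow : Good (Set.Ioi σ₀) fun y s => |w y s| ^ (p + 1) := by
  have e : (fun y s => |w y s| ^ (p + 1)) = fun y s =>
      Real.exp (-(2 * q + 1) * s) * |Real.exp (q * s) * w y s| ^ (p + 1) := by
    ext y s
    rw [abs_mul, Real.abs_exp, Real.mul_rpow (Real.exp_pos _).le (abs_nonneg _), ← Real.exp_mul,
      ← mul_assoc, ← Real.exp_add, show -(2 * q + 1) * s + q * s * (p + 1) = 0 by rw [← N.hpq]; ring,
      Real.exp_zero, one_mul]
  rw [e]
  have := N.hp
  have := N.hq
  exact (good_exp_Ioi (by positivity)).mul (h.good_comp (g := fun v => |v| ^ (p + 1))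
    (continuous_abs.rpow_const fun _ => Or.inr (by linarith)))

lemma powInt_le {s : ℝ} (hs : s ∈ Set.Ioi σ₀) (hs0 : 0 ≤ s) :
    c / 2 * powInt (p + 1) w s ≤
      2 * energy q f w wi s + 2 * C + 1 / 2 * sqInt ws s + 1 / 2 * sqInt ξ s := by
  have hq := N.hq
  have gE := h.good_energy N.cont hq
  have gF := h.good_force N.cont hq
  have gP := h.good_prim N.cont hq
  have g1 : Good (Set.Ioi σ₀) fun y s => -(∑ i, wi i y s ^ 2) - q * w y s ^ 2 +
      w y s * (Real.exp (-(q + 1) * s) * f (Real.exp (q * s) * w y s)) + w y s * ξ y s :=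
    ((((Good.sum Finset.univ fun i _ => (h.good_wi i).pow 2).neg).sub
      ((h.good_w.pow 2).const_mul q)).add (h.good_w.mul gF)).add (h.good_w.mul h.good_ξ)
  have gl : Good (Set.Ioi σ₀) fun y s => c / 2 * |w y s| ^ (p + 1) + w y s * ws y s := 
    ((h.good_pow N).const_mul _).add (h.good_w.mul h.good_ws)
  have gr : Good (Set.Ioi σ₀) fun y s => 2 * (1 / 2 * ∑ i, wi i y s ^ 2 + q / 2 * w y s ^ 2 -
      Real.exp (-(2 * q + 1) * s) * prim f (Real.exp (q * s) * w y s)) +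
      (-(∑ i, wi i y s ^ 2) - q * w y s ^ 2 +
      w y s * (Real.exp (-(q + 1) * s) * f (Real.exp (q * s) * w y s)) + w y s * ξ y s) + 2 * C +
      1 / 2 * ws y s ^ 2 + 1 / 2 * ξ y s ^ 2 :=
    ((((gE.const_mul 2).add g1).add (Good.const _)).add ((h.good_ws.pow 2).const_mul _)).add
      ((h.good_ξ.pow 2).const_mul _)
  have key : ∫ y, (c / 2 * |w y s| ^ (p + 1) + w y s * ws y s) * rho n y ≤ _ :=
    integral_mono (gl.integrable hs) (gr.integrable hs) fun y => by
      refine mul_le_mul_of_nonneg_right ?_ (rho_pos y).le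
      have e2 : Real.exp (-(2 * q + 1) * s) * Real.exp (q * s) = Real.exp (-(q + 1) * s) := by
        rw [← Real.exp_add]; congr 1; ring
      have e3 : Real.exp (-(2 * q + 1) * s) * |Real.exp (q * s) * w y s| ^ (p + 1) = |w y s| ^ (p + 1) := by
        rw [abs_mul, Real.abs_exp, Real.mul_rpow (Real.exp_pos _).le (abs_nonneg _), ← Real.exp_mul,
          ← mul_assoc, ← Real.exp_add, show -(2 * q + 1) * s + q * s * (p + 1) = 0 by
          rw [← N.hpq]; ring, Real.exp_zero, one_mul]
      have e1 := mul_le_mul_of_nonneg_left (N.super (Real.exp (q * s) * w y s))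
        (Real.exp_pos (-(2 * q + 1) * s)).le
      have e4 : Real.exp (-(2 * q + 1) * s) * C ≤ C :=
        mul_le_of_le_one_left N.hC (Real.exp_le_one_iff.2 (by nlinarith))
      have e5 := N.young (w y s)
      rw [mul_sub, mul_sub, mul_left_comm, e3, ← mul_assoc _ (Real.exp (q * s) * w y s),
        ← mul_assoc _ (Real.exp (q * s)), e2] at e1
      nlinarith [sq_nonneg (w y s - ws y s), sq_nonneg (w y s + ξ y s)]
  have i1 := (h.good_pow N).const_mul (c / 2)
  have i2 := h.good_w.mul h.good_ws
  have i3 := gE.const_mul 2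
  have i5 := Good.const (S := Set.Ioi σ₀) (n := n) (2 * C)
  have i6 := (h.good_ws.pow 2).const_mul (1 / 2)
  have i7 := (h.good_ξ.pow 2).const_mul (1 / 2)
  rw [i1.integral_add i2 hs, (((i3.add g1).add i5).add i6).integral_add i7 hs,
    ((i3.add g1).add i5).integral_add i6 hs, (i3.add g1).integral_add i5 hs, i3.integral_add g1 hs,
    h.integral_mul_deriv N.cont hq hs, integral_const_mul_rho, integral_const_mul_rho,
    integral_const_mul_rho, integral_const_mul_rho,
    integral_const_mul_rho (1 / 2) fun y => ξ y s ^ 2, integral_const_mul, integral_rho, mul_one] at key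
  change c / 2 * powInt (p + 1) w s + _ ≤ 2 * energy q f w wi s + _ + 2 * C +
    1 / 2 * sqInt ws s + 1 / 2 * sqInt ξ s at key
  linarith

lemma deriv_energy_le {s : ℝ} (hs : s ∈ Set.Ioi σ₀) (hs0 : s₀ ≤ s) :
    ∫ y, (-ws y s ^ 2 + ws y s * ξ y s + _root_.defect q f w y s) * rho n y ≤
      -(1 / 4) * sqInt ws s + sqInt ξ s +
        4 * C' / c * s ^ (-1 - a) * (energy q f w wi s + (C + c / 4)) := by
  have hq := N.hq
  have hc := N.hc
  have hs1 : 0 < s := by linarith [N.hs₀]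
  have g1 : Good (Set.Ioi σ₀) fun y s => -ws y s ^ 2 + ws y s * ξ y s + _root_.defect q f w y s :=
    (((h.good_ws.pow 2).neg).add (h.good_ws.mul h.good_ξ)).add (h.good_defect N.cont hq)
  have i2 := (h.good_ws.pow 2).const_mul (-(1 / 2))
  have i3 := (h.good_ξ.pow 2).const_mul (1 / 2)
  have i4 := ((h.good_pow N).add (Good.const 1)).const_mul (C' * s ^ (-1 - a))
  have key : ∫ y, (-ws y s ^ 2 + ws y s * ξ y s + _root_.defect q f w y s) * rho n y ≤ _ :=
    integral_mono (g1.integrable hs) (((i2.add i3).add i4).integrable hs) fun y => by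
    refine mul_le_mul_of_nonneg_right ?_ (rho_pos y).le
    have e1 : _root_.defect q f w y s ≤ C' * s ^ (-1 - a) * (|w y s| ^ (p + 1) + 1) := by
      refine (le_abs_self _).trans ?_
      rw [_root_.defect, abs_mul, Real.abs_exp]
      exact N.defect s (w y s) hs0
    nlinarith [sq_nonneg (ws y s - ξ y s)]
  rw [(i2.add i3).integral_add i4 hs, i2.integral_add i3 hs, integral_const_mul_rho,
    integral_const_mul_rho, integral_const_mul_rho,
    (h.good_pow N).integral_add (Good.const 1) hs] at key
  simp only [one_mul, integral_rho] at key
  change _ ≤ -(1 / 2) * sqInt ws s + 1 / 2 * sqInt ξ s +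
    C' * s ^ (-1 - a) * (powInt (p + 1) w s + 1) at key
  have hL := h.powInt_le N hs hs1.le
  have hsm := N.small s hs0
  have hB : C' * s ^ (-1 - a) = 4 * C' / c * s ^ (-1 - a) * (c / 4) := by field_simp
  have hB0 : 0 ≤ 4 * C' / c * s ^ (-1 - a) := by have := N.hC'; positivity
  set B := 4 * C' / c * s ^ (-1 - a)
  rw [hB] at key
  have hD := sqInt_nonneg ws s
  have hX := sqInt_nonneg ξ s
  have h5 := mul_le_mul_of_nonneg_left hL hB0
  have h6 : B * (sqInt ws s + sqInt ξ s) ≤ 1 * (sqInt ws s + sqInt ξ s) := by gcongr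
  nlinarith

end SimSol

end Dissipation

section Gronwall

variable {n : ℕ} {p q a c C C' s₀ σ₀ : ℝ} {f : ℝ → ℝ} {w ws ξ : Eu n → ℝ → ℝ}
  {wi wii wis : Fin n → Eu n → ℝ → ℝ}

namespace SimSol

variable (h : SimSol q f (Set.Ioi σ₀) w ws ξ wi wii wis)
include h

lemma continuousOn_diss : ContinuousOn (sqInt ws) (Set.Ioi σ₀) :=
  (h.good_ws.pow 2).continuousOn_integral isOpen_Ioi

lemma continuousOn_err : ContinuousOn (sqInt ξ) (Set.Ioi σ₀) :=
  (h.good_ξ.pow 2).continuousOn_integral isOpen_Ioi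

variable (N : Nonlin f p q a c C C' s₀)
include N

lemma continuousOn_powInt : ContinuousOn (powInt (p + 1) w) (Set.Ioi σ₀) :=
  (h.good_pow N).continuousOn_integral isOpen_Ioi

/-- The energy is asymptotically nonnegative for solutions that exist past the centre. -/
lemma eventually_energy_ge {ε : ℝ} (hε : 0 < ε) : ∀ᶠ s in atTop, -ε ≤ energy q f w wi s := by
  obtain ⟨M, hM⟩ := h.bdd
  have hq := N.hq
  obtain ⟨A, hA⟩ := (isCompact_Icc (a := -M) (b := M)).exists_bound_of_continuousOn
    (continuous_prim N.cont).continuousOn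
  have ht : Tendsto (fun s : ℝ => Real.exp (-(2 * q + 1) * s) * A) atTop (𝓝 0) := by
    have h1 : Tendsto (fun s : ℝ => -(2 * q + 1) * s) atTop atBot :=
      tendsto_id.const_mul_atTop_of_neg (by linarith)
    simpa using (Real.tendsto_exp_atBot.comp h1).mul_const A
  filter_upwards [ht.eventually (ge_mem_nhds hε), eventually_gt_atTop σ₀] with s h1 hs
  have key : ∫ y, -ε * rho n y ≤ energy q f w wi s :=
    integral_mono (integrable_rho.const_mul _) ((h.good_energy N.cont hq).integrable hs) fun y => by
      refine mul_le_mul_of_nonneg_right ?_ (rho_pos y).le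
      have h2 := (le_abs_self _).trans (hA _ (abs_le.1 (hM y s hs)))
      have h3 := mul_le_mul_of_nonneg_left h2 (Real.exp_pos (-(2 * q + 1) * s)).le
      have h4 : 0 ≤ ∑ i, wi i y s ^ 2 := Finset.sum_nonneg fun i _ => sq_nonneg _
      nlinarith [mul_nonneg hq.le (sq_nonneg (w y s))]
  rwa [integral_const_mul, integral_rho, mul_one] at key

lemma gronwall {s₁ s₂ : ℝ} (h0 : σ₀ < s₁) (h1 : s₀ ≤ s₁) (h12 : s₁ ≤ s₂) :
    Real.exp (4 * C' / c / a * s₂ ^ (-a)) * (energy q f w wi s₂ + (C + c / 4)) +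
        1 / 4 * ∫ s in s₁..s₂, sqInt ws s ≤
      Real.exp (4 * C' / c / a * s₁ ^ (-a)) * (energy q f w wi s₁ + (C + c / 4)) +
        Real.exp (4 * C' / c / a) * ∫ s in s₁..s₂, sqInt ξ s := by
  have ha := N.ha
  have hc := N.hc
  have hC' := N.hC'
  set B := 4 * C' / c
  have hB : 0 ≤ B := by positivity
  have hsub : Set.Icc s₁ s₂ ⊆ Set.Ioi σ₀ := fun s hs => h0.trans_le hs.1
  have hpos : ∀ s ∈ Set.Icc s₁ s₂, 1 ≤ s := fun s hs => N.hs₀.trans (h1.trans hs.1)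
  have cD := (h.continuousOn_diss).mono hsub
  have cX := (h.continuousOn_err).mono hsub
  have hder : ∀ s ∈ Set.Icc s₁ s₂, HasDerivAt (fun s => Real.exp (B / a * s ^ (-a)) *
      (energy q f w wi s + (C + c / 4))) (Real.exp (B / a * s ^ (-a)) *
        ((∫ y, (-ws y s ^ 2 + ws y s * ξ y s + _root_.defect q f w y s) * rho n y) -
          B * s ^ (-1 - a) * (energy q f w wi s + (C + c / 4)))) s := fun s hs => by
    have hs0 : 0 < s := zero_lt_one.trans_le (hpos s hs)
    have d1 : HasDerivAt (fun s : ℝ => Real.exp (B / a * s ^ (-a)))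
        (Real.exp (B / a * s ^ (-a)) * (B / a * (-a * s ^ (-a - 1)))) s :=
      ((Real.hasDerivAt_rpow_const (Or.inl hs0.ne')).const_mul (B / a)).exp
    refine (d1.fun_mul ((h.hasDerivAt_energy N.cont N.hq (hsub hs)).add_const _)).congr_deriv ?_
    rw [show -a - 1 = -1 - a by ring]
    field_simp
    ring
  have key := intervalIntegral.sub_le_integral_of_hasDeriv_right_of_le h12
    (fun s hs => (hder s hs).continuousAt.continuousWithinAt)
    (fun s hs => (hder s (Set.Ioo_subset_Icc_self hs)).hasDerivWithinAt)
    (φ := fun s => -(1 / 4) * sqInt ws s + Real.exp (B / a) * sqInt ξ s)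
    ((cD.const_smul (-(1 / 4) : ℝ)).add (cX.const_smul (Real.exp (B / a)))).integrableOn_Icc
    fun s hs => by
      have hs' := Set.Ioo_subset_Icc_self hs
      have hs1 := hpos s hs'
      have e1 := h.deriv_energy_le N (hsub hs') (h1.trans hs'.1)
      have e2 : 1 ≤ Real.exp (B / a * s ^ (-a)) := Real.one_le_exp (by positivity)
      have e3 : Real.exp (B / a * s ^ (-a)) ≤ Real.exp (B / a) := by
        refine Real.exp_le_exp.2 (mul_le_of_le_one_right (by positivity) ?_)
        exact Real.rpow_le_one_of_one_le_of_nonpos hs1 (by linarith)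
      have hD := sqInt_nonneg ws s
      have hX := sqInt_nonneg ξ s
      have e4 : (∫ y, (-ws y s ^ 2 + ws y s * ξ y s + _root_.defect q f w y s) * rho n y) -
          B * s ^ (-1 - a) * (energy q f w wi s + (C + c / 4)) ≤
          -(1 / 4) * sqInt ws s + sqInt ξ s := by linarith
      refine (mul_le_mul_of_nonneg_left e4 (Real.exp_pos _).le).trans ?_
      nlinarith [mul_le_mul_of_nonneg_right e2 hD, mul_le_mul_of_nonneg_right e3 hX]
  rw [intervalIntegral.integral_add, intervalIntegral.integral_const_mul,
    intervalIntegral.integral_const_mul] at key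
  · linarith
  · exact ((cD.intervalIntegrable_of_Icc h12).const_mul _)
  · exact ((cX.intervalIntegrable_of_Icc h12).const_mul _)

theorem diss_le {EE : ℝ} (hEE : 0 ≤ EE) {s₁ : ℝ} (h0 : σ₀ < s₁) (h1 : s₀ ≤ s₁)
    (hE : energy q f w wi s₁ ≤ EE) (hX : ∀ s₂, s₁ ≤ s₂ → ∫ s in s₁..s₂, sqInt ξ s ≤ 1)
    {s₂ : ℝ} (h12 : s₁ ≤ s₂) :
    ∫ s in s₁..s₂, sqInt ws s ≤ 4 * Real.exp (4 * C' / c / a) * (EE + C + c / 4 + 1) ∧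
    energy q f w wi s₂ + (C + c / 4) ≤ Real.exp (4 * C' / c / a) * (EE + C + c / 4 + 1) := by
  have ha := N.ha
  have hc := N.hc
  have hC := N.hC
  have hC' := N.hC'
  have hs1 : 1 ≤ s₁ := N.hs₀.trans h1
  set Θ := Real.exp (4 * C' / c / a)
  have hΘ : 0 < Θ := Real.exp_pos _
  have h_integ : ∀ t, s₁ ≤ t → Real.exp (4 * C' / c / a * t ^ (-a)) * (energy q f w wi t + (C + c / 4)) +
      1 / 4 * ∫ s in s₁..t, sqInt ws s ≤ Θ * (EE + C + c / 4 + 1) := fun t ht => by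
    refine (h.gronwall N h0 h1 ht).trans ?_
    have e2 : 0 < Real.exp (4 * C' / c / a * s₁ ^ (-a)) := Real.exp_pos _
    have e3 : Real.exp (4 * C' / c / a * s₁ ^ (-a)) ≤ Θ := by
      refine Real.exp_le_exp.2 (mul_le_of_le_one_right (by positivity) ?_)
      exact Real.rpow_le_one_of_one_le_of_nonpos hs1 (by linarith)
    have e4 := mul_le_mul_of_nonneg_left (hX t ht) hΘ.le
    have e5 := mul_le_mul_of_nonneg_left hE e2.le
    have e6 := mul_le_mul_of_nonneg_right e3 (by positivity : 0 ≤ EE + C + c / 4)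
    nlinarith
  constructor
  · obtain ⟨s₃, h3, h23⟩ := ((h.eventually_energy_ge N (by positivity : 0 < C + c / 4)).and
      (eventually_ge_atTop s₂)).exists
    have e1 := h_integ s₃ (h12.trans h23)
    have e2 : 0 ≤ Real.exp (4 * C' / c / a * s₃ ^ (-a)) * (energy q f w wi s₃ + (C + c / 4)) :=
      mul_nonneg (Real.exp_pos _).le (by linarith)
    have ci : ∀ s t, s₁ ≤ s → s ≤ t → IntervalIntegrable (sqInt ws) volume s t := fun s t hs hst =>
      (h.continuousOn_diss.mono fun x hx => h0.trans_le (hs.trans hx.1)).intervalIntegrable_of_Icc hst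
    have e3 : ∫ s in s₁..s₂, sqInt ws s ≤ ∫ s in s₁..s₃, sqInt ws s := by
      rw [← intervalIntegral.integral_add_adjacent_intervals (ci s₁ s₂ le_rfl h12) (ci s₂ s₃ h12 h23)]
      have := intervalIntegral.integral_nonneg h23 (μ := volume) fun s _ => sqInt_nonneg ws s
      linarith
    linarith
  · have e1 := h_integ s₂ h12
    have e2 := intervalIntegral.integral_nonneg h12 (μ := volume) fun s _ => sqInt_nonneg ws s
    rcases le_or_gt (energy q f w wi s₂ + (C + c / 4)) 0 with h4 | h4
    · exact h4.trans (by positivity)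
    · have e3 : 1 ≤ Real.exp (4 * C' / c / a * s₂ ^ (-a)) := Real.one_le_exp (by
        have : 0 < s₂ := by linarith
        positivity)
      nlinarith

theorem powInt_integral_le {EE : ℝ} (hEE : 0 ≤ EE) {s₁ : ℝ} (h0 : σ₀ < s₁) (h1 : s₀ ≤ s₁)
    (hE : energy q f w wi s₁ ≤ EE) (hX : ∀ s₂, s₁ ≤ s₂ → ∫ s in s₁..s₂, sqInt ξ s ≤ 1)
    {s₂ s₃ : ℝ} (h12 : s₁ ≤ s₂) (h23 : s₂ ≤ s₃) :
    ∫ s in s₂..s₃, powInt (p + 1) w s ≤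
      4 / c * (Real.exp (4 * C' / c / a) * (EE + C + c / 4 + 1) * (s₃ - s₂ + 1) + 1 / 4) := by
  have hc := N.hc
  have hsub : Set.Icc s₂ s₃ ⊆ Set.Ioi σ₀ := fun s hs => h0.trans_le (h12.trans hs.1)
  have ci : ∀ s t, s₁ ≤ s → s ≤ t → ∀ g : ℝ → ℝ, ContinuousOn g (Set.Ioi σ₀) → IntervalIntegrable g volume s t :=
    fun s t hs hst g hg => (hg.mono fun x hx => h0.trans_le (hs.trans hx.1)).intervalIntegrable_of_Icc hst
  have iD := ci s₂ s₃ h12 h23 _ h.continuousOn_diss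
  have iX := ci s₂ s₃ h12 h23 _ h.continuousOn_err
  set A := Real.exp (4 * C' / c / a) * (EE + C + c / 4 + 1) with hA
  have key : ∫ s in s₂..s₃, powInt (p + 1) w s ≤
      ∫ s in s₂..s₃, 4 / c * (A + (1 / 4 * sqInt ws s + 1 / 4 * sqInt ξ s)) := by
    refine intervalIntegral.integral_mono_on h23 (ci s₂ s₃ h12 h23 _ (h.continuousOn_powInt N))
      (((intervalIntegrable_const).add ((iD.const_mul _).add (iX.const_mul _))).const_mul _)
      fun s hs => ?_
    have e1 := h.powInt_le N (hsub hs) (by linarith [N.hs₀, hs.1])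
    have e2 := (h.diss_le N hEE h0 h1 hE hX (h12.trans hs.1)).2
    rw [← hA] at e2
    rw [div_mul_eq_mul_div, le_div_iff₀ hc]
    linarith
  refine key.trans ?_
  clear_value A
  rw [intervalIntegral.integral_const_mul, intervalIntegral.integral_add intervalIntegrable_const
    ((iD.const_mul _).add (iX.const_mul _)), intervalIntegral.integral_add (iD.const_mul _)
    (iX.const_mul _), intervalIntegral.integral_const_mul, intervalIntegral.integral_const_mul,
    intervalIntegral.integral_const, smul_eq_mul]
  have tail : ∀ g : ℝ → ℝ, (∀ s, 0 ≤ g s) → ContinuousOn g (Set.Ioi σ₀) →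
      ∫ s in s₂..s₃, g s ≤ ∫ s in s₁..s₃, g s := fun g hg hc => by
    rw [← intervalIntegral.integral_add_adjacent_intervals (ci s₁ s₂ le_rfl h12 _ hc)
      (ci s₂ s₃ h12 h23 _ hc)]
    have := intervalIntegral.integral_nonneg h12 (μ := volume) fun s _ => hg s
    linarith
  have t1 := (tail _ (sqInt_nonneg ws) h.continuousOn_diss).trans
    (h.diss_le N hEE h0 h1 hE hX (h12.trans h23)).1
  have t2 := (tail _ (sqInt_nonneg ξ) h.continuousOn_err).trans (hX s₃ (h12.trans h23))
  rw [mul_assoc, ← hA] at t1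
  exact mul_le_mul_of_nonneg_left (by linarith) (by positivity)

end SimSol

end Gronwall

section GoodTime

variable {n : ℕ} {p q a c C C' s₀ : ℝ} {f : ℝ → ℝ}

lemma integral_le_of_le_rho {g : Eu n → ℝ} (hg : Integrable fun y => g y * rho n y) {A : ℝ} (h : ∀ y, g y ≤ A) :
    ∫ y, g y * rho n y ≤ A :=
  calc _ ≤ ∫ y, A * rho n y := integral_mono hg (integrable_rho.const_mul A) fun y =>
        mul_le_mul_of_nonneg_right (h y) (rho_pos y).le
    _ = A := by rw [integral_const_mul, integral_rho, mul_one]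

lemma exists_bound_Icc {g : ℝ → ℝ} (hg : Continuous g) (M : ℝ) : ∃ B, 0 ≤ B ∧ ∀ z, |z| ≤ M → |g z| ≤ B := by
  obtain ⟨B, hB⟩ := (isCompact_Icc (a := -M) (b := M)).exists_bound_of_continuousOn hg.continuousOn
  exact ⟨max B 0, le_max_right _ _, fun z hz => (hB z (abs_le.1 hz)).trans (le_max_left _ _)⟩

/-- Dissipation and potential bounds, from pointwise bounds on an initial time window. -/
theorem Nonlin.exists_bounds (N : Nonlin f p q a c C C' s₀) {M : ℝ} (hM : 0 ≤ M) :
    ∃ B, 0 < B ∧ ∀ (σ₀ : ℝ) (w ws ξ : Eu n → ℝ → ℝ) (wi wii wis : Fin n → Eu n → ℝ → ℝ),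
      SimSol q f (Set.Ioi σ₀) w ws ξ wi wii wis → ∀ sa sb, σ₀ < sa → s₀ ≤ sa → sa + Real.log 2 ≤ sb →
      (∀ y, ∀ s ∈ Set.Icc sa sb, |Real.exp (q * s) * w y s| ≤ M) →
      (∀ y, ∀ s ∈ Set.Icc sa sb, |ξ y s| ≤ M) →
      (∀ s, sa ≤ s → ∫ r in sa..s, sqInt ξ r ≤ 1) → ∀ s₂ s₃, sb ≤ s₂ → s₂ ≤ s₃ →
      ∫ s in s₂..s₃, sqInt ws s ≤ B ∧ ∫ s in s₂..s₃, powInt (p + 1) w s ≤ B * (s₃ - s₂ + 1) := by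
  obtain ⟨P, hP, hP'⟩ := exists_bound_Icc (continuous_prim N.cont) M
  obtain ⟨F, hF, hF'⟩ := exists_bound_Icc N.cont M
  set EE := P + M * F + M ^ 2 with hEE
  have hE0 : 0 ≤ EE := by positivity
  have hc := N.hc
  have hC := N.hC
  set A := Real.exp (4 * C' / c / a) * (EE + C + c / 4 + 1) with hA
  have hA0 : 0 < A := by positivity
  refine ⟨4 * A + 4 / c * (A + 1 / 4), by positivity, fun σ₀ w ws ξ wi wii wis h sa sb h0 h1 hab hw hξ hX
    s₂ s₃ h2 h23 => ?_⟩
  have hl := Real.log_two_gt_d9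
  have hsub : ∀ s ∈ Set.Icc sa sb, s ∈ Set.Ioi σ₀ := fun s hs => h0.trans_le hs.1
  have hs0 : ∀ s ∈ Set.Icc sa sb, 0 ≤ s := fun s hs => by linarith [N.hs₀, hs.1]
  have hq := N.hq
  have hw' : ∀ y, ∀ s ∈ Set.Icc sa sb, |w y s| ≤ M := fun y s hs => by
    have := hw y s hs
    rw [abs_mul, Real.abs_exp] at this
    have e : 1 ≤ Real.exp (q * s) := Real.one_le_exp (mul_nonneg hq.le (hs0 s hs))
    exact (le_mul_of_one_le_left (abs_nonneg _) e).trans this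
  have hlt : sa < sb := by linarith
  obtain ⟨s₁, hs₁, hd⟩ := exists_hasDerivAt_eq_slope (sqInt w) (fun s => 2 * ∫ y, w y s * ws y s * rho n y) hlt
    (fun s hs => (h.hasDerivAt_sqInt (hsub s hs)).continuousAt.continuousWithinAt)
    (fun s hs => h.hasDerivAt_sqInt (hsub s ⟨hs.1.le, hs.2.le⟩))
  have hs₁' : s₁ ∈ Set.Icc sa sb := ⟨hs₁.1.le, hs₁.2.le⟩
  have hY : sqInt w sa ≤ M ^ 2 := integral_le_of_le_rho ((h.good_w.pow 2).integrable h0) fun y => by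
    rw [← sq_abs]; exact pow_le_pow_left₀ (abs_nonneg _) (hw' y sa ⟨le_rfl, hlt.le⟩) 2
  have hd' : -(M ^ 2) ≤ ∫ y, w y s₁ * ws y s₁ * rho n y := by
    have e1 := sqInt_nonneg w sb
    rw [eq_div_iff (by linarith)] at hd
    by_contra hcon
    push Not at hcon
    have : (M ^ 2) * 1 ≤ (M ^ 2) * (2 * (sb - sa)) := by gcongr; linarith
    nlinarith
  have g2 : Good (Set.Ioi σ₀) fun y s => -(∑ i, wi i y s ^ 2) - q * w y s ^ 2 +
      w y s * (Real.exp (-(q + 1) * s) * f (Real.exp (q * s) * w y s)) + w y s * ξ y s :=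
    ((((Good.sum Finset.univ fun i _ => (h.good_wi i).pow 2).neg).sub
      ((h.good_w.pow 2).const_mul q)).add (h.good_w.mul (h.good_force N.cont hq))).add
      (h.good_w.mul h.good_ξ)
  have hen : energy q f w wi s₁ + 1 / 2 * ∫ y, w y s₁ * ws y s₁ * rho n y ≤ P + 1 / 2 * (M * F + M * M) := by
    rw [h.integral_mul_deriv N.cont hq (hsub s₁ hs₁'), energy, ← integral_const_mul_rho,
      ← Good.integral_add (h.good_energy N.cont hq) (g2.const_mul (1 / 2)) (hsub s₁ hs₁')]
    refine integral_le_of_le_rho (((h.good_energy N.cont hq).add (g2.const_mul (1 / 2))).integrable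
      (hsub s₁ hs₁')) fun y => ?_
    have e0 := hs0 s₁ hs₁'
    have b1 := hw' y s₁ hs₁'
    have b2 := hξ y s₁ hs₁'
    have b3 := hP' _ (hw y s₁ hs₁')
    have b4 := hF' _ (hw y s₁ hs₁')
    have x1 : Real.exp (-(2 * q + 1) * s₁) ≤ 1 := Real.exp_le_one_iff.2 (by nlinarith)
    have x2 : Real.exp (-(q + 1) * s₁) ≤ 1 := Real.exp_le_one_iff.2 (by nlinarith)
    have c1 : -(Real.exp (-(2 * q + 1) * s₁) * prim f (Real.exp (q * s₁) * w y s₁)) ≤ P := by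
      refine (neg_le_abs _).trans ?_
      rw [abs_mul, Real.abs_exp]
      exact (mul_le_mul x1 b3 (abs_nonneg _) zero_le_one).trans (one_mul P).le
    have c2 : w y s₁ * (Real.exp (-(q + 1) * s₁) * f (Real.exp (q * s₁) * w y s₁)) ≤ M * F := by
      refine (le_abs_self _).trans ?_
      rw [abs_mul, abs_mul, Real.abs_exp]
      exact mul_le_mul b1 ((mul_le_mul x2 b4 (abs_nonneg _) zero_le_one).trans (one_mul F).le)
        (by positivity) hM
    have c3 : w y s₁ * ξ y s₁ ≤ M * M := by
      refine (le_abs_self _).trans ?_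
      rw [abs_mul]
      exact mul_le_mul b1 b2 (abs_nonneg _) hM
    linarith
  have hE : energy q f w wi s₁ ≤ EE := by
    have : 0 ≤ M * F := by positivity
    nlinarith
  have hX' : ∀ s, s₁ ≤ s → ∫ r in s₁..s, sqInt ξ r ≤ 1 := fun s hs => by
    refine le_trans ?_ (hX s (hs₁.1.le.trans hs))
    have ci : ∀ r t, sa ≤ r → r ≤ t → IntervalIntegrable (sqInt ξ) volume r t := fun r t hr hrt =>
      (h.continuousOn_err.mono fun x hx => h0.trans_le (hr.trans hx.1)).intervalIntegrable_of_Icc hrt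
    rw [← intervalIntegral.integral_add_adjacent_intervals (ci sa s₁ le_rfl hs₁.1.le) (ci s₁ s hs₁.1.le hs)]
    have := intervalIntegral.integral_nonneg hs₁.1.le (μ := volume) fun s _ => sqInt_nonneg ξ s
    linarith
  have hs12 : s₁ ≤ s₂ := hs₁.2.le.trans h2
  have k0 : 0 < 4 / c := by positivity
  constructor
  · have e1 := (h.diss_le N hE0 (h0.trans hs₁.1) (h1.trans hs₁.1.le) hE hX' (hs12.trans h23)).1
    rw [mul_assoc, ← hA] at e1
    have ci : ∀ r t, s₁ ≤ r → r ≤ t → IntervalIntegrable (sqInt ws) volume r t := fun r t hr hrt =>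
      (h.continuousOn_diss.mono fun x hx => (h0.trans hs₁.1).trans_le (hr.trans hx.1)).intervalIntegrable_of_Icc hrt
    rw [← intervalIntegral.integral_add_adjacent_intervals (ci s₁ s₂ le_rfl hs12) (ci s₂ s₃ hs12 h23)] at e1
    have e2 := intervalIntegral.integral_nonneg hs12 (μ := volume) fun s _ => sqInt_nonneg ws s
    have : 0 ≤ 4 / c * (A + 1 / 4) := by positivity
    linarith
  · have e1 := h.powInt_integral_le N hE0 (h0.trans hs₁.1) (h1.trans hs₁.1.le) hE hX' hs12 h23
    rw [← hA] at e1
    refine e1.trans ?_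
    have h3 : 0 ≤ s₃ - s₂ := by linarith
    have h4 : 4 / c * (A * (s₃ - s₂ + 1) + 1 / 4) ≤ 4 / c * ((A + 1 / 4) * (s₃ - s₂ + 1)) := by
      gcongr; nlinarith
    have h5 : 0 ≤ 4 * A * (s₃ - s₂ + 1) := by positivity
    linarith

end GoodTime

section Mollified

variable {n : ℕ}

/-- A sequence of bump functions shrinking to the origin. -/
noncomputable def bumpSeq (n k : ℕ) : ContDiffBump (0 : Eu n) where
  rIn := 1 / (k + 1) / 2
  rOut := 1 / (k + 1)
  rIn_pos := by positivity
  rIn_lt_rOut := half_lt_self (by positivity)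

/-- A standard sequence of mollifiers. -/
noncomputable def mollSeq (n k : ℕ) : Eu n → ℝ := (bumpSeq n k).normed volume

lemma moll_mollSeq (k : ℕ) : Moll (mollSeq n k) where
  smooth m := (bumpSeq n k).contDiff_normed (n := (m : ℕ∞))
  supp := (bumpSeq n k).hasCompactSupport_normed

lemma integral_abs_mollSeq (k : ℕ) : ∫ z, |mollSeq n k z| = 1 := by
  have : ∀ z, |mollSeq n k z| = mollSeq n k z := fun z => abs_of_nonneg ((bumpSeq n k).nonneg_normed z)
  simp only [this]
  exact (bumpSeq n k).integral_normed

lemma abs_mollSeq_le {g : Eu n → ℝ} {M : ℝ} (hM : ∀ x, |g x| ≤ M) (k : ℕ) (x : Eu n) :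
    |moll (mollSeq n k) g x| ≤ M := by
  simpa [integral_abs_mollSeq] using (moll_mollSeq k).abs_moll_le hM x

lemma tendsto_mollSeq {g : Eu n → ℝ} (hg : Continuous g) (x : Eu n) :
    Tendsto (fun k => moll (mollSeq n k) g x) atTop (𝓝 (g x)) := by
  have h1 : Tendsto (fun k => (bumpSeq n k).rOut) atTop (𝓝 0) := tendsto_one_div_add_atTop_nhds_zero_nat
  refine (ContDiffBump.convolution_tendsto_right_of_continuous (μ := volume) h1 hg x).congr fun k => ?_
  rw [convolution_lsmul_swap]
  exact integral_congr_ae (.of_forall fun z => mul_comm _ _)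

variable {f : ℝ → ℝ} {u : Eu n → ℝ → ℝ} {τ M K q : ℝ} {b : Eu n}

lemma err_eq (χ : Eu n → ℝ) (y : Eu n) (s : ℝ) :
    IsSol.err f u χ b τ q y s = Real.exp (-(q + 1) * s) *
      (moll χ (fun z => f (u z (τ - Real.exp (-s)))) (b + Real.exp (-s / 2) • y) -
        f (moll χ (fun z => u z (τ - Real.exp (-s))) (b + Real.exp (-s / 2) • y))) := by
  rw [IsSol.err, exp_mul_sim, sim, mul_sub]
  rfl

lemma abs_err_le {M F s : ℝ} (hM : ∀ z, |u z (τ - Real.exp (-s))| ≤ M) (hF : ∀ z, |z| ≤ M → |f z| ≤ F)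
    (k : ℕ) (y : Eu n) : |IsSol.err f u (mollSeq n k) b τ q y s| ≤ Real.exp (-(q + 1) * s) * (2 * F) := by
  rw [err_eq, abs_mul, Real.abs_exp]
  gcongr
  refine (abs_sub _ _).trans ?_
  have h1 := abs_mollSeq_le (n := n) (fun z => hF _ (hM z)) k (b + Real.exp (-s / 2) • y)
  have h2 := hF _ (abs_mollSeq_le (n := n) hM k (b + Real.exp (-s / 2) • y))
  linarith

namespace IsSol

lemma tendsto_integral_sqInt_err (h : IsSol f u τ M K) (hτ : 0 < τ) (hq : 0 < q) (b : Eu n) {sa : ℝ}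
    (hsa : -Real.log τ < sa) : Tendsto (fun k => ∫ s in Set.Ioi sa,
      sqInt (err f u (mollSeq n k) b τ q) s) atTop (𝓝 0) := by
  obtain ⟨F, hF0, hF⟩ := exists_bound_Icc h.contf M
  have hmem : ∀ s ∈ Set.Ioi sa, s ∈ Set.Ioi (-Real.log τ) := fun s hs => hsa.trans hs
  have bd : ∀ k y, ∀ s ∈ Set.Ioi sa, |err f u (mollSeq n k) b τ q y s| ≤ Real.exp (-(q + 1) * s) * (2 * F) :=
    fun k y s hs => abs_err_le (fun z => h.bdd z _ (sub_exp_mem hτ (hmem s hs))) hF k y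
  have hsim := fun k => h.simSol (q := q) hτ (moll_mollSeq (n := n) k) b hq
  have key : Tendsto (fun k => ∫ s in Set.Ioi sa, sqInt (err f u (mollSeq n k) b τ q) s) atTop
      (𝓝 (∫ s in Set.Ioi sa, (0:ℝ))) := by
    refine tendsto_integral_filter_of_dominated_convergence
      (fun s => Real.exp (-(2 * (q + 1)) * s) * (2 * F) ^ 2) (.of_forall fun k => ?_)
      (.of_forall fun k => ?_) ?_ ?_
    · obtain ⟨ws, wi, wii, wis, hs⟩ := hsim k
      exact (hs.continuousOn_err.mono hmem).aestronglyMeasurable measurableSet_Ioi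
    · refine (ae_restrict_mem measurableSet_Ioi).mono fun s hs => ?_
      obtain ⟨ws, wi, wii, wis, hS⟩ := hsim k
      rw [Real.norm_of_nonneg (sqInt_nonneg _ _)]
      refine integral_le_of_le_rho ((hS.good_ξ.pow 2).integrable (hmem s hs)) fun y => ?_
      rw [show -(2 * (q + 1)) * s = (2:ℕ) * (-(q + 1) * s) by push_cast; ring, Real.exp_nat_mul, ← mul_pow,
        ← sq_abs]
      exact pow_le_pow_left₀ (abs_nonneg _) (bd k y s hs) 2
    · exact (integrableOn_exp_mul_Ioi (by linarith) sa).mul_const _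
    · refine (ae_restrict_mem measurableSet_Ioi).mono fun s hs => ?_
      have hts := sub_exp_mem hτ (hmem s hs)
      have hc := (h.c2 _ hts).continuous
      have : Tendsto (fun k => sqInt (err f u (mollSeq n k) b τ q) s) atTop
          (𝓝 (∫ y : Eu n, (0:ℝ))) := by
        refine tendsto_integral_filter_of_dominated_convergence
          (fun y => (Real.exp (-(q + 1) * s) * (2 * F)) ^ 2 * rho n y) (.of_forall fun k => ?_)
          (.of_forall fun k => .of_forall fun y => ?_) (integrable_rho.const_mul _) (.of_forall fun y => ?_)
        · obtain ⟨ws, wi, wii, wis, hS⟩ := hsim k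
          exact ((hS.good_ξ.pow 2).integrable (hmem s hs)).aestronglyMeasurable
        · rw [Real.norm_of_nonneg (mul_nonneg (sq_nonneg _) (rho_pos y).le), ← sq_abs]
          exact mul_le_mul_of_nonneg_right (pow_le_pow_left₀ (abs_nonneg _) (bd k y s hs) 2) (rho_pos y).le
        · simp only [err_eq]
          have t1 := tendsto_mollSeq (h.contf.comp hc) (b + Real.exp (-s / 2) • y)
          have t2 := (h.contf.tendsto _).comp (tendsto_mollSeq hc (b + Real.exp (-s / 2) • y))
          have := ((((t1.sub t2).const_mul (Real.exp (-(q + 1) * s))).pow 2).mul_const (rho n y))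
          simpa [Function.comp_def] using this
      simpa using this
  simpa using key

lemma eventually_err_le (h : IsSol f u τ M K) (hτ : 0 < τ) (hq : 0 < q) (b : Eu n) {sa : ℝ}
    (hsa : -Real.log τ < sa) : ∀ᶠ k in atTop, ∀ s, sa ≤ s →
      ∫ r in sa..s, sqInt (err f u (mollSeq n k) b τ q) r ≤ 1 := by
  obtain ⟨F, hF0, hF⟩ := exists_bound_Icc h.contf M
  filter_upwards [(h.tendsto_integral_sqInt_err hτ hq b hsa).eventually_le_const zero_lt_one] with k hk s hs
  obtain ⟨ws, wi, wii, wis, hS⟩ := h.simSol (q := q) hτ (moll_mollSeq (n := n) k) b hq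
  have hmem : ∀ s ∈ Set.Ioi sa, s ∈ Set.Ioi (-Real.log τ) := fun s hs => hsa.trans hs
  have h_integ : IntegrableOn (fun s => sqInt (err f u (mollSeq n k) b τ q) s) (Set.Ioi sa) := by
    refine Integrable.mono' (g := fun s => Real.exp (-(2 * (q + 1)) * s) * (2 * F) ^ 2)
      ((integrableOn_exp_mul_Ioi (by linarith) sa).mul_const _)
      ((hS.continuousOn_err.mono hmem).aestronglyMeasurable measurableSet_Ioi) ?_
    refine (ae_restrict_mem measurableSet_Ioi).mono fun s hs => ?_
    rw [Real.norm_of_nonneg (sqInt_nonneg _ _)]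
    refine integral_le_of_le_rho ((hS.good_ξ.pow 2).integrable (hmem s hs)) fun y => ?_
    rw [show -(2 * (q + 1)) * s = (2:ℕ) * (-(q + 1) * s) by push_cast; ring, Real.exp_nat_mul, ← mul_pow,
      ← sq_abs]
    exact pow_le_pow_left₀ (abs_nonneg _)
      (abs_err_le (fun z => h.bdd z _ (sub_exp_mem hτ (hmem s hs))) hF k y) 2
  rw [intervalIntegral.integral_of_le hs]
  exact (setIntegral_mono_set h_integ (.of_forall fun s => sqInt_nonneg _ s)
    (Set.Ioc_subset_Ioi_self).eventuallyLE).trans hk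

end IsSol

/-- Dissipation and potential bounds for mollified solutions, uniform in the centre. -/
theorem Nonlin.exists_uniform_bounds {p a c C C' s₀ T : ℝ} (N : Nonlin f p q a c C C' s₀) (hT : 0 < T)
    (hu : ∀ τ ∈ Set.Ioo 0 T, ∃ M K, IsSol f u τ M K) :
    ∃ tb ∈ Set.Ioo 0 T, ∃ B, 0 < B ∧ ∀ T' ∈ Set.Ioo ((tb + T) / 2) T, ∀ b, ∀ᶠ k in atTop,
      ∃ ws ξ wi wii wis, SimSol q f (Set.Ioi (-Real.log T')) (sim b T' q (stm (mollSeq n k) u)) ws ξ wi wii wis ∧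
      ∀ s₂ s₃, -Real.log (T' - tb) ≤ s₂ → s₂ ≤ s₃ → ∫ s in s₂..s₃, sqInt ws s ≤ B ∧
        ∫ s in s₂..s₃, powInt (p + 1) (sim b T' q (stm (mollSeq n k) u)) s ≤ B * (s₃ - s₂ + 1) := by
  obtain ⟨ta, hta, hta'⟩ : ∃ ta ∈ Set.Ioo 0 T, T - ta ≤ Real.exp (-s₀) :=
    ⟨max (T / 2) (T - Real.exp (-s₀)), ⟨lt_max_of_lt_left (by linarith),
      max_lt (by linarith) (by linarith [Real.exp_pos (-s₀)])⟩, by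
      linarith [le_max_right (T / 2) (T - Real.exp (-s₀))]⟩
  set tb := (ta + T) / 2 with htb
  have htab : ta < tb := by rw [htb]; linarith [hta.2]
  have htbT : tb < T := by rw [htb]; linarith [hta.2]
  obtain ⟨M, K, hM⟩ := hu ((tb + T) / 2) ⟨by linarith [hta.1], by linarith⟩
  obtain ⟨F, hF0, hF⟩ := exists_bound_Icc N.cont M
  have hMM : ∀ t ∈ Set.Icc ta tb, ∀ z, |u z t| ≤ M := fun t ht z =>
    hM.bdd z t ⟨hta.1.trans_le ht.1, by linarith [ht.2]⟩
  have hM0 : 0 ≤ M := (abs_nonneg _).trans (hMM ta ⟨le_rfl, htab.le⟩ 0)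
  obtain ⟨B, hB, hB'⟩ := N.exists_bounds (n := n) (M := max M (2 * F)) (le_max_of_le_left hM0)
  refine ⟨tb, ⟨hta.1.trans htab, htbT⟩, B, hB, fun T' hT' b => ?_⟩
  have hT'0 : 0 < T' := by linarith [hT'.1, hta.1]
  have htbT' : tb < T' := by linarith [hT'.1]
  obtain ⟨M', K', hM'⟩ := hu T' ⟨hT'0, hT'.2⟩
  have hsa : -Real.log T' < -Real.log (T' - ta) :=
    neg_lt_neg (Real.log_lt_log (by linarith) (by linarith [hta.1]))
  filter_upwards [hM'.eventually_err_le hT'0 N.hq b hsa] with k hk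
  obtain ⟨ws, wi, wii, wis, hS⟩ := hM'.simSol (q := q) hT'0 (moll_mollSeq (n := n) k) b N.hq
  have hmem : ∀ s ∈ Set.Icc (-Real.log (T' - ta)) (-Real.log (T' - tb)), T' - Real.exp (-s) ∈ Set.Icc ta tb :=
    fun s hs => by
      have e1 : Real.exp (-s) ≤ T' - ta := by
        rw [← Real.le_log_iff_exp_le (by linarith)]; linarith [hs.1]
      have e2 : T' - tb ≤ Real.exp (-s) := by
        rw [← Real.log_le_iff_le_exp (by linarith)]; linarith [hs.2]
      exact ⟨by linarith, by linarith⟩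
  have hs₀ : s₀ ≤ -Real.log (T' - ta) := by
    rw [le_neg, Real.log_le_iff_le_exp (by linarith)]
    linarith [hT'.2]
  refine ⟨ws, _, wi, wii, wis, hS, hB' _ _ _ _ _ _ _ hS _ _ hsa hs₀ ?_ ?_ ?_ hk⟩
  · rw [← sub_nonneg, show -Real.log (T' - tb) - (-Real.log (T' - ta) + Real.log 2) =
      Real.log (T' - ta) - (Real.log 2 + Real.log (T' - tb)) by ring,
      ← Real.log_mul two_ne_zero (by linarith), sub_nonneg]
    exact Real.log_le_log (by linarith) (by linarith [hT'.2])
  · intro y s hs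
    rw [exp_mul_sim]
    exact (abs_mollSeq_le (hMM _ (hmem s hs)) k _).trans (le_max_left _ _)
  · intro y s hs
    refine (abs_err_le (hMM _ (hmem s hs)) hF k y).trans (le_trans ?_ (le_max_right _ _))
    have : Real.exp (-(q + 1) * s) ≤ 1 := Real.exp_le_one_iff.2 (by nlinarith [N.hq, N.hs₀, hs.1])
    nlinarith

end Mollified

section Drift

variable {n : ℕ}

lemma sqrt_exp_div (s : ℝ) {k : ℝ} (hk : 0 < k) : √(Real.exp (-s) / k ^ 2) = Real.exp (-s / 2) * k⁻¹ := by
  rw [show Real.exp (-s) / k ^ 2 = (Real.exp (-s / 2) * k⁻¹) ^ 2 by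
    rw [mul_pow, ← Real.exp_nat_mul, inv_pow, div_eq_mul_inv]; congr 2; push_cast; ring]
  exact Real.sqrt_sq (by positivity)

lemma integral_sim_scaled (b : Eu n) (T q : ℝ) (V : Eu n → ℝ → ℝ) (s : ℝ) {k : ℝ} (hk : 0 < k) :
    ∫ z, sim b T q V (k⁻¹ • z) s * rho n z = Real.exp (-q * s) *
      heat (Real.exp (-s) / k ^ 2) (fun x => V x (T - Real.exp (-s))) b := by
  simp only [heat, sim, sqrt_exp_div s hk, ← integral_const_mul, smul_smul, mul_assoc]

lemma Good.comp_smul {S : Set ℝ} {G : Eu n → ℝ → ℝ} (h : Good S G) {k : ℝ} (hk : 1 ≤ k) :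
    Good S fun y s => G (k⁻¹ • y) s where
  growth := by
    obtain ⟨A, m, hA, h⟩ := h.growth
    refine ⟨A, m, hA, fun s hs y => (h s hs _).trans ?_⟩
    gcongr
    rw [norm_smul, Real.norm_of_nonneg (by positivity)]
    exact mul_le_of_le_one_left (norm_nonneg _) (inv_le_one_of_one_le₀ hk)
  cont := h.cont.comp (f := fun P : Eu n × ℝ => (k⁻¹ • P.1, P.2)) (by fun_prop) fun P hP => ⟨trivial, hP.2⟩

/-- Weighted means at a finer scale vary slowly when the dissipation is bounded. -/
theorem SimSol.abs_mean_sub_le {q σ₀ : ℝ} {f : ℝ → ℝ} {w ws ξ : Eu n → ℝ → ℝ} {wi wii wis : Fin n → Eu n → ℝ → ℝ}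
    (h : SimSol q f (Set.Ioi σ₀) w ws ξ wi wii wis) {s₁ s₂ B k β : ℝ} (h0 : σ₀ < s₁) (h12 : s₁ ≤ s₂)
    (hB : ∫ s in s₁..s₂, sqInt ws s ≤ B) (hk : 1 ≤ k) (hβ : 0 < β) :
    |(∫ z, w (k⁻¹ • z) s₂ * rho n z) - ∫ z, w (k⁻¹ • z) s₁ * rho n z| ≤
      β / 2 * k ^ n * B + 1 / (2 * β) * (s₂ - s₁) := by
  have hsub : Set.Icc s₁ s₂ ⊆ Set.Ioi σ₀ := fun s hs => h0.trans_le hs.1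
  have g1 := h.good_w.comp_smul hk
  have g2 := h.good_ws.comp_smul hk
  have hd : ∀ s ∈ Set.uIcc s₁ s₂, HasDerivAt (fun s => ∫ z, w (k⁻¹ • z) s * rho n z)
      (∫ z, ws (k⁻¹ • z) s * rho n z) s := fun s hs => by
    rw [Set.uIcc_of_le h12] at hs
    exact g1.hasDerivAt_integral isOpen_Ioi g2 (fun y => h.deriv_w _) (hsub hs)
  have hc := (g2.continuousOn_integral isOpen_Ioi).mono hsub
  rw [← intervalIntegral.integral_eq_sub_of_hasDerivAt hd (hc.intervalIntegrable_of_Icc h12)]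
  have hbd : ∀ s ∈ Set.Icc s₁ s₂, |∫ z, ws (k⁻¹ • z) s * rho n z| ≤
      β / 2 * k ^ n * sqInt ws s + 1 / (2 * β) := fun s hs => by
    have i2 := (g2.pow 2).integrable (hsub hs)
    have e1 := integral_scaled_mul_rho_le (g := fun y => ws y s ^ 2) (fun y => sq_nonneg _) hk
      ((h.good_ws.pow 2).integrable (hsub hs))
    calc |∫ z, ws (k⁻¹ • z) s * rho n z|
        ≤ ∫ z, (β / 2 * (ws (k⁻¹ • z) s ^ 2 * rho n z) + 1 / (2 * β) * rho n z) := by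
          refine norm_integral_le_of_norm_le (f := fun z => ws (k⁻¹ • z) s * rho n z) ((i2.const_mul _).add (integrable_rho.const_mul _))
            (.of_forall fun z => ?_)
          rw [norm_mul, Real.norm_of_nonneg (rho_pos z).le, ← mul_assoc, ← add_mul]
          refine mul_le_mul_of_nonneg_right ?_ (rho_pos z).le
          have := sq_nonneg (β * |ws (k⁻¹ • z) s| - 1)
          rw [Real.norm_eq_abs, ← sq_abs, show β / 2 * |ws (k⁻¹ • z) s| ^ 2 + 1 / (2 * β) =
            (β ^ 2 * |ws (k⁻¹ • z) s| ^ 2 + 1) / (2 * β) by field_simp, le_div_iff₀ (by positivity)]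
          linarith
      _ = β / 2 * (∫ z, ws (k⁻¹ • z) s ^ 2 * rho n z) + 1 / (2 * β) := by
          rw [integral_add (i2.const_mul _) (integrable_rho.const_mul _), integral_const_mul,
            integral_const_mul, integral_rho, mul_one]
      _ ≤ β / 2 * (k ^ n * sqInt ws s) + 1 / (2 * β) := by
          have : 0 ≤ β / 2 := by positivity
          gcongr
          exact e1
      _ = _ := by ring
  have ci : IntervalIntegrable (sqInt ws) volume s₁ s₂ :=
    (h.continuousOn_diss.mono hsub).intervalIntegrable_of_Icc h12
  calc _ ≤ ∫ s in s₁..s₂, |∫ z, ws (k⁻¹ • z) s * rho n z| := intervalIntegral.abs_integral_le_integral_abs h12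
    _ ≤ ∫ s in s₁..s₂, (β / 2 * k ^ n * sqInt ws s + 1 / (2 * β)) :=
        intervalIntegral.integral_mono_on h12 (hc.abs.intervalIntegrable_of_Icc h12)
          ((ci.const_mul _).add intervalIntegrable_const) hbd
    _ = β / 2 * k ^ n * (∫ s in s₁..s₂, sqInt ws s) + 1 / (2 * β) * (s₂ - s₁) := by
        rw [intervalIntegral.integral_add (ci.const_mul _) intervalIntegrable_const,
          intervalIntegral.integral_const_mul, intervalIntegral.integral_const, smul_eq_mul]
        ring
    _ ≤ _ := by gcongr

lemma rpow_le_integral_rpow {g : Eu n → ℝ} {M r m : ℝ} (hg : Continuous g) (hM : ∀ y, |g y| ≤ M)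
    (hr : 1 ≤ r) (hm : 0 < m) (h : m ≤ |∫ y, g y * rho n y|) : m ^ r ≤ ∫ y, |g y| ^ r * rho n y := by
  have i1 : Integrable fun y => |g y| * rho n y :=
    integrable_mul_rho_of_bdd (M := M) (fun y => by rw [abs_abs]; exact hM y) hg.abs.aestronglyMeasurable
  have i2 : Integrable fun y => |g y| ^ r * rho n y :=
    integrable_mul_rho_of_bdd (M := M ^ r) (fun y => by
      rw [abs_of_nonneg (by positivity)]
      exact Real.rpow_le_rpow (abs_nonneg _) (hM y) (by linarith))
      (hg.abs.rpow_const fun _ => .inr (by linarith)).aestronglyMeasurable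
  have h1 : m ≤ ∫ y, |g y| * rho n y := by
    refine h.trans (norm_integral_le_of_norm_le (f := fun y => g y * rho n y) i1 (.of_forall fun y => ?_))
    rw [norm_mul, Real.norm_of_nonneg (rho_pos y).le, Real.norm_eq_abs]
  have h2 : ∀ y, m ^ r * (1 - r) + m ^ r * r / m * |g y| ≤ |g y| ^ r := fun y => by
    have e := one_add_mul_self_le_rpow_one_add (s := |g y| / m - 1) (by
      have : 0 ≤ |g y| / m := by positivity
      linarith) hr
    rw [add_sub_cancel, Real.div_rpow (abs_nonneg _) hm.le, le_div_iff₀ (by positivity)] at e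
    calc _ = (1 + r * (|g y| / m - 1)) * m ^ r := by field_simp; ring
      _ ≤ _ := e
  calc m ^ r = m ^ r * (1 - r) + m ^ r * r / m * m := by field_simp; ring
    _ ≤ m ^ r * (1 - r) + m ^ r * r / m * ∫ y, |g y| * rho n y := by
        have : 0 ≤ m ^ r * r / m := by positivity
        gcongr
    _ = ∫ y, (m ^ r * (1 - r) * rho n y + m ^ r * r / m * (|g y| * rho n y)) := by
        rw [integral_add (integrable_rho.const_mul _) (i1.const_mul _), integral_const_mul,
          integral_const_mul, integral_rho, mul_one]
    _ ≤ _ := by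
        refine integral_mono ((integrable_rho.const_mul _).add (i1.const_mul _)) i2 fun y => ?_
        simp only [← mul_assoc, ← add_mul]
        exact mul_le_mul_of_nonneg_right (h2 y) (rho_pos y).le

lemma le_powInt_sim {b : Eu n} {T q r s h L m M : ℝ} {V : Eu n → ℝ → ℝ}
    (hV : Continuous fun x => V x (T - Real.exp (-s))) (hM : ∀ x, |V x (T - Real.exp (-s))| ≤ M)
    (hr : 1 ≤ r) (hm : 0 < m) (hh : 0 < h) (hs : h ≤ Real.exp (-s)) (hL : Real.exp (-s) ≤ L * h)
    (hmean : m ≤ |heat h (fun x => V x (T - Real.exp (-s))) b|) :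
    Real.exp (-(q * r) * s) * L ^ (-(n : ℝ) / 2) * m ^ r ≤ powInt r (sim b T q V) s := by
  set φ : Eu n → ℝ := fun x => V x (T - Real.exp (-s)) with hφ
  set k := √(Real.exp (-s) / h) with hk
  have hk2 : k ^ 2 = Real.exp (-s) / h := Real.sq_sqrt (by positivity)
  have hk1 : 1 ≤ k := by rw [hk, Real.one_le_sqrt, one_le_div hh]; exact hs
  have hk0 : 0 < k := by linarith
  have hh' : h = Real.exp (-s) / k ^ 2 := by rw [hk2]; field_simp
  have hL0 : 0 < L := by
    by_contra hcon
    push Not at hcon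
    nlinarith [Real.exp_pos (-s)]
  have hkL : k ^ n ≤ L ^ ((n : ℝ) / 2) := by
    rw [← Real.rpow_natCast, show (n : ℝ) = 2 * (n / 2) by ring, Real.rpow_mul hk0.le, Real.rpow_two, hk2,
      show 2 * ((n : ℝ) / 2) / 2 = n / 2 by ring]
    exact Real.rpow_le_rpow (by positivity) (by rwa [div_le_iff₀ hh]) (by positivity)
  have e1 : m ^ r ≤ ∫ z, |φ (b + √h • z)| ^ r * rho n z :=
    rpow_le_integral_rpow (g := fun z => φ (b + √h • z)) (hV.comp (by fun_prop)) (fun y => hM _) hr hm hmean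
  have hc : Continuous fun y : Eu n => φ (b + Real.exp (-s / 2) • y) := hV.comp (by fun_prop)
  have i2 : Integrable fun y => |φ (b + Real.exp (-s / 2) • y)| ^ r * rho n y :=
    integrable_mul_rho_of_bdd (M := M ^ r) (fun y => by
      rw [abs_of_nonneg (by positivity)]
      exact Real.rpow_le_rpow (abs_nonneg _) (hM _) (by linarith))
      (hc.abs.rpow_const fun _ => .inr (by linarith)).aestronglyMeasurable
  have e2 := integral_scaled_mul_rho_le (g := fun y => |φ (b + Real.exp (-s / 2) • y)| ^ r)
    (fun y => by positivity) hk1 i2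
  have e3 : ∀ z : Eu n, b + Real.exp (-s / 2) • (k⁻¹ • z) = b + √h • z := fun z => by
    rw [hh', sqrt_exp_div s hk0, smul_smul]
  simp only [e3] at e2
  have e4 : powInt r (sim b T q V) s = Real.exp (-(q * r) * s) *
      ∫ y, |φ (b + Real.exp (-s / 2) • y)| ^ r * rho n y := by
    rw [powInt, ← integral_const_mul]
    refine integral_congr_ae (.of_forall fun y => ?_)
    simp only [sim]
    rw [abs_mul, Real.abs_exp, Real.mul_rpow (Real.exp_pos _).le (abs_nonneg _), ← Real.exp_mul, mul_assoc]
    congr 2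
    ring
  have e5 : 0 ≤ ∫ y, |φ (b + Real.exp (-s / 2) • y)| ^ r * rho n y :=
    integral_nonneg fun y => mul_nonneg (by positivity) (rho_pos y).le
  rw [e4, mul_assoc]
  refine mul_le_mul_of_nonneg_left ?_ (Real.exp_pos _).le
  rw [neg_div, Real.rpow_neg hL0.le, inv_mul_le_iff₀ (by positivity)]
  exact (e1.trans e2).trans (mul_le_mul_of_nonneg_right hkL e5)

end Drift

section Rate

variable {n : ℕ}

lemma exists_rate_params (n : ℕ) {B q c₀ A : ℝ} (hc₀ : 0 < c₀) (hn : (n : ℝ) < 4 * q + 2)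
    (hB : 0 ≤ B) (hA : 0 < A) : ∃ σ r β, 2 * c₀ ≤ σ ∧ σ ≤ r ∧ 0 < β ∧
      8 * B ≤ σ ^ (2 * q + 1) * (2 * σ / c₀) ^ (-(n : ℝ) / 2) * A ∧
      β / 2 * √((r + c₀) / c₀) ^ n * B + 1 / (2 * β) * (σ / r) ≤ r ^ q / 8 := by
  obtain ⟨σ, hσ1, hσ⟩ : ∃ σ, 2 * c₀ ≤ σ ∧ 8 * B / ((2 / c₀) ^ (-(n : ℝ) / 2) * A) ≤ σ ^ (2 * q + 1 - n / 2) :=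
    ((eventually_ge_atTop _).and ((tendsto_rpow_atTop (by linarith)).eventually_ge_atTop _)).exists
  have hσ0 : 0 < σ := by linarith
  set C₁ := 1 / 2 * √(2 / c₀) ^ n * B with hC₁
  obtain ⟨r, hr1, hr⟩ : ∃ r, σ ≤ r ∧ 8 * (C₁ + σ / 2) ≤ r ^ (q - (n - 2) / 4) :=
    ((eventually_ge_atTop _).and ((tendsto_rpow_atTop (by linarith)).eventually_ge_atTop _)).exists
  have hr0 : 0 < r := by linarith
  refine ⟨σ, r, r ^ (-((n : ℝ) + 2) / 4), hσ1, hr1, by positivity, ?_, ?_⟩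
  · rw [div_le_iff₀ (by positivity)] at hσ
    refine hσ.trans_eq ?_
    rw [mul_div_right_comm 2 σ c₀, Real.mul_rpow (by positivity) hσ0.le,
      show 2 * q + 1 - (n : ℝ) / 2 = (2 * q + 1) + -(n : ℝ) / 2 by ring, Real.rpow_add hσ0]
    ring
  · have e1 : √((r + c₀) / c₀) ^ n ≤ √(2 / c₀) ^ n * r ^ ((n : ℝ) / 2) := by
      have : r ^ ((n : ℝ) / 2) = √r ^ n := by
        rw [Real.sqrt_eq_rpow, ← Real.rpow_natCast, ← Real.rpow_mul hr0.le]; congr 1; ring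
      rw [this, ← mul_pow, ← Real.sqrt_mul (by positivity)]
      gcongr
      rw [div_mul_eq_mul_div]
      gcongr
      linarith
    have e2 : r ^ (-((n : ℝ) + 2) / 4) * r ^ ((n : ℝ) / 2) = r ^ (((n : ℝ) - 2) / 4) := by
      rw [← Real.rpow_add hr0]; congr 1; ring
    have e3 : 1 / (2 * r ^ (-((n : ℝ) + 2) / 4)) * (σ / r) = σ / 2 * r ^ (((n : ℝ) - 2) / 4) := by
      rw [show ((n : ℝ) - 2) / 4 = -(-((n : ℝ) + 2) / 4) - 1 by ring, Real.rpow_sub hr0, Real.rpow_neg hr0.le,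
        Real.rpow_one]
      field_simp
    have e4 : r ^ q = r ^ (q - ((n : ℝ) - 2) / 4) * r ^ (((n : ℝ) - 2) / 4) := by
      rw [← Real.rpow_add hr0]; congr 1; ring
    calc _ ≤ r ^ (-((n : ℝ) + 2) / 4) / 2 * (√(2 / c₀) ^ n * r ^ ((n : ℝ) / 2)) * B +
          σ / 2 * r ^ (((n : ℝ) - 2) / 4) := by rw [e3]; gcongr
      _ = (C₁ + σ / 2) * r ^ (((n : ℝ) - 2) / 4) := by rw [← e2]; ring
      _ ≤ (r ^ (q - ((n : ℝ) - 2) / 4) / 8) * r ^ (((n : ℝ) - 2) / 4) := by gcongr; linarith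
      _ = _ := by rw [e4]; ring

variable {f : ℝ → ℝ} {u : Eu n → ℝ → ℝ} {τ M K p q K₀ : ℝ}

lemma IsSol.half_le_abs_heat (h : IsSol f u τ M K) (hK₀ : 0 < K₀) (hp : 1 < p) (hK : ∀ z, |f z| ≤ K₀ * |z| ^ p)
    {x₀ : Eu n} {t₀ h₁ : ℝ} (ht₀ : t₀ < τ) (h₁pos : 0 < h₁) (ht : h₁ < t₀)
    (hh : K₀ * 2 ^ p * h₁ ≤ 1 / 2 * |u x₀ t₀| ^ (1 - p)) (hN : 0 < |u x₀ t₀|)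
    (hle : ∀ x, ∀ t ∈ Set.Ioc 0 t₀, |u x t| ≤ 2 * |u x₀ t₀|) :
    |u x₀ t₀| / 2 ≤ |heat h₁ (fun x => u x (t₀ - h₁)) x₀| := by
  set N := |u x₀ t₀| with hNdef
  have h1 := h.abs_sub_heat_le x₀ (t := t₀ - h₁) (ε := h₁) (K' := K₀ * (2 * N) ^ p) (by linarith) h₁pos (by linarith)
    fun x s hs => (hK _).trans (by
      gcongr
      exact hle x s ⟨by linarith [hs.1], by linarith [hs.2]⟩)
  rw [sub_add_cancel] at h1
  have h2 : K₀ * (2 * N) ^ p * h₁ ≤ N / 2 := by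
    rw [Real.mul_rpow zero_le_two hN.le]
    calc _ = K₀ * 2 ^ p * h₁ * N ^ p := by ring
      _ ≤ 1 / 2 * N ^ (1 - p) * N ^ p := by gcongr
      _ = N / 2 := by rw [mul_assoc, ← Real.rpow_add hN]; simp; ring
  have h3 := abs_sub_abs_le_abs_sub (u x₀ t₀) (heat h₁ (fun x => u x (t₀ - h₁)) x₀)
  linarith

lemma IsSol.eventually_quarter_le (h : IsSol f u τ M K) {t h₁ m : ℝ} (ht : t ∈ Set.Ioo 0 τ) {x₀ : Eu n}
    (hm : 0 < m) (hle : m / 2 ≤ |heat h₁ (fun x => u x t) x₀|) :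
    ∀ᶠ k in atTop, m / 4 ≤ |heat h₁ (fun x => stm (mollSeq n k) u x t) x₀| := by
  have hc := (h.c2 t ht).continuous
  have hM : ∀ x, |u x t| ≤ M := fun x => h.bdd x t ht
  have hc' : Continuous (heat h₁ fun x => u x t) :=
    (continuous_heat hc hM).comp (f := fun x => (x, h₁)) (by fun_prop)
  filter_upwards [(tendsto_mollSeq hc' x₀).abs.eventually_const_le (show m / 4 < _ by linarith)] with k hk
  rwa [(moll_mollSeq k).moll_heat hc hM] at hk

set_option maxHeartbeats 2000000 in
/-- Away from the blow-up time, a near-maximal value of `u` occurs only at small parabolic distance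
from the final time. -/
theorem exists_rate {a c C C' s₀ T : ℝ} (Nl : Nonlin f p q a c C C' s₀) (hT : 0 < T) (hqp : (1 - p) * q = -1)
    (hn : (n : ℝ) < 4 * q + 2) (hK₀ : 0 < K₀) (hK : ∀ z, |f z| ≤ K₀ * |z| ^ p)
    (hu : ∀ τ ∈ Set.Ioo 0 T, ∃ M K, IsSol f u τ M K) :
    ∃ r N₀, 0 < r ∧ 0 < N₀ ∧ ∀ x₀, ∀ t₀ ∈ Set.Ioo 0 T, N₀ ≤ |u x₀ t₀| →
      (∀ x, ∀ t ∈ Set.Ioc 0 t₀, |u x t| ≤ 2 * |u x₀ t₀|) → T - t₀ ≤ r * |u x₀ t₀| ^ (1 - p) := by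
  have hp := Nl.hp
  have hq := Nl.hq
  obtain ⟨tb, htb, B, hB, hbounds⟩ := Nl.exists_uniform_bounds hT hu
  set c₀ := 1 / (2 * K₀ * 2 ^ p) with hc₀
  have hc₀0 : 0 < c₀ := by positivity
  set c₂ : ℝ := 1 / (8 * 2 ^ q) with hc₂
  have hc₂0 : 0 < c₂ := by positivity
  obtain ⟨σ, r, β, hσ, hσr, hβ, hpar1, hpar2⟩ := exists_rate_params n (A := c₂ ^ (p + 1)) hc₀0 hn hB.le
    (by positivity)
  have hσ0 : 0 < σ := by linarith
  have hr0 : 0 < r := by linarith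
  obtain ⟨M, K, hM⟩ := hu ((tb + T) / 2) ⟨by linarith [htb.1, htb.2], by linarith [htb.2]⟩
  obtain ⟨N₁, hN₁⟩ : ∃ N₁, ∀ N ≥ N₁, σ * N ^ (1 - p) ≤ (T - tb) / 2 := by
    have := (tendsto_rpow_neg_atTop (y := p - 1) (by linarith)).const_mul σ
    rw [mul_zero, neg_sub] at this
    exact eventually_atTop.1 (this.eventually_le_const (by linarith [htb.2]))
  refine ⟨r, max 1 (max (M + 1) N₁), hr0, by positivity, fun x₀ t₀ ht₀ hN₀ hle => ?_⟩
  set N := |u x₀ t₀| with hN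
  have hNM : M + 1 ≤ N := ((le_max_left _ _).trans (le_max_right _ _)).trans hN₀
  have hN0 : 0 < N := by linarith [(le_max_left 1 (max (M + 1) N₁)).trans hN₀]
  set l := N ^ (1 - p) with hl
  have hl0 : 0 < l := by positivity
  have hσl : σ * l ≤ (T - tb) / 2 := hN₁ N (((le_max_right _ _).trans (le_max_right _ _)).trans hN₀)
  by_contra hcon
  push Not at hcon
  have ht₀' : (tb + T) / 2 ≤ t₀ := by
    by_contra h1
    push Not at h1
    linarith [hM.bdd x₀ t₀ ⟨ht₀.1, h1⟩]
  have hlq : l ^ q = N⁻¹ := by rw [hl, ← Real.rpow_mul hN0.le, hqp, Real.rpow_neg_one]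
  have hlq2 : l ^ (2 * q + 1) = (N ^ (p + 1))⁻¹ := by
    rw [← Nl.hpq, hl, ← Real.rpow_mul hN0.le, ← Real.rpow_neg hN0.le]
    congr 1
    linear_combination (p + 1) * hqp
  have hrl : 0 < r * l := by positivity
  have hσl0 : 0 < σ * l := by positivity
  have hcl : 0 < c₀ * l := by positivity
  have hcσ : c₀ * l < σ * l := by gcongr; linarith
  have hσrl : σ * l ≤ r * l := by gcongr
  have hT' : t₀ + r * l ∈ Set.Ioo ((tb + T) / 2) T := ⟨by linarith, by linarith⟩
  have hT'' : t₀ + σ * l ∈ Set.Ioo ((tb + T) / 2) T := ⟨by linarith, by linarith⟩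
  have htb0 := htb.1
  obtain ⟨M', K', hM'⟩ := hu (t₀ + r * l) ⟨by linarith, hT'.2⟩
  have hstart : N / 2 ≤ |heat (c₀ * l) (fun x => u x (t₀ - c₀ * l)) x₀| :=
    hM'.half_le_abs_heat hK₀ hp hK (by linarith) hcl (by linarith) (by rw [hc₀]; field_simp; rfl) hN0 hle
  obtain ⟨k, ⟨ws, ξ, wi, wii, wis, hS, hbd⟩, ⟨ws₂, ξ₂, wi₂, wii₂, wis₂, hS₂, hbd₂⟩, hk⟩ :=
    ((hbounds _ hT' x₀).and ((hbounds _ hT'' x₀).and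
      (hM'.eventually_quarter_le (t := t₀ - c₀ * l) ⟨by linarith, by linarith⟩ hN0 hstart))).exists
  set V := stm (mollSeq n k) u with hV
  set κ := √((r + c₀) / c₀) with hκ
  have hκ2 : κ ^ 2 = (r + c₀) / c₀ := Real.sq_sqrt (by positivity)
  have hκ1 : 1 ≤ κ := by rw [hκ, Real.one_le_sqrt, one_le_div hc₀0]; linarith
  have hκ0 : 0 < κ := by linarith
  have hmean : ∀ t ∈ Set.Icc (t₀ - σ * l) (t₀ - c₀ * l),
      c₂ * N ≤ |heat ((t₀ + r * l - t) / κ ^ 2) (fun x => V x t) x₀| := fun t ht => by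
    have p1 : 0 < t₀ + r * l - t := by linarith [ht.2]
    have p2 : 0 < t₀ + r * l - (t₀ - c₀ * l) := by linarith
    have hs12 : -Real.log (t₀ + r * l - t) ≤ -Real.log (t₀ + r * l - (t₀ - c₀ * l)) :=
      neg_le_neg (Real.log_le_log p2 (by linarith [ht.2]))
    have hs0 : -Real.log (t₀ + r * l - tb) ≤ -Real.log (t₀ + r * l - t) :=
      neg_le_neg (Real.log_le_log p1 (by linarith [ht.1]))
    have hs00 : -Real.log (t₀ + r * l) < -Real.log (t₀ + r * l - t) :=
      neg_lt_neg (Real.log_lt_log p1 (by linarith [ht.1]))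
    have e1 := hS.abs_mean_sub_le hs00 hs12 (hbd _ _ hs0 hs12).1 hκ1 hβ
    rw [integral_sim_scaled _ _ _ _ _ hκ0, integral_sim_scaled _ _ _ _ _ hκ0] at e1
    have ex : ∀ x, 0 < x → Real.exp (-q * -Real.log x) = x ^ q := fun x hx => by
      rw [Real.rpow_def_of_pos hx]; congr 1; ring
    rw [ex _ p1, ex _ p2, neg_neg, neg_neg, Real.exp_log p1, Real.exp_log p2, sub_sub_cancel, sub_sub_cancel] at e1
    have e2 : (t₀ + r * l - (t₀ - c₀ * l)) / κ ^ 2 = c₀ * l := by rw [hκ2]; field_simp; ring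
    rw [e2] at e1
    have e3 : -Real.log (t₀ + r * l - (t₀ - c₀ * l)) - -Real.log (t₀ + r * l - t) ≤ σ / r := by
      rw [neg_sub_neg, ← Real.log_div p1.ne' p2.ne']
      refine (Real.log_le_sub_one_of_pos (by positivity)).trans ?_
      rw [div_sub_one p2.ne', div_le_div_iff₀ p2 hr0]
      nlinarith [ht.1]
    have e4 : β / 2 * κ ^ n * B + 1 / (2 * β) *
        (-Real.log (t₀ + r * l - (t₀ - c₀ * l)) - -Real.log (t₀ + r * l - t)) ≤ r ^ q / 8 :=
      le_trans (by gcongr) hpar2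
    have e5 := (abs_sub_abs_le_abs_sub _ _).trans (e1.trans e4)
    rw [abs_mul, abs_mul, abs_of_nonneg (Real.rpow_nonneg p2.le q),
      abs_of_nonneg (Real.rpow_nonneg p1.le q)] at e5
    have e6 : r ^ q * N⁻¹ ≤ (t₀ + r * l - (t₀ - c₀ * l)) ^ q := by
      rw [← hlq, ← Real.mul_rpow hr0.le hl0.le]
      exact Real.rpow_le_rpow hrl.le (by linarith) hq.le
    have e7 : (t₀ + r * l - t) ^ q ≤ 2 ^ q * r ^ q * N⁻¹ := by
      rw [← hlq, ← Real.mul_rpow zero_le_two hr0.le, ← Real.mul_rpow (by positivity) hl0.le]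
      exact Real.rpow_le_rpow p1.le (by linarith [ht.1]) hq.le
    have e8 : r ^ q / 4 ≤ (t₀ + r * l - (t₀ - c₀ * l)) ^ q * |heat (c₀ * l) (fun x => V x (t₀ - c₀ * l)) x₀| :=
      calc r ^ q / 4 = r ^ q * N⁻¹ * (N / 4) := by field_simp
        _ ≤ _ := by gcongr
    have e9 : r ^ q / 8 ≤ 2 ^ q * r ^ q * N⁻¹ * |heat ((t₀ + r * l - t) / κ ^ 2) (fun x => V x t) x₀| := by
      refine le_trans ?_ (mul_le_mul_of_nonneg_right e7 (abs_nonneg _))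
      linarith
    have hrq : 0 < r ^ q := by positivity
    have h2q : (0:ℝ) < 2 ^ q := by positivity
    rw [hc₂, div_mul_eq_mul_div, one_mul, div_le_iff₀ (by positivity)]
    rw [← mul_le_mul_iff_of_pos_left hrq]
    rw [show 2 ^ q * r ^ q * N⁻¹ * |heat ((t₀ + r * l - t) / κ ^ 2) (fun x => V x t) x₀| =
      (2 ^ q * r ^ q * |heat ((t₀ + r * l - t) / κ ^ 2) (fun x => V x t) x₀|) / N by ring,
      le_div_iff₀ hN0] at e9
    linarith
  have q1 : 0 < t₀ + σ * l - (t₀ - σ * l) := by linarith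
  have q2 : 0 < t₀ + σ * l - (t₀ - c₀ * l) := by linarith
  set sA := -Real.log (t₀ + σ * l - (t₀ - σ * l)) with hsA
  set sB := -Real.log (t₀ + σ * l - (t₀ - c₀ * l)) with hsB
  have hAB : 1 / 4 ≤ sB - sA := by
    rw [hsA, hsB, neg_sub_neg, ← Real.log_div q1.ne' q2.ne']
    refine le_trans ?_ (Real.one_sub_inv_le_log_of_pos (by positivity))
    rw [inv_div, le_sub_comm, div_le_iff₀ q1]
    nlinarith
  have hsA0 : -Real.log (t₀ + σ * l - tb) ≤ sA := neg_le_neg (Real.log_le_log q1 (by linarith))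
  have hsA1 : -Real.log (t₀ + σ * l) < sA := neg_lt_neg (Real.log_lt_log q1 (by linarith))
  have hlow : ∀ s ∈ Set.Icc sA sB, 8 * B ≤ powInt (p + 1) (sim x₀ (t₀ + σ * l) q V) s := fun s hs => by
    have b1 : Real.exp (-s) ≤ t₀ + σ * l - (t₀ - σ * l) := by
      rw [← Real.le_log_iff_exp_le q1]; linarith [hs.1]
    have b2 : t₀ + σ * l - (t₀ - c₀ * l) ≤ Real.exp (-s) := by
      rw [← Real.log_le_iff_le_exp q2]; linarith [hs.2]
    set t := t₀ + σ * l - Real.exp (-s) with ht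
    have htI : t ∈ Set.Icc (t₀ - σ * l) (t₀ - c₀ * l) := ⟨by linarith, by linarith⟩
    have ht' : t ∈ Set.Ioo 0 (t₀ + r * l) := ⟨by linarith [htI.1], by linarith [htI.2]⟩
    have es : Real.exp (-s) = t₀ + σ * l - t := by rw [ht]; ring
    have hVc : Continuous fun x => V x t :=
      ((moll_mollSeq k).differentiable (hM'.c2 t ht').continuous).continuous
    have key := le_powInt_sim (b := x₀) (T := t₀ + σ * l) (q := q) (r := p + 1) (s := s) (V := V) (M := M')
      (h := (t₀ + r * l - t) / κ ^ 2) (L := 2 * σ / c₀) (m := c₂ * N) hVc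
      (fun x => abs_mollSeq_le (fun z => hM'.bdd z t ht') k x) (by linarith) (by positivity)
      (div_pos (by linarith [htI.2]) (by positivity))
      (by
        rw [hκ2, es, div_div_eq_mul_div, div_le_iff₀ (by positivity)]
        nlinarith [htI.1, htI.2, mul_pos hσ0 hl0, mul_le_mul_of_nonneg_left htI.2 hr0.le,
          mul_le_mul_of_nonneg_left hcσ.le hr0.le])
      (by
        clear_value c₀
        rw [hκ2, es, show 2 * σ / c₀ * ((t₀ + r * l - t) / ((r + c₀) / c₀)) =
          2 * σ * (t₀ + r * l - t) / (r + c₀) by field_simp, le_div_iff₀ (by positivity)]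
        have z1 : (r + c₀) * l ≤ t₀ + r * l - t := by linarith [htI.2]
        have z2 : (t₀ + σ * l - t) * (r + c₀) ≤ (2 * (σ * l)) * (r + c₀) := by
          gcongr; linarith [htI.1]
        have z3 := mul_le_mul_of_nonneg_left z1 (by positivity : 0 ≤ 2 * σ)
        linarith)
      (hmean t htI)
    refine le_trans ?_ key
    have d1 : (σ * l) ^ (2 * q + 1) ≤ Real.exp (-(q * (p + 1)) * s) := by
      rw [mul_comm q, Nl.hpq, show -(2 * q + 1) * s = -s * (2 * q + 1) by ring, Real.exp_mul]
      exact Real.rpow_le_rpow hσl0.le (by linarith) (by positivity)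
    have d2 : σ ^ (2 * q + 1) * (2 * σ / c₀) ^ (-(n : ℝ) / 2) * c₂ ^ (p + 1) =
        (σ * l) ^ (2 * q + 1) * (2 * σ / c₀) ^ (-(n : ℝ) / 2) * (c₂ * N) ^ (p + 1) := by
      rw [Real.mul_rpow hσ0.le hl0.le, Real.mul_rpow hc₂0.le hN0.le, hlq2]
      have : 0 < N ^ (p + 1) := by positivity
      field_simp
    refine (hpar1.trans_eq d2).trans ?_
    gcongr
  have hup := (hbd₂ sA sB hsA0 (by linarith)).2
  have h_integ : IntervalIntegrable (powInt (p + 1) (sim x₀ (t₀ + σ * l) q V)) volume sA sB :=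
    ((hS₂.continuousOn_powInt Nl).mono fun s hs => hsA1.trans_le hs.1).intervalIntegrable_of_Icc (by linarith)
  have hlo := intervalIntegral.integral_mono_on (by linarith : sA ≤ sB) intervalIntegrable_const h_integ hlow
  rw [intervalIntegral.integral_const, smul_eq_mul] at hlo
  nlinarith

end Rate

section MainEstimate

variable {n : ℕ} {p a μ T : ℝ} {u : Eu n → ℝ → ℝ}

lemma SolvesU.exists_isSol (hu : SolvesU n p a μ T u) (hp : 1 < p) {τ : ℝ} (hτ : τ ∈ Set.Ioo 0 T) :
    ∃ M K, IsSol (nl p a μ) u τ M K := by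
  obtain ⟨h1, h2, h3, h4, -⟩ := hu
  obtain ⟨M, hM⟩ := h4 τ ⟨hτ.1.le, hτ.2⟩
  obtain ⟨K, -, hK⟩ := exists_bound_Icc (continuous_nl (a := a) (μ := μ) hp) M
  have hM' : ∀ x, ∀ t ∈ Set.Ioo 0 τ, |u x t| ≤ M := fun x t ht => hM x t ⟨ht.1.le, ht.2.le⟩
  have hmem : ∀ t ∈ Set.Ioo 0 τ, t ∈ Set.Ico 0 T := fun t ht => ⟨ht.1.le, ht.2.trans hτ.2⟩
  refine ⟨M, K, continuous_nl hp, fun t ht => h1 t (hmem t ht), fun x t ht => ?_, hM',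
    fun x t ht => hK _ (hM' x t ht)⟩
  have := (h2 x t (hmem t ht)).hasDerivAt
  rwa [h3 x t (hmem t ht), add_assoc] at this

lemma lt_of_subcritical (hp : 1 < p) (hpS : 3 ≤ n → p < ((n : ℝ) + 2) / ((n : ℝ) - 2)) :
    (n : ℝ) < 4 * (1 / (p - 1)) + 2 := by
  have hp1 : 0 < p - 1 := by linarith
  rw [← sub_lt_iff_lt_add, mul_one_div, lt_div_iff₀ hp1]
  rcases le_or_gt 3 n with h | h
  · have h3 : (3 : ℝ) ≤ n := by exact_mod_cast h
    have := hpS h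
    rw [lt_div_iff₀ (by linarith)] at this
    linarith
  · have h3 : (n : ℝ) ≤ 2 := by exact_mod_cast Nat.lt_succ_iff.1 h
    nlinarith

/-- The blow-up rate estimate on the whole lifespan. -/
theorem SolvesU.exists_abs_le (hu : SolvesU n p a μ T u) (hp : 1 < p) (ha : 0 < a) (hT : 0 < T)
    (hpS : 3 ≤ n → p < ((n : ℝ) + 2) / ((n : ℝ) - 2)) :
    ∃ C > 0, ∀ t ∈ Set.Ico 0 T, ∀ x, |u x t| ≤ C * (T - t) ^ (-(1 / (p - 1))) := by
  obtain ⟨c, C, C', s₀, Nl⟩ := exists_nonlin (μ := μ) hp ha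
  obtain ⟨K₀, hK₀, hK⟩ := abs_nl_le (μ := μ) hp ha
  have hp1 : 0 < p - 1 := by linarith
  have hqp : (1 - p) * (1 / (p - 1)) = -1 := by field_simp; ring
  obtain ⟨r, N₀, hr, hN₀, hrate⟩ := exists_rate Nl hT hqp (lt_of_subcritical hp hpS) hK₀ hK
    fun τ hτ => hu.exists_isSol hp hτ
  obtain ⟨M₀, hM₀⟩ := hu.2.2.2.1 0 ⟨le_rfl, hT⟩
  set q := 1 / (p - 1) with hq
  have hq0 : 0 < q := by positivity
  set L := 2 * max N₀ (M₀ + 1) with hL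
  have hL0 : 0 < L := by positivity
  refine ⟨max (L * T ^ q) (2 * r ^ q), by positivity, fun t₁ ht₁ x₁ => ?_⟩
  have hTt : 0 < T - t₁ := by linarith [ht₁.2]
  obtain ⟨M, hM⟩ := hu.2.2.2.1 t₁ ht₁
  set S := (fun z : Eu n × ℝ => |u z.1 z.2|) '' (Set.univ ×ˢ Set.Icc 0 t₁) with hS
  have hbdd : BddAbove S := ⟨M, by rintro _ ⟨z, hz, rfl⟩; exact hM _ _ hz.2⟩
  have hle : ∀ x, ∀ t ∈ Set.Icc 0 t₁, |u x t| ≤ sSup S := fun x t ht =>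
    le_csSup hbdd ⟨(x, t), ⟨Set.mem_univ _, ht⟩, rfl⟩
  have h1 : |u x₁ t₁| ≤ sSup S := hle x₁ t₁ ⟨ht₁.1, le_rfl⟩
  rcases le_or_gt (sSup S) L with hSL | hSL
  · have h2 : 1 ≤ T ^ q * (T - t₁) ^ (-q) := by
      rw [Real.rpow_neg hTt.le, ← div_eq_mul_inv, one_le_div (by positivity)]
      exact Real.rpow_le_rpow hTt.le (by linarith [ht₁.1]) hq0.le
    calc |u x₁ t₁| ≤ L * 1 := by linarith
      _ ≤ L * (T ^ q * (T - t₁) ^ (-q)) := by gcongr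
      _ = L * T ^ q * (T - t₁) ^ (-q) := by ring
      _ ≤ _ := by gcongr; exact le_max_left _ _
  · obtain ⟨_, ⟨⟨x, t⟩, ⟨-, ht⟩, rfl⟩, hxt⟩ := exists_lt_of_lt_csSup
      (⟨_, (x₁, t₁), ⟨Set.mem_univ _, ht₁.1, le_rfl⟩, rfl⟩ : S.Nonempty) (half_lt_self (hL0.trans hSL))
    simp only at hxt ht
    have hN : N₀ ≤ |u x t| := by linarith [le_max_left N₀ (M₀ + 1)]
    have ht0 : 0 < t := by
      refine lt_of_le_of_ne ht.1 fun h0 => ?_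
      subst h0
      linarith [hM₀ x 0 ⟨le_rfl, le_rfl⟩, le_max_right N₀ (M₀ + 1)]
    have hN0 : 0 < |u x t| := hN₀.trans_le hN
    have h3 := hrate x t ⟨ht0, by linarith [ht.2, ht₁.2]⟩ hN fun y s hs =>
      (hle y s ⟨hs.1.le, hs.2.trans ht.2⟩).trans (by linarith)
    have h4 : (T - t₁) ^ q ≤ r ^ q * |u x t|⁻¹ := by
      rw [← Real.rpow_neg_one, ← hqp, Real.rpow_mul hN0.le, ← Real.mul_rpow hr.le (by positivity)]
      exact Real.rpow_le_rpow hTt.le (by linarith [ht.2]) hq0.le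
    have h5 : |u x t| ≤ r ^ q * (T - t₁) ^ (-q) := by
      rw [Real.rpow_neg hTt.le, ← div_eq_mul_inv, le_div_iff₀ (by positivity)]
      rwa [← div_eq_mul_inv, le_div_iff₀' hN0] at h4
    calc |u x₁ t₁| ≤ 2 * (r ^ q * (T - t₁) ^ (-q)) := by linarith
      _ = 2 * r ^ q * (T - t₁) ^ (-q) := by ring
      _ ≤ _ := by gcongr; exact le_max_right _ _

lemma abs_wSelf_le {C : ℝ} (hT : 0 < T)
    (h : ∀ t ∈ Set.Ico 0 T, ∀ x, |u x t| ≤ C * (T - t) ^ (-(1 / (p - 1)))) (b y : Eu n) {s : ℝ}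
    (hs : -Real.log T ≤ s) : |wSelf n p T u b y s| ≤ C := by
  have hsT : Real.exp (-s) ≤ T := by
    rw [← Real.le_log_iff_exp_le hT]; linarith
  have h1 := h (T - Real.exp (-s)) ⟨by linarith, by linarith [Real.exp_pos (-s)]⟩
    (b + Real.exp (-s / 2) • y)
  rw [sub_sub_cancel, ← Real.exp_mul] at h1
  rw [wSelf, abs_mul, abs_of_pos (Real.exp_pos _)]
  calc _ ≤ Real.exp (-s / (p - 1)) * (C * Real.exp (-s * -(1 / (p - 1)))) := by gcongr
    _ = C * Real.exp (-s / (p - 1) + -s * -(1 / (p - 1))) := by rw [Real.exp_add]; ring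
    _ = C := by rw [show -s / (p - 1) + -s * -(1 / (p - 1)) = 0 by ring, Real.exp_zero, mul_one]

end MainEstimate

/-- Blow-up rate. -/
theorem stmt1 (n : ℕ) (hn : 1 ≤ n) (p : ℝ) (hp : 1 < p)
    (hpS : 3 ≤ n → p < ((n : ℝ) + 2) / ((n : ℝ) - 2)) (a : ℝ) (ha : 0 < a) (μ : ℝ)
    (T : ℝ) (hT : 0 < T) (u : EuclideanSpace ℝ (Fin n) → ℝ → ℝ)
    (hu : SolvesU n p a μ T u) :
    ∃ t₀ ∈ Set.Ico (0:ℝ) T, ∃ C > (0:ℝ),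
      (∀ t ∈ Set.Ico t₀ T, ∀ x, |u x t| ≤ C * (T - t) ^ (-(1 / (p - 1)))) ∧
      (∀ b : EuclideanSpace ℝ (Fin n), ∀ s : ℝ, -Real.log (T - t₀) ≤ s →
        ∀ y, |wSelf n p T u b y s| ≤ C) := by
  obtain ⟨C, hC, h⟩ := hu.exists_abs_le hp ha hT hpS
  refine ⟨0, ⟨le_rfl, hT⟩, C, hC, h, fun b s hs y => ?_⟩
  rw [sub_zero] at hs
  exact abs_wSelf_le hT h b y hs
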